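/- Let n ≥ 1, 0 < ρ ≤ 1 and 1 < p < ∞, and set m_p = n(1−ρ)|1/p − 1/2|. Let σ : 𝕋ⁿ × ℤⁿ → ℂ be a symbol, smooth in x, for which there is C > 0 such that |∂_x^β Δ_ξ^α σ(x,ξ)| ≤ C ⟨ξ⟩^{−m_p − ρ|α|} for all (x,ξ) ∈ 𝕋ⁿ × ℤⁿ and all multi-indices α, β with |α| ≤ [n/2]+1 and |β| ≤ [n/p]+1. Then the periodic pseudo-differential operator σ(x,D) extends to a bounded operator on L^p(𝕋ⁿ). -/

import Mathlib

open MeasureTheory Real ENNReal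

noncomputable section

/-- Partial derivative of a complex-valued function on `ℝⁿ` in the `j`-th coordinate
direction. -/
def pd {n : ℕ} (j : Fin n) (f : (Fin n → ℝ) → ℂ) : (Fin n → ℝ) → ℂ :=
  fun x => fderiv ℝ f x (Pi.single j 1)

/-- The canonical list of directions associated to a multi-index `β ∈ ℕⁿ`. -/
def mIdxList {n : ℕ} (β : Fin n → ℕ) : List (Fin n) :=
  (List.finRange n).flatMap fun j => List.replicate (β j) j

/-- Iterated partial derivative `∂^β` associated to a multi-index `β`. -/
def pdM {n : ℕ} (β : Fin n → ℕ) (f : (Fin n → ℝ) → ℂ) : (Fin n → ℝ) → ℂ :=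
  (mIdxList β).foldr pd f

/-- Forward difference operator in the `j`-th direction on functions of `ξ ∈ ℤⁿ`. -/
def dd {n : ℕ} (j : Fin n) (g : (Fin n → ℤ) → ℂ) : (Fin n → ℤ) → ℂ :=
  fun ξ => g (ξ + Pi.single j 1) - g ξ

/-- Iterated difference operator `Δ_ξ^α` associated to a multi-index `α`. -/
def ddM {n : ℕ} (α : Fin n → ℕ) (g : (Fin n → ℤ) → ℂ) : (Fin n → ℤ) → ℂ :=
  (mIdxList α).foldr dd g

/-- Japanese bracket `⟨ξ⟩ = (1+|ξ|²)^{1/2}` of a lattice point `ξ ∈ ℤⁿ`. -/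
def jb {n : ℕ} (ξ : Fin n → ℤ) : ℝ := Real.sqrt (1 + ∑ j, ((ξ j : ℝ)) ^ 2)

/-- Japanese bracket `⟨ξ⟩ = (1+|ξ|²)^{1/2}` of a vector `ξ ∈ ℝⁿ`. -/
def jbR {n : ℕ} (ξ : Fin n → ℝ) : ℝ := Real.sqrt (1 + ∑ j, (ξ j) ^ 2)

/-- The canonical embedding `ℤⁿ → ℝⁿ`. -/
def castZ {n : ℕ} (ξ : Fin n → ℤ) : Fin n → ℝ := fun j => (ξ j : ℝ)

/-- The fundamental domain `[0,1)ⁿ` of the torus `𝕋ⁿ = ℝⁿ/ℤⁿ`. -/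
def cube (n : ℕ) : Set (Fin n → ℝ) := Set.univ.pi fun _ => Set.Ico (0 : ℝ) 1

/-- The normalized Lebesgue measure of the torus `𝕋ⁿ`, realized as the Lebesgue measure
on `ℝⁿ` restricted to the fundamental domain `[0,1)ⁿ`. -/
def μT (n : ℕ) : Measure (Fin n → ℝ) := volume.restrict (cube n)

/-- `1`-periodicity of a function on `ℝⁿ` (i.e. the function descends to `𝕋ⁿ`). -/
def Per {n : ℕ} (f : (Fin n → ℝ) → ℂ) : Prop :=
  ∀ (x : Fin n → ℝ) (v : Fin n → ℤ), f (x + fun j => (v j : ℝ)) = f x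

/-- The character `e^{2πi⟨x,ξ⟩}`. -/
def eChar {n : ℕ} (x : Fin n → ℝ) (ξ : Fin n → ℤ) : ℂ :=
  Complex.exp (2 * (π : ℂ) * Complex.I * ∑ j, (x j : ℂ) * (ξ j : ℂ))

/-- Fourier coefficient `f̂(ξ) = ∫_{𝕋ⁿ} e^{-2πi⟨x,ξ⟩} f(x) dx` of a function on `𝕋ⁿ`. -/
def fc {n : ℕ} (f : (Fin n → ℝ) → ℂ) (ξ : Fin n → ℤ) : ℂ :=
  ∫ x, Complex.exp (-(2 * (π : ℂ) * Complex.I) * ∑ j, (x j : ℂ) * (ξ j : ℂ)) * f x ∂(μT n)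

/-- Periodic pseudo-differential operator
    `σ(x,D)f(x) = Σ_{ξ ∈ ℤⁿ} e^{2πi⟨x,ξ⟩} σ(x,ξ) f̂(ξ)`
with symbol `σ` on `𝕋ⁿ × ℤⁿ`. -/
def Op {n : ℕ} (σ : (Fin n → ℝ) → (Fin n → ℤ) → ℂ) (f : (Fin n → ℝ) → ℂ) :
    (Fin n → ℝ) → ℂ :=
  fun x => ∑' ξ : Fin n → ℤ, eChar x ξ * σ x ξ * fc f ξ

/-- The `L^p(𝕋ⁿ)` norm, for a real exponent `p`. -/
def lpT (n : ℕ) (p : ℝ) (g : (Fin n → ℝ) → ℂ) : ℝ :=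
  (∫ x, ‖g x‖ ^ p ∂(μT n)) ^ (1 / p)

/-- `∂_x^β Δ_ξ^α σ(x,ξ)` for a symbol `σ` on `𝕋ⁿ × ℤⁿ` (difference operator applied first,
then the derivatives in `x`). -/
def symbDxD {n : ℕ} (β α : Fin n → ℕ) (σ : (Fin n → ℝ) → (Fin n → ℤ) → ℂ)
    (x : Fin n → ℝ) (ξ : Fin n → ℤ) : ℂ :=
  pdM β (fun x' => ddM α (σ x') ξ) x

/-- `Δ_ξ^α ∂_x^β σ(x,ξ)` for a symbol `σ` on `𝕋ⁿ × ℤⁿ` (derivatives in `x` applied first,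
then the difference operator in `ξ`). -/
def symbDDx {n : ℕ} (α β : Fin n → ℕ) (σ : (Fin n → ℝ) → (Fin n → ℤ) → ℂ)
    (x : Fin n → ℝ) (ξ : Fin n → ℤ) : ℂ :=
  ddM α (fun ξ' => pdM β (fun x' => σ x' ξ') x) ξ

/-- `∂_ξ^α ∂_x^β σ(x,ξ)` for a symbol `σ` on `𝕋ⁿ × ℝⁿ` (derivatives in `x` applied first,
then the derivatives in `ξ`). -/
def symbDξDx {n : ℕ} (α β : Fin n → ℕ) (σ : (Fin n → ℝ) → (Fin n → ℝ) → ℂ)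
    (x ξ : Fin n → ℝ) : ℂ :=
  pdM α (fun ξ' => pdM β (fun x' => σ x' ξ') x) ξ

/-- `∂_x^β ∂_ξ^α σ(x,ξ)` for a symbol `σ` on `𝕋ⁿ × ℝⁿ` (derivatives in `ξ` applied first,
then the derivatives in `x`). -/
def symbDxDξ {n : ℕ} (β α : Fin n → ℕ) (σ : (Fin n → ℝ) → (Fin n → ℝ) → ℂ)
    (x ξ : Fin n → ℝ) : ℂ :=
  pdM β (fun x' => pdM α (σ x') ξ) x

/-- The Euclidean Fourier transform `û(ξ) = ∫_{ℝⁿ} e^{-2πi⟨x,ξ⟩} u(x) dx`. -/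
def FT {n : ℕ} (u : (Fin n → ℝ) → ℂ) (ξ : Fin n → ℝ) : ℂ :=
  ∫ x, Complex.exp (-(2 * (π : ℂ) * Complex.I) * ∑ j, (x j : ℂ) * (ξ j : ℂ)) * u x

/-- Pseudo-differential operator on `ℝⁿ`:
`T_σ u(x) = ∫_{ℝⁿ} e^{2πi⟨x,ξ⟩} σ(x,ξ) û(ξ) dξ`. -/
def OpR {n : ℕ} (σ : (Fin n → ℝ) → (Fin n → ℝ) → ℂ) (u : (Fin n → ℝ) → ℂ) :
    (Fin n → ℝ) → ℂ :=
  fun x => ∫ ξ, Complex.exp (2 * (π : ℂ) * Complex.I * ∑ j, (x j : ℂ) * (ξ j : ℂ)) * σ x ξ * FT u ξ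

/-- Periodic amplitude operator
`a(x,y,D)u(x) = ∫_{𝕋ⁿ} ∫_{ℝⁿ} e^{2πi⟨x-y,ξ⟩} a(x,y,ξ) u(y) dξ dy`. -/
def OpAmp {n : ℕ} (a : (Fin n → ℝ) → (Fin n → ℝ) → (Fin n → ℝ) → ℂ)
    (u : (Fin n → ℝ) → ℂ) : (Fin n → ℝ) → ℂ :=
  fun x => ∫ y,
    (∫ ξ, Complex.exp (2 * (π : ℂ) * Complex.I * ∑ j, ((x j : ℂ) - (y j : ℂ)) * (ξ j : ℂ)) *
        a x y ξ) * u y ∂(μT n)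

/-- The `L^p(ℝⁿ)` norm, for a real exponent `p`. -/
def lpR (n : ℕ) (p : ℝ) (g : (Fin n → ℝ) → ℂ) : ℝ :=
  (∫ x, ‖g x‖ ^ p) ^ (1 / p)

/-! ### Characters and finite Fourier analysis on the unit cube -/

theorem eChar_eq_prod {n : ℕ} (x : Fin n → ℝ) (ξ : Fin n → ℤ) :
    eChar x ξ = ∏ j, Complex.exp (2 * (π : ℂ) * Complex.I * ((x j : ℂ) * (ξ j : ℂ))) := by
  rw [eChar, Finset.mul_sum, Complex.exp_sum]

theorem eChar_add {n : ℕ} (x : Fin n → ℝ) (ξ η : Fin n → ℤ) :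
    eChar x (ξ + η) = eChar x ξ * eChar x η := by
  simp only [eChar, ← Complex.exp_add, ← mul_add, ← Finset.sum_add_distrib]
  push_cast [Pi.add_apply]
  rfl

theorem eChar_zero {n : ℕ} (x : Fin n → ℝ) : eChar x 0 = 1 := by simp [eChar]

theorem norm_eChar {n : ℕ} (x : Fin n → ℝ) (ξ : Fin n → ℤ) : ‖eChar x ξ‖ = 1 := by
  have : eChar x ξ = Complex.exp (((2 * π * ∑ j, x j * ξ j : ℝ) : ℂ) * Complex.I) := by
    rw [eChar]; push_cast; congr 1; ring
  rw [this, Complex.norm_exp_ofReal_mul_I]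

theorem conj_eChar {n : ℕ} (x : Fin n → ℝ) (ξ : Fin n → ℤ) :
    (starRingEnd ℂ) (eChar x ξ) = eChar x (-ξ) := by
  simp only [eChar, ← Complex.exp_conj, map_mul, map_sum, Complex.conj_I, Complex.conj_ofReal,
    Complex.conj_ofNat, Pi.neg_apply, Int.cast_neg, mul_neg, Finset.sum_neg_distrib]
  simp

theorem eChar_sub_left {n : ℕ} (x y : Fin n → ℝ) (ξ : Fin n → ℤ) :
    eChar (x - y) ξ = eChar x ξ * (starRingEnd ℂ) (eChar y ξ) := by
  rw [conj_eChar]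
  simp only [eChar, ← Complex.exp_add, ← mul_add, ← Finset.sum_add_distrib]
  congr 2
  refine Finset.sum_congr rfl fun j _ => ?_
  push_cast [Pi.sub_apply, Pi.neg_apply]
  ring

theorem continuous_eChar {n : ℕ} (ξ : Fin n → ℤ) :
    Continuous fun x : Fin n → ℝ => eChar x ξ := by
  unfold eChar; fun_prop

theorem contDiff_eChar {n : ℕ} (ξ : Fin n → ℤ) :
    ContDiff ℝ (⊤ : ℕ∞) fun x : Fin n → ℝ => eChar x ξ := by
  unfold eChar
  refine ContDiff.cexp (contDiff_const.mul (ContDiff.sum fun j _ => ContDiff.mul ?_ contDiff_const))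
  exact Complex.ofRealCLM.contDiff.comp (contDiff_apply ℝ ℝ j)

theorem measurableSet_cube (n : ℕ) : MeasurableSet (cube n) :=
  MeasurableSet.univ_pi fun _ => measurableSet_Ico

theorem μT_eq_pi (n : ℕ) :
    μT n = Measure.pi fun _ : Fin n => (volume : Measure ℝ).restrict (Set.Ico 0 1) := by
  rw [μT, cube, volume_pi, Measure.restrict_pi_pi]

instance isProbabilityMeasure_restrict_Ico :
    IsProbabilityMeasure ((volume : Measure ℝ).restrict (Set.Ico 0 1)) :=
  ⟨by simp⟩

instance isProbabilityMeasure_μT (n : ℕ) : IsProbabilityMeasure (μT n) := by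
  rw [μT_eq_pi]; infer_instance

theorem integral_eChar {n : ℕ} (ξ : Fin n → ℤ) :
    ∫ x, eChar x ξ ∂(μT n) = if ξ = 0 then 1 else 0 := by
  split_ifs with h
  · simp [h, eChar_zero]
  · simp only [eChar_eq_prod]
    rw [μT_eq_pi, integral_fintype_prod_eq_prod (𝕜 := ℂ)
      (f := fun j (t : ℝ) => Complex.exp (2 * (π : ℂ) * Complex.I * ((t : ℂ) * (ξ j : ℂ))))]
    obtain ⟨i, hi⟩ := Function.ne_iff.mp h
    refine Finset.prod_eq_zero (Finset.mem_univ i) ?_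
    rw [integral_Ico_eq_integral_Ioc, ← intervalIntegral.integral_of_le zero_le_one]
    have hc : (2 * (π : ℂ) * Complex.I * (ξ i : ℂ)) ≠ 0 := by
      have : (ξ i : ℂ) ≠ 0 := by exact_mod_cast hi
      simp [this, Real.pi_ne_zero]
    have := integral_exp_mul_complex (a := 0) (b := 1) hc
    simp only [mul_assoc, mul_comm (_ : ℂ) (ξ i : ℂ)] at this ⊢
    simp only [mul_left_comm (_ : ℂ) (ξ i : ℂ)] at this ⊢
    rw [this]
    have h1 : Complex.exp ((ξ i : ℂ) * (2 * (π * Complex.I))) = 1 := by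
      rw [Complex.exp_eq_one_iff]; exact ⟨ξ i, by ring⟩
    simp [h1]

theorem fc_eq {n : ℕ} (f : (Fin n → ℝ) → ℂ) (ξ : Fin n → ℤ) :
    fc f ξ = ∫ x, (starRingEnd ℂ) (eChar x ξ) * f x ∂(μT n) := by
  simp only [fc]
  congr 1; ext x; congr 1
  rw [conj_eChar, eChar]
  congr 1
  simp [Finset.sum_neg_distrib]

/-- Bounded measurable functions. -/
structure BddMeas {n : ℕ} (f : (Fin n → ℝ) → ℂ) : Prop where
  measurable : Measurable f
  bdd : ∃ M : ℝ, ∀ x, ‖f x‖ ≤ M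

namespace BddMeas

variable {n : ℕ} {f g : (Fin n → ℝ) → ℂ}

theorem exists_pos (hf : BddMeas f) : ∃ M : ℝ, 0 < M ∧ ∀ x, ‖f x‖ ≤ M := by
  obtain ⟨M, hM⟩ := hf.bdd
  exact ⟨max M 1, by positivity, fun x => (hM x).trans (le_max_left _ _)⟩

theorem integrable (hf : BddMeas f) : Integrable f (μT n) := by
  obtain ⟨M, hM⟩ := hf.bdd
  exact Integrable.of_bound hf.measurable.aestronglyMeasurable M (.of_forall hM)

theorem mul (hf : BddMeas f) (hg : BddMeas g) : BddMeas fun x => f x * g x := by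
  obtain ⟨M, hM0, hM⟩ := hf.exists_pos
  obtain ⟨N, hN⟩ := hg.bdd
  refine ⟨hf.measurable.mul hg.measurable, M * N, fun x => ?_⟩
  rw [norm_mul]
  exact mul_le_mul (hM x) (hN x) (norm_nonneg _) hM0.le

theorem add (hf : BddMeas f) (hg : BddMeas g) : BddMeas fun x => f x + g x := by
  obtain ⟨M, hM⟩ := hf.bdd
  obtain ⟨N, hN⟩ := hg.bdd
  exact ⟨hf.measurable.add hg.measurable, M + N, fun x =>
    (norm_add_le _ _).trans (add_le_add (hM x) (hN x))⟩

theorem const (c : ℂ) : BddMeas fun _ : Fin n → ℝ => c :=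
  ⟨measurable_const, ‖c‖, fun _ => le_rfl⟩

theorem sum {ι : Type*} (S : Finset ι) {F : ι → (Fin n → ℝ) → ℂ} (hF : ∀ i ∈ S, BddMeas (F i)) :
    BddMeas fun x => ∑ i ∈ S, F i x := by
  classical
  induction S using Finset.induction_on with
  | empty => simpa using const 0
  | insert a S ha ih =>
    simp only [Finset.sum_insert ha]
    exact (hF a (by simp)).add (ih fun i hi => hF i (by simp [hi]))

theorem conj (hf : BddMeas f) : BddMeas fun x => (starRingEnd ℂ) (f x) := by
  obtain ⟨M, hM⟩ := hf.bdd
  exact ⟨Complex.continuous_conj.measurable.comp hf.measurable, M, fun x => by simpa using hM x⟩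

theorem indicator (hf : BddMeas f) {E : Set (Fin n → ℝ)} (hE : MeasurableSet E) :
    BddMeas (E.indicator f) := by
  obtain ⟨M, hM⟩ := hf.bdd
  exact ⟨hf.measurable.indicator hE, M, fun x => (norm_indicator_le_norm_self f x).trans (hM x)⟩

theorem eChar (ξ : Fin n → ℤ) : BddMeas fun x : Fin n → ℝ => eChar x ξ :=
  ⟨(continuous_eChar ξ).measurable, 1, fun x => (norm_eChar x ξ).le⟩

theorem integrable_norm_rpow (hf : BddMeas f) {p : ℝ} (hp : 0 ≤ p) :
    Integrable (fun x => ‖f x‖ ^ p) (μT n) := by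
  obtain ⟨M, hM⟩ := hf.bdd
  refine Integrable.of_bound (C := M ^ p) ?_ (.of_forall fun x => ?_)
  · exact (hf.measurable.norm.pow_const p).aestronglyMeasurable
  · rw [Real.norm_of_nonneg (by positivity)]
    exact Real.rpow_le_rpow (norm_nonneg _) (hM x) hp

theorem integrable_norm_sq (hf : BddMeas f) : Integrable (fun x => ‖f x‖ ^ 2) (μT n) := by
  simpa using hf.integrable_norm_rpow (p := 2) (by norm_num)

end BddMeas

/-- The trigonometric polynomial with coefficients `a`, for `a` of finite support. -/
def trig {n : ℕ} (a : (Fin n → ℤ) → ℂ) (x : Fin n → ℝ) : ℂ := ∑' ξ, a ξ * eChar x ξ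

theorem trig_eq_sum {n : ℕ} {a : (Fin n → ℤ) → ℂ} {S : Finset (Fin n → ℤ)}
    (hS : ∀ ξ ∉ S, a ξ = 0) (x : Fin n → ℝ) : trig a x = ∑ ξ ∈ S, a ξ * eChar x ξ :=
  tsum_eq_sum fun ξ hξ => by rw [hS ξ hξ, zero_mul]

theorem eq_zero_of_notMem_toFinset {n : ℕ} {a : (Fin n → ℤ) → ℂ} (ha : a.support.Finite) :
    ∀ ξ ∉ ha.toFinset, a ξ = 0 := by
  intro ξ hξ; simpa using hξ

theorem BddMeas.trig {n : ℕ} {a : (Fin n → ℤ) → ℂ} (ha : a.support.Finite) :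
    BddMeas (_root_.trig a) := by
  have : _root_.trig a = fun x => ∑ ξ ∈ ha.toFinset, a ξ * _root_.eChar x ξ :=
    funext fun x => trig_eq_sum (eq_zero_of_notMem_toFinset ha) x
  rw [this]
  exact BddMeas.sum _ fun ξ _ => (BddMeas.const _).mul (BddMeas.eChar ξ)

theorem contDiff_trig {n : ℕ} {a : (Fin n → ℤ) → ℂ} (ha : a.support.Finite) :
    ContDiff ℝ (⊤ : ℕ∞) (trig a) := by
  have : trig a = fun x => ∑ ξ ∈ ha.toFinset, a ξ * _root_.eChar x ξ :=
    funext fun x => trig_eq_sum (eq_zero_of_notMem_toFinset ha) x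
  rw [this]
  exact ContDiff.sum fun ξ _ => contDiff_const.mul (contDiff_eChar ξ)

/-- Pairing of a trigonometric polynomial with a bounded function. -/
theorem integral_trig_mul_conj {n : ℕ} {a : (Fin n → ℤ) → ℂ} {S : Finset (Fin n → ℤ)}
    (hS : ∀ ξ ∉ S, a ξ = 0) {g : (Fin n → ℝ) → ℂ} (hg : BddMeas g) :
    ∫ x, trig a x * (starRingEnd ℂ) (g x) ∂(μT n) = ∑ ξ ∈ S, a ξ * (starRingEnd ℂ) (fc g ξ) := by
  simp only [trig_eq_sum hS, Finset.sum_mul]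
  rw [integral_finsetSum]
  · refine Finset.sum_congr rfl fun ξ _ => ?_
    rw [fc_eq, ← integral_conj, ← integral_const_mul]
    congr 1; ext x; simp; ring
  · intro ξ _
    exact (((BddMeas.const (a ξ)).mul (BddMeas.eChar ξ)).mul hg.conj).integrable

theorem fc_trig {n : ℕ} {a : (Fin n → ℤ) → ℂ} (ha : a.support.Finite) (η : Fin n → ℤ) :
    fc (trig a) η = a η := by
  classical
  have hS := eq_zero_of_notMem_toFinset ha
  rw [fc_eq]
  simp only [trig_eq_sum hS, Finset.mul_sum]
  rw [integral_finsetSum]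
  · have : ∀ ξ ∈ ha.toFinset, ∫ x, (starRingEnd ℂ) (eChar x η) * (a ξ * eChar x ξ) ∂(μT n)
        = if ξ = η then a ξ else 0 := by
      intro ξ _
      have h1 : ∀ x : Fin n → ℝ, (starRingEnd ℂ) (eChar x η) * (a ξ * eChar x ξ)
          = a ξ * eChar x (ξ - η) := by
        intro x; rw [conj_eChar, sub_eq_add_neg, eChar_add]; ring
      simp only [h1]
      rw [integral_const_mul, integral_eChar]
      simp [sub_eq_zero]
    rw [Finset.sum_congr rfl this, Finset.sum_ite_eq']
    split_ifs with h
    · rfl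
    · exact (hS _ h).symm
  · intro ξ _
    exact ((BddMeas.eChar η).conj.mul ((BddMeas.const _).mul (BddMeas.eChar ξ))).integrable

/-- Parseval's identity for trigonometric polynomials. -/
theorem integral_norm_sq_trig {n : ℕ} {a : (Fin n → ℤ) → ℂ} {S : Finset (Fin n → ℤ)}
    (hS : ∀ ξ ∉ S, a ξ = 0) : ∫ x, ‖trig a x‖ ^ 2 ∂(μT n) = ∑ ξ ∈ S, ‖a ξ‖ ^ 2 := by
  have ha : a.support.Finite := S.finite_toSet.subset fun ξ hξ => by
    by_contra h; exact hξ (hS ξ (by simpa using h))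
  have h := integral_trig_mul_conj hS (BddMeas.trig ha)
  simp only [fc_trig ha, Complex.mul_conj, Complex.normSq_eq_norm_sq] at h
  have hcast : ((∫ x, ‖trig a x‖ ^ 2 ∂(μT n) : ℝ) : ℂ) = ((∑ ξ ∈ S, ‖a ξ‖ ^ 2 : ℝ) : ℂ) := by
    rw [← integral_complex_ofReal]
    push_cast
    exact_mod_cast h
  exact_mod_cast hcast

/-- Bessel's inequality. -/
theorem sum_norm_sq_fc_le {n : ℕ} {g : (Fin n → ℝ) → ℂ} (hg : BddMeas g)
    (S : Finset (Fin n → ℤ)) : ∑ ξ ∈ S, ‖fc g ξ‖ ^ 2 ≤ ∫ x, ‖g x‖ ^ 2 ∂(μT n) := by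
  classical
  set a : (Fin n → ℤ) → ℂ := fun ξ => if ξ ∈ S then fc g ξ else 0 with ha
  have hS : ∀ ξ ∉ S, a ξ = 0 := fun ξ hξ => by simp [ha, hξ]
  have haf : a.support.Finite := S.finite_toSet.subset fun ξ hξ => by
    by_contra h; exact hξ (hS ξ (by simpa using h))
  have h1 := integral_norm_sq_trig hS
  have h2 := integral_trig_mul_conj hS hg
  have h3 : ∑ ξ ∈ S, a ξ * (starRingEnd ℂ) (fc g ξ) = ((∑ ξ ∈ S, ‖fc g ξ‖ ^ 2 : ℝ) : ℂ) := by
    push_cast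
    refine Finset.sum_congr rfl fun ξ hξ => ?_
    simp [ha, hξ, Complex.mul_conj, Complex.normSq_eq_norm_sq]
  have h1' : ∑ ξ ∈ S, ‖a ξ‖ ^ 2 = ∑ ξ ∈ S, ‖fc g ξ‖ ^ 2 :=
    Finset.sum_congr rfl fun ξ hξ => by simp [ha, hξ]
  rw [h3] at h2
  rw [h1'] at h1
  have hT := BddMeas.trig haf
  have h4 : ∫ x, (trig a x * (starRingEnd ℂ) (g x)).re ∂(μT n) = ∑ ξ ∈ S, ‖fc g ξ‖ ^ 2 := by
    have := congrArg Complex.re h2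
    rw [Complex.ofReal_re] at this
    rw [← this]
    exact integral_re (hT.mul hg.conj).integrable
  have h5 : 0 ≤ ∫ x, ‖g x - trig a x‖ ^ 2 ∂(μT n) := integral_nonneg fun x => by positivity
  have h6 : ∀ x, ‖g x - trig a x‖ ^ 2
      = ‖g x‖ ^ 2 + ‖trig a x‖ ^ 2 - 2 * (trig a x * (starRingEnd ℂ) (g x)).re := by
    intro x
    simp only [← Complex.normSq_eq_norm_sq, Complex.normSq_sub]
    rw [← Complex.conj_re (trig a x * _)]
    simp [mul_comm]
  simp only [h6] at h5
  have hint : Integrable (fun x => (trig a x * (starRingEnd ℂ) (g x)).re) (μT n) :=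
    (hT.mul hg.conj).integrable.re
  rw [integral_sub (by exact hg.integrable_norm_sq.add hT.integrable_norm_sq) (hint.const_mul 2),
    integral_add hg.integrable_norm_sq hT.integrable_norm_sq, integral_const_mul] at h5
  linarith

/-- A Fourier multiplier with finitely supported symbol is a convolution operator. -/
theorem trig_mul_fc {n : ℕ} {a : (Fin n → ℤ) → ℂ} (ha : a.support.Finite)
    {g : (Fin n → ℝ) → ℂ} (hg : BddMeas g) (x : Fin n → ℝ) :
    trig (fun ξ => a ξ * fc g ξ) x = ∫ y, trig a (x - y) * g y ∂(μT n) := by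
  have hS := eq_zero_of_notMem_toFinset ha
  rw [trig_eq_sum (S := ha.toFinset) (fun ξ hξ => by rw [hS ξ hξ, zero_mul])]
  simp only [trig_eq_sum hS, Finset.sum_mul]
  rw [integral_finsetSum]
  · refine Finset.sum_congr rfl fun ξ _ => ?_
    rw [fc_eq, mul_right_comm, ← integral_const_mul]
    congr 1; ext y; rw [eChar_sub_left]; ring
  · intro ξ _
    simp only [eChar_sub_left]
    exact (((BddMeas.const (a ξ)).mul ((BddMeas.const (eChar x ξ)).mul
      (BddMeas.eChar ξ).conj)).mul hg).integrable

theorem integral_norm_sq_trig_sub {n : ℕ} {a : (Fin n → ℤ) → ℂ} {S : Finset (Fin n → ℤ)}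
    (hS : ∀ ξ ∉ S, a ξ = 0) (x : Fin n → ℝ) :
    ∫ y, ‖trig a (x - y)‖ ^ 2 ∂(μT n) = ∑ ξ ∈ S, ‖a ξ‖ ^ 2 := by
  have hS' : ∀ ξ ∉ S, (starRingEnd ℂ) (a ξ * eChar x ξ) = 0 := fun ξ hξ => by simp [hS ξ hξ]
  have h := integral_norm_sq_trig hS'
  have h2 : ∀ y, ‖trig a (x - y)‖ = ‖trig (fun ξ => (starRingEnd ℂ) (a ξ * eChar x ξ)) y‖ := by
    intro y
    rw [← Complex.norm_conj, trig_eq_sum hS, trig_eq_sum hS', map_sum]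
    congr 1
    refine Finset.sum_congr rfl fun ξ _ => ?_
    rw [eChar_sub_left]; simp; ring
  simp only [h2, h]
  refine Finset.sum_congr rfl fun ξ _ => ?_
  rw [Complex.norm_conj, norm_mul, norm_eChar, mul_one]

/-! ### Kernel estimates -/

/-- Chordal distance on the circle `ℝ/ℤ`. -/
def chord (s t : ℝ) : ℝ := 2 * |Real.sin (π * (s - t))|

theorem chord_nonneg (s t : ℝ) : 0 ≤ chord s t := by unfold chord; positivity

theorem chord_eq_norm (s t : ℝ) :
    chord s t = ‖Complex.exp (2 * π * Complex.I * s) - Complex.exp (2 * π * Complex.I * t)‖ := by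
  have h1 : Complex.exp (2 * π * Complex.I * s) - Complex.exp (2 * π * Complex.I * t)
      = Complex.exp (((2 * π * t : ℝ) : ℂ) * Complex.I) *
        (Complex.exp (Complex.I * ((2 * π * (s - t) : ℝ) : ℂ)) - 1) := by
    rw [mul_sub, ← Complex.exp_add, mul_one]
    push_cast
    congr 2 <;> ring
  rw [h1, norm_mul, Complex.norm_exp_ofReal_mul_I, one_mul, Complex.norm_exp_I_mul_ofReal_sub_one]
  rw [chord, Real.norm_eq_abs, abs_mul, abs_two]
  congr 3; ring

theorem chord_triangle (s t u : ℝ) : chord s u ≤ chord s t + chord t u := by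
  simp only [chord_eq_norm]; exact norm_sub_le_norm_sub_add_norm_sub _ _ _

theorem chord_le (s t : ℝ) : chord s t ≤ 2 * π * |s - t| := by
  unfold chord
  have := Real.abs_sin_le_abs (x := π * (s - t))
  rw [abs_mul, abs_of_pos Real.pi_pos] at this
  nlinarith

theorem continuous_chord : Continuous fun q : ℝ × ℝ => chord q.1 q.2 := by
  unfold chord; fun_prop

theorem exists_integral_chord_le {β : ℝ} (hβ : 1 < β) :
    ∃ C : ℝ, 0 < C ∧ ∀ R : ℝ, 0 < R → ∀ s : ℝ,
      ∫ t in Set.Ico (0 : ℝ) 1, (1 + R * chord s t) ^ (-β) ≤ C / R := by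
  have hint : Integrable (fun v : ℝ => (1 + ‖v‖) ^ (-β)) :=
    integrable_one_add_norm (by simpa using hβ)
  set I := ∫ v : ℝ, (1 + ‖v‖) ^ (-β) with hI
  have hI0 : 0 ≤ I := integral_nonneg fun v => by positivity
  refine ⟨I + 1, by positivity, fun R hR s => ?_⟩
  have hper : Function.Periodic (fun u : ℝ => (1 + R * (2 * |Real.sin (π * u)|)) ^ (-β)) 1 := by
    intro u
    simp only [mul_add, mul_one, Real.sin_add_pi, abs_neg]
  have hcont : Continuous (fun u : ℝ => (1 + R * (2 * |Real.sin (π * u)|)) ^ (-β)) := by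
    refine Continuous.rpow_const (by fun_prop) fun u => Or.inl ?_
    positivity
  rw [integral_Ico_eq_integral_Ioc, ← intervalIntegral.integral_of_le zero_le_one]
  simp only [chord]
  rw [intervalIntegral.integral_comp_sub_left
    (fun u : ℝ => (1 + R * (2 * |Real.sin (π * u)|)) ^ (-β)) s]
  have h1 := hper.intervalIntegral_add_eq (s - 1) (-(1 / 2))
  rw [sub_add_cancel, show (-(1 / 2) : ℝ) + 1 = 1 / 2 by norm_num] at h1
  rw [sub_zero, h1, intervalIntegral.integral_of_le (by norm_num)]
  have hint2 : Integrable (fun u : ℝ => (1 + ‖4 * R * u‖) ^ (-β)) :=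
    hint.comp_mul_left' (by positivity)
  calc ∫ u in Set.Ioc (-(1 / 2) : ℝ) (1 / 2), (1 + R * (2 * |Real.sin (π * u)|)) ^ (-β)
      ≤ ∫ u in Set.Ioc (-(1 / 2) : ℝ) (1 / 2), (1 + ‖4 * R * u‖) ^ (-β) := by
        refine setIntegral_mono_on ?_ hint2.integrableOn measurableSet_Ioc fun u hu => ?_
        · exact (hcont.integrableOn_Icc).mono_set Set.Ioc_subset_Icc_self
        · refine Real.rpow_le_rpow_of_nonpos (by positivity) ?_ (by linarith)
          have hu' : |π * u| ≤ π / 2 := by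
            rw [abs_mul, abs_of_pos Real.pi_pos]
            have : |u| ≤ 1 / 2 := abs_le.2 ⟨hu.1.le, hu.2⟩
            nlinarith [Real.pi_pos]
          have := Real.mul_abs_le_abs_sin hu'
          rw [abs_mul, abs_of_pos Real.pi_pos] at this
          have h2 : 2 / π * (π * |u|) = 2 * |u| := by field_simp
          rw [Real.norm_eq_abs, abs_mul, abs_of_pos (by positivity : 0 < 4 * R)]
          nlinarith
    _ ≤ ∫ u : ℝ, (1 + ‖4 * R * u‖) ^ (-β) :=
        setIntegral_le_integral hint2 (.of_forall fun u => by positivity)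
    _ = (4 * R)⁻¹ * I := by
        rw [Measure.integral_comp_mul_left (fun v : ℝ => (1 + ‖v‖) ^ (-β)) (4 * R), smul_eq_mul,
          abs_of_pos (by positivity)]
    _ ≤ (I + 1) / R := by
        rw [mul_inv, div_eq_mul_inv]
        have : 0 < R⁻¹ := by positivity
        nlinarith

/-- The weight `∏ₗ (1 + R |xₗ - yₗ|)` on the torus. -/
def kw {n : ℕ} (R : ℝ) (x y : Fin n → ℝ) : ℝ := ∏ l, (1 + R * chord (x l) (y l))

theorem one_le_kw {n : ℕ} {R : ℝ} (hR : 0 ≤ R) (x y : Fin n → ℝ) : 1 ≤ kw R x y := by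
  unfold kw
  calc (1 : ℝ) = ∏ _l : Fin n, (1 : ℝ) := by simp
    _ ≤ _ := Finset.prod_le_prod (fun _ _ => zero_le_one) fun l _ => by
      have := mul_nonneg hR (chord_nonneg (x l) (y l)); linarith

theorem le_kw {n : ℕ} {R : ℝ} (hR : 0 ≤ R) (x y : Fin n → ℝ) (l : Fin n) :
    1 + R * chord (x l) (y l) ≤ kw R x y := by
  have hc := fun l => mul_nonneg hR (chord_nonneg (x l) (y l))
  unfold kw
  rw [← Finset.mul_prod_erase _ _ (Finset.mem_univ l)]
  refine le_mul_of_one_le_right (by linarith [hc l]) ?_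
  calc (1 : ℝ) = ∏ _l ∈ Finset.univ.erase l, (1 : ℝ) := by simp
    _ ≤ _ := Finset.prod_le_prod (fun _ _ => zero_le_one) fun l _ => by linarith [hc l]

theorem continuous_kw {n : ℕ} (R : ℝ) (x : Fin n → ℝ) : Continuous fun y => kw R x y := by
  unfold kw chord; fun_prop

theorem exists_integral_kw_le (n : ℕ) {β : ℝ} (hβ : 1 < β) :
    ∃ C : ℝ, 0 < C ∧ ∀ R : ℝ, 0 < R → ∀ x : Fin n → ℝ,
      ∫ y, kw R x y ^ (-β) ∂(μT n) ≤ C * R ^ (-(n : ℝ)) := by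
  obtain ⟨C, hC, h⟩ := exists_integral_chord_le hβ
  refine ⟨C ^ n, by positivity, fun R hR x => ?_⟩
  have h1 : ∀ y : Fin n → ℝ, kw R x y ^ (-β) = ∏ l, (1 + R * chord (x l) (y l)) ^ (-β) := by
    intro y
    rw [kw, Real.finsetProd_rpow]
    intro l _
    have := chord_nonneg (x l) (y l); positivity
  simp only [h1]
  rw [μT_eq_pi, integral_fintype_prod_eq_prod (𝕜 := ℝ)
    (f := fun l t => (1 + R * chord (x l) t) ^ (-β))]
  calc _ ≤ ∏ _l : Fin n, C / R := Finset.prod_le_prod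
        (fun l _ => integral_nonneg fun t => by
          have := chord_nonneg (x l) t; positivity)
        (fun l _ => h R hR (x l))
    _ = C ^ n * R ^ (-(n : ℝ)) := by
        rw [Finset.prod_const, Finset.card_univ, Fintype.card_fin, div_pow, Real.rpow_neg hR.le,
          Real.rpow_natCast, div_eq_mul_inv]

theorem kw_rpow_le {n : ℕ} (hn : 1 ≤ n) {R : ℝ} (hR : 0 < R) (x y : Fin n → ℝ) :
    kw R x y ^ (1 + 1 / (n : ℝ)) ≤ 2 ^ (2 * (n / 2 + 1)) *
      (1 + ∑ l, (R * chord (x l) (y l)) ^ (2 * (n / 2 + 1))) := by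
  have hn0 : (0 : ℝ) < n := by exact_mod_cast hn
  have : Nonempty (Fin n) := ⟨⟨0, hn⟩⟩
  obtain ⟨l₀, hl₀⟩ := Finite.exists_max fun l => R * chord (x l) (y l)
  set t := R * chord (x l₀) (y l₀) with ht
  have hc := chord_nonneg (x l₀) (y l₀)
  have ht0 : 0 ≤ t := by positivity
  have h1 : kw R x y ≤ (1 + t) ^ n := by
    calc kw R x y ≤ ∏ _l : Fin n, (1 + t) := Finset.prod_le_prod
          (fun l _ => by have := chord_nonneg (x l) (y l); positivity)
          (fun l _ => by have := hl₀ l; linarith)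
      _ = _ := by simp
  have h0 : 0 ≤ kw R x y := zero_le_one.trans (one_le_kw hR.le x y)
  calc kw R x y ^ (1 + 1 / (n : ℝ)) ≤ ((1 + t) ^ n) ^ (1 + 1 / (n : ℝ)) :=
        Real.rpow_le_rpow h0 h1 (by positivity)
    _ = (1 + t) ^ (n + 1) := by
        rw [← Real.rpow_natCast (1 + t) n, ← Real.rpow_mul (by positivity),
          ← Real.rpow_natCast]
        congr 1; push_cast; field_simp
    _ ≤ (1 + t) ^ (2 * (n / 2 + 1)) := pow_le_pow_right₀ (by linarith) (by omega)
    _ ≤ 2 ^ (2 * (n / 2 + 1)) * (1 + t ^ (2 * (n / 2 + 1))) := by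
        refine (add_pow_le zero_le_one ht0 _).trans ?_
        rw [one_pow]
        gcongr
        · norm_num
        · omega
    _ ≤ _ := by
        gcongr
        exact Finset.single_le_sum (f := fun l => (R * chord (x l) (y l)) ^ (2 * (n / 2 + 1)))
          (fun l _ => by have := chord_nonneg (x l) (y l); positivity) (Finset.mem_univ l₀)

theorem finite_support_dd {n : ℕ} {a : (Fin n → ℤ) → ℂ} (ha : a.support.Finite) (l : Fin n) :
    (dd l a).support.Finite := by
  refine ((ha.preimage (f := fun ξ => ξ + Pi.single l 1)
    fun _ _ _ _ h => add_right_cancel h).union ha).subset fun ξ hξ => ?_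
  by_contra h
  simp only [Set.mem_union, Set.mem_preimage, Function.mem_support, not_or, not_not] at h
  exact hξ (by simp [dd, h.1, h.2])

theorem finite_support_dd_iterate {n : ℕ} {a : (Fin n → ℤ) → ℂ} (ha : a.support.Finite)
    (l : Fin n) (i : ℕ) : ((dd l)^[i] a).support.Finite := by
  induction i with
  | zero => exact ha
  | succ i ih => rw [Function.iterate_succ_apply']; exact finite_support_dd ih l

theorem trig_dd {n : ℕ} {a : (Fin n → ℤ) → ℂ} (ha : a.support.Finite) (l : Fin n)
    (x : Fin n → ℝ) :
    trig (dd l a) x = (eChar x (-Pi.single l 1) - 1) * trig a x := by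
  have hsum : ∀ b : (Fin n → ℤ) → ℂ, b.support.Finite → Summable fun ξ => b ξ * eChar x ξ :=
    fun b hb => summable_of_hasFiniteSupport (hb.subset fun ξ hξ => left_ne_zero_of_mul hξ)
  have ha' : (fun ξ => a (ξ + Pi.single l 1)).support.Finite :=
    ha.preimage (f := fun ξ => ξ + Pi.single l 1) fun _ _ _ _ h => add_right_cancel h
  have h1 : ∑' ξ, a (ξ + Pi.single l 1) * eChar x ξ
      = eChar x (-Pi.single l 1) * ∑' ξ, a ξ * eChar x ξ := by
    rw [← tsum_mul_left, ← (Equiv.addRight (Pi.single l (1 : ℤ))).tsum_eq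
      (fun ξ => eChar x (-Pi.single l 1) * (a ξ * eChar x ξ))]
    congr 1; ext ξ
    simp only [Equiv.coe_addRight]
    rw [mul_left_comm, ← eChar_add]
    congr 2; abel
  simp only [trig, dd, sub_mul, one_mul]
  rw [(hsum _ ha').tsum_sub (hsum a ha), h1]

theorem trig_dd_iterate {n : ℕ} {a : (Fin n → ℤ) → ℂ} (ha : a.support.Finite) (l : Fin n)
    (i : ℕ) (x : Fin n → ℝ) :
    trig ((dd l)^[i] a) x = (eChar x (-Pi.single l 1) - 1) ^ i * trig a x := by
  induction i with
  | zero => simp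
  | succ i ih =>
    rw [Function.iterate_succ_apply', trig_dd (finite_support_dd_iterate ha l i), ih]; ring

theorem eChar_single {n : ℕ} (x : Fin n → ℝ) (l : Fin n) :
    eChar x (Pi.single l 1) = Complex.exp (2 * π * Complex.I * x l) := by
  rw [eChar]; congr 2
  rw [Finset.sum_eq_single l]
  · simp
  · intro j _ hj; simp [Pi.single_eq_of_ne hj]
  · simp

theorem norm_eChar_sub_one {n : ℕ} (x y : Fin n → ℝ) (l : Fin n) :
    ‖eChar (x - y) (-Pi.single l 1) - 1‖ = chord (x l) (y l) := by
  rw [← conj_eChar, ← Complex.norm_conj, map_sub, Complex.conj_conj, map_one, eChar_sub_left,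
    chord_eq_norm, ← eChar_single, ← eChar_single]
  have : eChar x (Pi.single l 1) - eChar y (Pi.single l 1) =
      eChar y (Pi.single l 1) *
        (eChar x (Pi.single l 1) * (starRingEnd ℂ) (eChar y (Pi.single l 1)) - 1) := by
    rw [mul_sub, mul_left_comm, Complex.mul_conj, Complex.normSq_eq_norm_sq, norm_eChar]; simp
  rw [this, norm_mul, norm_eChar, one_mul]

/-- `L²` bounds on a symbol and its differences of order `[n/2]+1`. -/
structure SymL2 {n : ℕ} (V R : ℝ) (a : (Fin n → ℤ) → ℂ) : Prop where
  finite : a.support.Finite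
  sum_le : ∀ S : Finset (Fin n → ℤ), ∑ ξ ∈ S, ‖a ξ‖ ^ 2 ≤ V ^ 2
  sum_dd_le : ∀ l, ∀ S : Finset (Fin n → ℤ),
    R ^ (2 * (n / 2 + 1)) * ∑ ξ ∈ S, ‖(dd l)^[n / 2 + 1] a ξ‖ ^ 2 ≤ V ^ 2

theorem SymL2.integral_kernel_le {n : ℕ} (hn : 1 ≤ n) {V R : ℝ} (hR : 0 < R)
    {a : (Fin n → ℤ) → ℂ} (ha : SymL2 V R a) (x : Fin n → ℝ) :
    ∫ y, ‖trig a (x - y)‖ ^ 2 * kw R x y ^ (1 + 1 / (n : ℝ)) ∂(μT n)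
      ≤ 2 ^ (2 * (n / 2 + 1)) * (1 + n) * V ^ 2 := by
  set s := n / 2 + 1 with hs
  have hcont : ∀ b : (Fin n → ℤ) → ℂ, b.support.Finite →
      Continuous fun y => trig b (x - y) := fun b hb =>
    (contDiff_trig hb).continuous.comp (by fun_prop)
  have hbm : ∀ b : (Fin n → ℤ) → ℂ, b.support.Finite →
      BddMeas fun y => trig b (x - y) := by
    intro b hb
    obtain ⟨M, hM⟩ := (BddMeas.trig hb).bdd
    exact ⟨(hcont b hb).measurable, M, fun y => hM _⟩
  have hkey : ∀ y, ‖trig a (x - y)‖ ^ 2 * kw R x y ^ (1 + 1 / (n : ℝ)) ≤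
      2 ^ (2 * s) * (‖trig a (x - y)‖ ^ 2 +
        ∑ l, R ^ (2 * s) * ‖trig ((dd l)^[s] a) (x - y)‖ ^ 2) := by
    intro y
    have h1 := kw_rpow_le hn hR x y
    rw [← hs] at h1
    have h2 : ∀ l, R ^ (2 * s) * ‖trig ((dd l)^[s] a) (x - y)‖ ^ 2
        = ‖trig a (x - y)‖ ^ 2 * (R * chord (x l) (y l)) ^ (2 * s) := by
      intro l
      rw [trig_dd_iterate ha.finite, norm_mul, norm_pow, norm_eChar_sub_one, mul_pow, mul_pow,
        ← pow_mul, mul_comm s 2]; ring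
    simp only [h2]
    rw [← Finset.mul_sum]
    calc _ ≤ ‖trig a (x - y)‖ ^ 2 *
          (2 ^ (2 * s) * (1 + ∑ l, (R * chord (x l) (y l)) ^ (2 * s))) := by gcongr
      _ = _ := by ring
  have hi1 : Integrable (fun y => ‖trig a (x - y)‖ ^ 2) (μT n) :=
    (hbm a ha.finite).integrable_norm_sq
  have hi2 : ∀ l, Integrable (fun y => R ^ (2 * s) * ‖trig ((dd l)^[s] a) (x - y)‖ ^ 2) (μT n) :=
    fun l => (hbm _ (finite_support_dd_iterate ha.finite l s)).integrable_norm_sq.const_mul _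
  have hi3 : Integrable (fun y => ∑ l, R ^ (2 * s) * ‖trig ((dd l)^[s] a) (x - y)‖ ^ 2) (μT n) :=
    integrable_finsetSum _ fun l _ => hi2 l
  have hcomp : ∀ b : (Fin n → ℤ) → ℂ, ∀ hb : b.support.Finite,
      ∫ y, ‖trig b (x - y)‖ ^ 2 ∂(μT n) = ∑ ξ ∈ hb.toFinset, ‖b ξ‖ ^ 2 := fun b hb =>
    integral_norm_sq_trig_sub (eq_zero_of_notMem_toFinset hb) x
  calc _ ≤ ∫ y, 2 ^ (2 * s) * (‖trig a (x - y)‖ ^ 2 +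
        ∑ l, R ^ (2 * s) * ‖trig ((dd l)^[s] a) (x - y)‖ ^ 2) ∂(μT n) := by
        refine integral_mono_of_nonneg (.of_forall fun y => ?_) ((hi1.add hi3).const_mul _)
          (.of_forall hkey)
        have := one_le_kw hR.le x y
        positivity
    _ = 2 ^ (2 * s) * (∑ ξ ∈ ha.finite.toFinset, ‖a ξ‖ ^ 2 + ∑ l, R ^ (2 * s) *
          ∑ ξ ∈ (finite_support_dd_iterate ha.finite l s).toFinset, ‖(dd l)^[s] a ξ‖ ^ 2) := by
        rw [integral_const_mul, integral_add hi1 hi3, hcomp a ha.finite,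
          integral_finsetSum _ fun l _ => hi2 l]
        congr 2
        refine Finset.sum_congr rfl fun l _ => ?_
        rw [integral_const_mul, hcomp]
    _ ≤ 2 ^ (2 * s) * (V ^ 2 + ∑ _l : Fin n, V ^ 2) := by
        gcongr with l
        · exact ha.sum_le _
        · exact ha.sum_dd_le l _
    _ = _ := by simp; ring

/-- Pointwise bound for a Fourier multiplier applied to a bounded function supported away from the
point of evaluation. -/
theorem exists_norm_multiplier_le (n : ℕ) (hn : 1 ≤ n) :
    ∃ C : ℝ, 0 < C ∧ ∀ V R : ℝ, 0 < V → 0 < R → ∀ a : (Fin n → ℤ) → ℂ, SymL2 V R a →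
      ∀ (x : Fin n → ℝ) (r N : ℝ), 0 ≤ r → 0 ≤ N → ∀ g : (Fin n → ℝ) → ℂ, BddMeas g →
        (∀ y, ‖g y‖ ≤ N) → (∀ y, g y ≠ 0 → ∃ l, r ≤ chord (x l) (y l)) →
        ‖trig (fun ξ => a ξ * fc g ξ) x‖ ≤
          C * V * R ^ (-((n : ℝ) / 2)) * (1 + R * r) ^ (-(1 / (4 * (n : ℝ)))) * N := by
  have hn0 : (0 : ℝ) < n := by exact_mod_cast hn
  obtain ⟨C, hC, hkw⟩ := exists_integral_kw_le n
    (show (1 : ℝ) < 1 + 1 / (2 * n) by have : 0 < 1 / (2 * (n : ℝ)) := by positivity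
                                       linarith)
  set D : ℝ := 2 ^ (2 * (n / 2 + 1)) * (1 + n) with hD
  refine ⟨D + C, by positivity, fun V R hV hR a ha x r N hr hN g hg hgN hgr => ?_⟩
  rw [trig_mul_fc ha.finite hg]
  set Q := R ^ (-((n : ℝ) / 2)) with hQ
  set P := (1 + R * r) ^ (-(1 / (4 * (n : ℝ)))) with hP
  have hQ0 : 0 < Q := by positivity
  have hP0 : 0 < P := by positivity
  have hQ2 : R ^ (-(n : ℝ)) = Q ^ 2 := by
    rw [hQ, ← Real.rpow_natCast, ← Real.rpow_mul hR.le]; congr 1; push_cast; ring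
  have hP2 : (1 + R * r) ^ (-(1 / (2 * (n : ℝ)))) = P ^ 2 := by
    rw [hP, ← Real.rpow_natCast, ← Real.rpow_mul (by positivity)]; congr 1; push_cast
    field_simp; norm_num
  have hcontK : Continuous fun y => trig a (x - y) :=
    (contDiff_trig ha.finite).continuous.comp (by fun_prop)
  have hcontW : ∀ β : ℝ, Continuous fun y => kw R x y ^ β := fun β =>
    (continuous_kw R x).rpow_const fun y => Or.inl (by have := one_le_kw hR.le x y; positivity)
  have hint : ∀ f : (Fin n → ℝ) → ℝ, Continuous f → Integrable f (μT n) := by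
    intro f hf
    have h1 : IntegrableOn f (Set.Icc 0 1) volume := hf.integrableOn_Icc
    exact h1.mono_set fun y hy =>
      ⟨fun j => (hy j (Set.mem_univ j)).1, fun j => (hy j (Set.mem_univ j)).2.le⟩
  set t := (V * Q⁻¹ * P⁻¹)⁻¹ with ht
  have ht0 : 0 < t := by positivity
  have hpt : ∀ y, ‖trig a (x - y) * g y‖ ≤
      N * (t * (‖trig a (x - y)‖ ^ 2 * kw R x y ^ (1 + 1 / (n : ℝ)))
        + t⁻¹ * (P ^ 2 * kw R x y ^ (-(1 + 1 / (2 * (n : ℝ)))))) := by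
    intro y
    have hk1 := one_le_kw hR.le x y
    have hk0 : 0 < kw R x y := by linarith
    by_cases hgy : g y = 0
    · rw [hgy, mul_zero, norm_zero]; positivity
    rw [norm_mul, mul_comm]
    refine mul_le_mul (hgN y) ?_ (norm_nonneg _) hN
    obtain ⟨l, hl⟩ := hgr y hgy
    have h1 : 1 + R * r ≤ kw R x y := le_trans (by gcongr) (le_kw hR.le x y l)
    have h2 : kw R x y ^ (-(1 + 1 / (n : ℝ))) ≤ P ^ 2 * kw R x y ^ (-(1 + 1 / (2 * (n : ℝ)))) := by
      have : kw R x y ^ (-(1 + 1 / (n : ℝ))) =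
          kw R x y ^ (-(1 / (2 * (n : ℝ)))) * kw R x y ^ (-(1 + 1 / (2 * (n : ℝ)))) := by
        rw [← Real.rpow_add hk0]; congr 1; field_simp; ring
      rw [this, ← hP2]
      gcongr ?_ * _
      exact Real.rpow_le_rpow_of_nonpos (by positivity) h1 (by
        have : 0 < 1 / (2 * (n : ℝ)) := by positivity
        linarith)
    refine le_trans ?_ (add_le_add_right (mul_le_mul_of_nonneg_left h2 (by positivity)) _)
    rw [Real.rpow_neg hk0.le]
    set k := kw R x y ^ (1 + 1 / (n : ℝ)) with hk
    have hkpos : 0 < k := by positivity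
    set u := ‖trig a (x - y)‖
    have h3 : t * (u ^ 2 * k) + t⁻¹ * k⁻¹ - u = (t * k * u - 1) ^ 2 / (t * k) + u := by
      field_simp; ring
    have h4 : 0 ≤ (t * k * u - 1) ^ 2 / (t * k) + u := by positivity
    linarith
  calc ‖∫ y, trig a (x - y) * g y ∂(μT n)‖
      ≤ ∫ y, ‖trig a (x - y) * g y‖ ∂(μT n) := norm_integral_le_integral_norm _
    _ ≤ ∫ y, N * (t * (‖trig a (x - y)‖ ^ 2 * kw R x y ^ (1 + 1 / (n : ℝ)))
        + t⁻¹ * (P ^ 2 * kw R x y ^ (-(1 + 1 / (2 * (n : ℝ)))))) ∂(μT n) := by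
        refine integral_mono_of_nonneg (.of_forall fun y => norm_nonneg _)
          (hint _ ?_) (.of_forall hpt)
        exact continuous_const.mul ((continuous_const.mul ((hcontK.norm.pow 2).mul (hcontW _))).add
          (continuous_const.mul (continuous_const.mul (hcontW _))))
    _ = N * (t * (∫ y, ‖trig a (x - y)‖ ^ 2 * kw R x y ^ (1 + 1 / (n : ℝ)) ∂(μT n))
        + t⁻¹ * (P ^ 2 * ∫ y, kw R x y ^ (-(1 + 1 / (2 * (n : ℝ)))) ∂(μT n))) := by
        rw [integral_const_mul, integral_add, integral_const_mul, integral_const_mul,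
          integral_const_mul]
        · exact hint _ (continuous_const.mul ((hcontK.norm.pow 2).mul (hcontW _)))
        · exact hint _ (continuous_const.mul (continuous_const.mul (hcontW _)))
    _ ≤ N * (t * (D * V ^ 2) + t⁻¹ * (P ^ 2 * (C * Q ^ 2))) := by
        rw [← hQ2]
        gcongr
        · exact ha.integral_kernel_le hn hR x
        · exact hkw R hR x
    _ = (D + C) * V * Q * P * N := by
        rw [ht]; field_simp

/-! ### Symbol classes -/

theorem one_le_jb {n : ℕ} (ξ : Fin n → ℤ) : 1 ≤ jb ξ := by
  rw [jb, Real.one_le_sqrt]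
  have : 0 ≤ ∑ j, ((ξ j : ℝ)) ^ 2 := Finset.sum_nonneg fun j _ => sq_nonneg _
  linarith

theorem jb_pos {n : ℕ} (ξ : Fin n → ℤ) : 0 < jb ξ := zero_lt_one.trans_le (one_le_jb ξ)

theorem jb_sq {n : ℕ} (ξ : Fin n → ℤ) : jb ξ ^ 2 = 1 + ∑ j, ((ξ j : ℝ)) ^ 2 :=
  Real.sq_sqrt (by have : 0 ≤ ∑ j, ((ξ j : ℝ)) ^ 2 := Finset.sum_nonneg fun j _ => sq_nonneg _
                   linarith)

theorem abs_le_jb {n : ℕ} (ξ : Fin n → ℤ) (l : Fin n) : |(ξ l : ℝ)| ≤ jb ξ := by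
  refine Real.abs_le_sqrt ?_
  have := Finset.single_le_sum (f := fun j => ((ξ j : ℝ)) ^ 2) (fun j _ => sq_nonneg _)
    (Finset.mem_univ l)
  linarith

theorem jb_le_of_abs_le {n : ℕ} {ξ : Fin n → ℤ} {M : ℝ} (hM : 1 ≤ M)
    (h : ∀ l, |(ξ l : ℝ)| ≤ M) : jb ξ ≤ (1 + n) * M := by
  refine Real.sqrt_le_iff.2 ⟨by positivity, ?_⟩
  have : ∑ j, ((ξ j : ℝ)) ^ 2 ≤ ∑ _j : Fin n, M ^ 2 := Finset.sum_le_sum fun j _ => by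
    rw [← sq_abs]; exact pow_le_pow_left₀ (abs_nonneg _) (h j) 2
  rw [Finset.sum_const, Finset.card_univ, Fintype.card_fin, nsmul_eq_mul] at this
  have hn : (0 : ℝ) ≤ n := Nat.cast_nonneg n
  have h1 : (1 : ℝ) ≤ M ^ 2 := one_le_pow₀ hM
  nlinarith [mul_nonneg (mul_nonneg hn hn) (sq_nonneg M)]

theorem jb_add_single_le {n : ℕ} (ξ : Fin n → ℤ) (l : Fin n) (ε : ℤ) (hε : |ε| ≤ 1) :
    jb (ξ + Pi.single l ε) ≤ 2 * jb ξ := by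
  refine Real.sqrt_le_iff.2 ⟨by have := jb_pos ξ; positivity, ?_⟩
  rw [mul_pow, jb_sq]
  have h : ∀ j, (((ξ + (Pi.single l ε : Fin n → ℤ)) j : ℤ) : ℝ) ^ 2 ≤ 2 * (ξ j : ℝ) ^ 2 +
      if j = l then 2 else 0 := by
    intro j
    split_ifs with hj
    · subst hj
      have h2 : (ε : ℝ) ^ 2 ≤ 1 := by
        rw [sq_le_one_iff_abs_le_one]; exact_mod_cast hε
      simp only [Pi.add_apply, Pi.single_eq_same]
      push_cast
      nlinarith [sq_nonneg ((ξ j : ℝ) - ε)]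
    · simp only [Pi.add_apply, Pi.single_eq_of_ne hj, add_zero]
      nlinarith [sq_nonneg (ξ j : ℝ)]
  have h2 := Finset.sum_le_sum fun j (_ : j ∈ Finset.univ) => h j
  rw [Finset.sum_add_distrib, ← Finset.mul_sum, Finset.sum_ite_eq' Finset.univ l] at h2
  simp only [Finset.mem_univ, if_true] at h2
  have : 0 ≤ ∑ j, ((ξ j : ℝ)) ^ 2 := Finset.sum_nonneg fun j _ => sq_nonneg _
  linarith

theorem jb_le_jb_add_single {n : ℕ} (ξ : Fin n → ℤ) (l : Fin n) :
    jb ξ ≤ 2 * jb (ξ + Pi.single l 1) := by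
  have := jb_add_single_le (ξ + Pi.single l 1) l (-1) (by norm_num)
  rwa [add_assoc, ← Pi.single_add, add_neg_cancel, Pi.single_zero, add_zero] at this

theorem rpow_le_of_comparable {c N t : ℝ} (hc : 1 ≤ c) (hN : 0 < N) (ht : 0 < t) (h1 : N ≤ c * t)
    (h2 : t ≤ c * N) (ν : ℝ) : t ^ ν ≤ c ^ |ν| * N ^ ν := by
  have hc0 : 0 < c := by linarith
  rcases le_total 0 ν with hν | hν
  · rw [abs_of_nonneg hν, ← Real.mul_rpow hc0.le hN.le]
    exact Real.rpow_le_rpow ht.le h2 hν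
  · rw [abs_of_nonpos hν]
    have : t ^ ν ≤ (N / c) ^ ν :=
      Real.rpow_le_rpow_of_nonpos (by positivity) (by rw [div_le_iff₀ hc0]; linarith) hν
    refine this.trans (le_of_eq ?_)
    rw [Real.div_rpow hN.le hc0.le, Real.rpow_neg hc0.le, div_eq_inv_mul]

theorem dd_add {n : ℕ} (l : Fin n) (u v : (Fin n → ℤ) → ℂ) :
    dd l (fun ξ => u ξ + v ξ) = fun ξ => dd l u ξ + dd l v ξ := by
  ext ξ; simp only [dd]; ring

theorem dd_iterate_add {n : ℕ} (l : Fin n) (i : ℕ) (u v : (Fin n → ℤ) → ℂ) :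
    (dd l)^[i] (fun ξ => u ξ + v ξ) = fun ξ => (dd l)^[i] u ξ + (dd l)^[i] v ξ := by
  induction i generalizing u v with
  | zero => rfl
  | succ i ih => simp only [Function.iterate_succ_apply, dd_add, ih]

theorem dd_iterate_sub {n : ℕ} (l : Fin n) (i : ℕ) (u v : (Fin n → ℤ) → ℂ) :
    (dd l)^[i] (fun ξ => u ξ - v ξ) = fun ξ => (dd l)^[i] u ξ - (dd l)^[i] v ξ := by
  induction i generalizing u v with
  | zero => rfl
  | succ i ih =>
    simp only [Function.iterate_succ_apply]
    rw [← ih]; congr 1; ext ξ; simp only [dd]; ring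

theorem dd_iterate_mul_of_invariant {n : ℕ} (l : Fin n) (i : ℕ) (u w : (Fin n → ℤ) → ℂ)
    (hw : ∀ ξ, w (ξ + Pi.single l 1) = w ξ) :
    (dd l)^[i] (fun ξ => u ξ * w ξ) = fun ξ => (dd l)^[i] u ξ * w ξ := by
  induction i generalizing u with
  | zero => rfl
  | succ i ih =>
    simp only [Function.iterate_succ_apply]
    rw [← ih]; congr 1; ext ξ; simp only [dd, hw]; ring

theorem dd_iterate_shift {n : ℕ} (l : Fin n) (i : ℕ) (u : (Fin n → ℤ) → ℂ) (e : Fin n → ℤ) :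
    (dd l)^[i] (fun ξ => u (ξ + e)) = fun ξ => (dd l)^[i] u (ξ + e) := by
  induction i generalizing u with
  | zero => rfl
  | succ i ih =>
    simp only [Function.iterate_succ_apply]
    rw [← ih]; congr 1; ext ξ; simp only [dd, add_right_comm]

/-- Symbols whose first `s` pure differences satisfy `|Δₗⁱ u(ξ)| ≤ A ⟨ξ⟩^{μ - ρ i}`. -/
def SymCl {n : ℕ} (s : ℕ) (ρ μ A : ℝ) (u : (Fin n → ℤ) → ℂ) : Prop :=
  ∀ l, ∀ i ≤ s, ∀ ξ, ‖(dd l)^[i] u ξ‖ ≤ A * jb ξ ^ (μ - ρ * i)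

namespace SymCl

variable {n s : ℕ} {ρ μ A : ℝ} {u : (Fin n → ℤ) → ℂ}

theorem norm_le (hn : 1 ≤ n) (hu : SymCl s ρ μ A u) (ξ : Fin n → ℤ) : ‖u ξ‖ ≤ A * jb ξ ^ μ := by
  simpa using hu ⟨0, hn⟩ 0 (Nat.zero_le _) ξ

theorem mono (hu : SymCl s ρ μ A u) {ρ' A' : ℝ} (hρ : ρ' ≤ ρ) (hA : A ≤ A') (hA0 : 0 ≤ A') :
    SymCl s ρ' μ A' u := by
  intro l i hi ξ
  refine (hu l i hi ξ).trans ?_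
  have h1 := one_le_jb ξ
  refine mul_le_mul hA ?_ (Real.rpow_nonneg (by linarith) _) hA0
  refine Real.rpow_le_rpow_of_exponent_le h1 ?_
  have : ρ' * i ≤ ρ * i := by gcongr
  linarith

theorem conj (hu : SymCl s ρ μ A u) : SymCl s ρ μ A fun ξ => (starRingEnd ℂ) (u ξ) := by
  have : ∀ (l : Fin n) (i : ℕ) (u : (Fin n → ℤ) → ℂ),
      (dd l)^[i] (fun ξ => (starRingEnd ℂ) (u ξ)) = fun ξ => (starRingEnd ℂ) ((dd l)^[i] u ξ) := by
    intro l i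
    induction i with
    | zero => intro u; rfl
    | succ i ih =>
      intro u
      simp only [Function.iterate_succ_apply]
      rw [← ih]; congr 1; ext ξ; simp [dd]
  intro l i hi ξ
  rw [this, Complex.norm_conj]
  exact hu l i hi ξ

end SymCl

theorem exists_norm_dd_iterate_mul_le {n : ℕ} (ρ : ℝ) (i : ℕ) : ∀ μ₁ μ₂ : ℝ, ∃ K : ℝ, 0 < K ∧
    ∀ (l : Fin n) (u v : (Fin n → ℤ) → ℂ) (A B : ℝ), 0 ≤ A → 0 ≤ B →
      (∀ k ≤ i, ∀ ξ, ‖(dd l)^[k] u ξ‖ ≤ A * jb ξ ^ (μ₁ - ρ * k)) →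
      (∀ k ≤ i, ∀ ξ, ‖(dd l)^[k] v ξ‖ ≤ B * jb ξ ^ (μ₂ - ρ * k)) →
      ∀ ξ, ‖(dd l)^[i] (fun ξ => u ξ * v ξ) ξ‖ ≤ K * A * B * jb ξ ^ (μ₁ + μ₂ - ρ * i) := by
  induction i with
  | zero =>
    intro μ₁ μ₂
    refine ⟨1, one_pos, fun l u v A B hA hB hu hv ξ => ?_⟩
    have h1 := hu 0 le_rfl ξ
    have h2 := hv 0 le_rfl ξ
    simp only [Function.iterate_zero, id_eq, Nat.cast_zero, mul_zero, sub_zero, one_mul] at *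
    rw [norm_mul, Real.rpow_add (jb_pos ξ)]
    have := mul_le_mul h1 h2 (norm_nonneg _) ((norm_nonneg _).trans h1)
    linarith
  | succ i ih =>
    intro μ₁ μ₂
    obtain ⟨K₁, hK₁, h₁⟩ := ih (μ₁ - ρ) μ₂
    obtain ⟨K₂, hK₂, h₂⟩ := ih μ₁ (μ₂ - ρ)
    set M : ℝ := ∑ k ∈ Finset.range (i + 1), 2 ^ |μ₂ - ρ * k| with hM
    have hM0 : 0 ≤ M := Finset.sum_nonneg fun k _ => by positivity
    refine ⟨K₁ * M + K₂, by positivity, fun l u v A B hA hB hu hv ξ => ?_⟩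
    have hdd : dd l (fun ξ => u ξ * v ξ) =
        fun ξ => dd l u ξ * v (ξ + Pi.single l 1) + u ξ * dd l v ξ := by
      ext ξ; simp only [dd]; ring
    rw [Function.iterate_succ_apply, hdd, dd_iterate_add]
    have hsh : ∀ k ≤ i, ∀ ξ, ‖(dd l)^[k] (fun ξ => v (ξ + Pi.single l 1)) ξ‖
        ≤ (B * M) * jb ξ ^ (μ₂ - ρ * k) := by
      intro k hk ξ
      rw [dd_iterate_shift]
      refine (hv k (by omega) _).trans ?_
      rw [mul_assoc]
      refine mul_le_mul_of_nonneg_left ?_ hB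
      refine (rpow_le_of_comparable one_le_two (jb_pos ξ) (jb_pos _) (jb_le_jb_add_single ξ l)
        (jb_add_single_le ξ l 1 (by norm_num)) _).trans ?_
      refine mul_le_mul_of_nonneg_right ?_ (Real.rpow_nonneg (jb_pos ξ).le _)
      exact Finset.single_le_sum (f := fun k : ℕ => (2 : ℝ) ^ |μ₂ - ρ * k|)
        (fun k _ => by positivity) (Finset.mem_range.2 (by omega))
    have e1 := h₁ l (dd l u) _ A (B * M) hA (by positivity) (fun k hk ξ => by
      have := hu (k + 1) (by omega) ξ
      rw [Function.iterate_succ_apply] at this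
      refine this.trans (le_of_eq ?_)
      congr 2; push_cast; ring) hsh ξ
    have e2 := h₂ l u (dd l v) A B hA hB (fun k hk => hu k (by omega)) (fun k hk ξ => by
      have := hv (k + 1) (by omega) ξ
      rw [Function.iterate_succ_apply] at this
      refine this.trans (le_of_eq ?_)
      congr 2; push_cast; ring) ξ
    refine (norm_add_le _ _).trans ((add_le_add e1 e2).trans (le_of_eq ?_))
    rw [show μ₁ - ρ + μ₂ - ρ * i = μ₁ + μ₂ - ρ * (i + 1 : ℕ) by push_cast; ring,
      show μ₁ + (μ₂ - ρ) - ρ * i = μ₁ + μ₂ - ρ * (i + 1 : ℕ) by push_cast; ring]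
    ring

theorem SymCl.exists_mul (n s : ℕ) (ρ μ₁ μ₂ : ℝ) : ∃ K : ℝ, 0 < K ∧
    ∀ (u v : (Fin n → ℤ) → ℂ) (A B : ℝ), 0 ≤ A → 0 ≤ B → SymCl s ρ μ₁ A u → SymCl s ρ μ₂ B v →
      SymCl s ρ (μ₁ + μ₂) (K * A * B) fun ξ => u ξ * v ξ := by
  choose K hK h using fun i => exists_norm_dd_iterate_mul_le (n := n) ρ i μ₁ μ₂
  refine ⟨∑ i ∈ Finset.range (s + 1), K i, Finset.sum_pos (fun i _ => hK i) (by simp),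
    fun u v A B hA hB hu hv l i hi ξ => ?_⟩
  refine (h i l u v A B hA hB (fun k hk => hu l k (by omega)) (fun k hk => hv l k (by omega))
    ξ).trans ?_
  have := Finset.single_le_sum (f := K) (fun i _ => (hK i).le)
    (Finset.mem_range.2 (by omega : i < s + 1))
  have := jb_pos ξ
  gcongr

theorem SymCl.coord {n s : ℕ} (l : Fin n) : SymCl s 1 1 1 fun ξ : Fin n → ℤ => (ξ l : ℂ) := by
  have hz : ∀ (k : Fin n) (i : ℕ) (c : ℂ), (dd k)^[i + 1] (fun _ => c) = fun _ => 0 := by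
    intro k i c
    induction i with
    | zero => ext ξ; simp [dd]
    | succ i ih => rw [Function.iterate_succ_apply', ih]; ext ξ; simp [dd]
  intro k i _ ξ
  match i with
  | 0 => simpa using abs_le_jb ξ l
  | 1 =>
    simp only [Function.iterate_one, dd, Pi.add_apply, Int.cast_add, add_sub_cancel_left,
      Nat.cast_one, mul_one, sub_self, Real.rpow_zero, Complex.norm_intCast]
    by_cases h : l = k
    · subst h; simp
    · simp [Pi.single_eq_of_ne h]
  | i + 2 =>
    have : dd k (fun ξ : Fin n → ℤ => (ξ l : ℂ)) =
        fun _ => ((Pi.single k 1 : Fin n → ℤ) l : ℂ) := by ext ξ; simp [dd]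
    rw [Function.iterate_succ_apply, this, hz]
    have := jb_pos ξ
    simp only [norm_zero, one_mul]; positivity

/-! ### Dyadic cutoffs -/

/-- A smooth cutoff on `ℝ`, equal to `1` on `[-1,1]` and supported in `[-2,2]`. -/
def bump : ContDiffBump (0 : ℝ) := ⟨1, 2, one_pos, one_lt_two⟩

theorem bump_eq_one {t : ℝ} (ht : |t| ≤ 1) : bump t = 1 :=
  bump.one_of_mem_closedBall (by simpa [bump] using ht)

theorem bump_eq_zero {t : ℝ} (ht : 2 ≤ |t|) : bump t = 0 :=
  bump.zero_of_le_dist (by simpa [bump] using ht)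

theorem exists_iteratedDeriv_bump_le (i : ℕ) :
    ∃ M : ℝ, 0 < M ∧ ∀ t, ‖iteratedDeriv i bump t‖ ≤ M := by
  have h0 : ∀ i, HasCompactSupport (iteratedDeriv i bump) := by
    intro i
    induction i with
    | zero => simpa using bump.hasCompactSupport
    | succ i ih => rw [iteratedDeriv_succ]; exact ih.deriv
  obtain ⟨C, hC⟩ := (h0 i).exists_bound_of_continuous
    ((bump.contDiff (n := ⊤)).continuous_iteratedDeriv i (by exact_mod_cast le_top))
  exact ⟨max C 1, by positivity, fun t => (hC t).trans (le_max_left _ _)⟩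

theorem norm_dd_iterate_le_of_iteratedDeriv {n : ℕ} (l : Fin n) {h : ℝ} (hh : 0 ≤ h) (i : ℕ) :
    ∀ (f : ℝ → ℝ) (M : ℝ), ContDiff ℝ (⊤ : ℕ∞) f → (∀ t, ‖iteratedDeriv i f t‖ ≤ M) →
      ∀ ξ : Fin n → ℤ, ‖(dd l)^[i] (fun ξ => ((f (ξ l * h) : ℝ) : ℂ)) ξ‖ ≤ M * h ^ i := by
  induction i with
  | zero => intro f M _ hM ξ; simpa using hM (ξ l * h)
  | succ i ih =>
    intro f M hf hM ξ
    have h1 : dd l (fun ξ => ((f (ξ l * h) : ℝ) : ℂ)) =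
        fun ξ => (((fun t => f (t + h) - f t) (ξ l * h) : ℝ) : ℂ) := by
      ext ξ
      simp only [dd, Pi.add_apply, Pi.single_eq_same]
      push_cast
      rw [add_mul, one_mul]
    have hfs : ContDiff ℝ (⊤ : ℕ∞) fun t => f (t + h) := hf.comp (contDiff_id.add contDiff_const)
    rw [Function.iterate_succ_apply, h1]
    refine (ih _ (M * h) (hfs.sub hf) (fun t => ?_) ξ).trans (by rw [pow_succ]; linarith)
    rw [iteratedDeriv_fun_sub (hfs.of_le (by exact_mod_cast le_top)).contDiffAt
      (hf.of_le (by exact_mod_cast le_top)).contDiffAt, iteratedDeriv_comp_add_const]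
    have h2 := Convex.norm_image_sub_le_of_norm_deriv_le (f := iteratedDeriv i f) (s := Set.univ)
      (x := t) (y := t + h) (C := M) (fun x _ =>
        (hf.differentiable_iteratedDeriv i (by exact_mod_cast WithTop.coe_lt_top _)) x)
      (fun x _ => by rw [← iteratedDeriv_succ]; exact hM x) convex_univ trivial trivial
    simpa [abs_of_nonneg hh] using h2

/-- The cutoff to frequencies `|ξ|_∞ ≲ 2^j`. -/
def lowCut {n : ℕ} (j : ℕ) (ξ : Fin n → ℤ) : ℝ := ∏ l, bump (ξ l * (1 / 2) ^ j)

/-- The Littlewood-Paley cutoff to frequencies of size `2^j`. -/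
def lpCut {n : ℕ} : ℕ → (Fin n → ℤ) → ℝ
  | 0 => lowCut 0
  | j + 1 => fun ξ => lowCut (j + 1) ξ - lowCut j ξ

theorem lowCut_nonneg {n : ℕ} (j : ℕ) (ξ : Fin n → ℤ) : 0 ≤ lowCut j ξ :=
  Finset.prod_nonneg fun _ _ => bump.nonneg

theorem lowCut_le_one {n : ℕ} (j : ℕ) (ξ : Fin n → ℤ) : lowCut j ξ ≤ 1 :=
  Finset.prod_le_one (fun _ _ => bump.nonneg) fun _ _ => bump.le_one

theorem lowCut_eq_one {n : ℕ} {j : ℕ} {ξ : Fin n → ℤ} (h : ∀ l, |(ξ l : ℝ)| ≤ 2 ^ j) :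
    lowCut j ξ = 1 :=
  Finset.prod_eq_one fun l _ => bump_eq_one (by
    rw [abs_mul, abs_of_pos (by positivity : (0 : ℝ) < (1 / 2) ^ j)]
    calc _ ≤ (2 : ℝ) ^ j * (1 / 2) ^ j := by gcongr; exact h l
      _ = 1 := by rw [← mul_pow]; norm_num)

theorem lowCut_eq_zero {n : ℕ} {j : ℕ} {ξ : Fin n → ℤ} (l : Fin n)
    (h : 2 ^ (j + 1) ≤ |(ξ l : ℝ)|) : lowCut j ξ = 0 :=
  Finset.prod_eq_zero (Finset.mem_univ l) (bump_eq_zero (by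
    rw [abs_mul, abs_of_pos (by positivity : (0 : ℝ) < (1 / 2) ^ j)]
    calc (2 : ℝ) = 2 ^ (j + 1) * (1 / 2) ^ j := by
          rw [pow_succ, mul_right_comm, ← mul_pow]; norm_num
      _ ≤ _ := by gcongr))

theorem lowCut_le_succ {n : ℕ} (j : ℕ) (ξ : Fin n → ℤ) : lowCut j ξ ≤ lowCut (j + 1) ξ := by
  by_cases h : ∀ l, |(ξ l : ℝ)| ≤ 2 ^ (j + 1)
  · rw [lowCut_eq_one h]; exact lowCut_le_one j ξ
  · push Not at h
    obtain ⟨l, hl⟩ := h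
    rw [lowCut_eq_zero l hl.le]; exact lowCut_nonneg _ _

theorem lpCut_nonneg {n : ℕ} (j : ℕ) (ξ : Fin n → ℤ) : 0 ≤ lpCut j ξ := by
  cases j with
  | zero => exact lowCut_nonneg 0 ξ
  | succ j => exact sub_nonneg.2 (lowCut_le_succ j ξ)

theorem sum_lpCut {n : ℕ} (J : ℕ) (ξ : Fin n → ℤ) :
    ∑ j ∈ Finset.range (J + 1), lpCut j ξ = lowCut J ξ := by
  induction J with
  | zero => simp [lpCut]
  | succ J ih => rw [Finset.sum_range_succ, ih]; simp [lpCut]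

theorem lpCut_le_one {n : ℕ} (j : ℕ) (ξ : Fin n → ℤ) : lpCut j ξ ≤ 1 := by
  have h1 := Finset.single_le_sum (f := fun j => lpCut j ξ) (fun j _ => lpCut_nonneg j ξ)
    (Finset.mem_range.2 (Nat.lt_succ_self j))
  exact h1.trans ((sum_lpCut j ξ).le.trans (lowCut_le_one j ξ))

/-- `u` is supported where `⟨ξ⟩` is comparable to `2^j`. -/
def IsDyadic {n : ℕ} (c : ℝ) (j : ℕ) (u : (Fin n → ℤ) → ℂ) : Prop :=
  ∀ ξ, u ξ ≠ 0 → 2 ^ j ≤ c * jb ξ ∧ jb ξ ≤ c * 2 ^ j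

theorem dyadic_lpCut {n : ℕ} (j : ℕ) :
    IsDyadic (2 * (1 + n)) j fun ξ : Fin n → ℤ => ((lpCut j ξ : ℝ) : ℂ) := by
  intro ξ hξ
  have hξ' : lpCut j ξ ≠ 0 := fun h => hξ (by simp [h])
  have hj := jb_pos ξ
  have hn : (0 : ℝ) ≤ n := Nat.cast_nonneg n
  have hup : ∀ l, |(ξ l : ℝ)| ≤ 2 ^ (j + 1) := by
    by_contra h
    push Not at h
    obtain ⟨l, hl⟩ := h
    apply hξ'
    cases j with
    | zero => exact lowCut_eq_zero l hl.le
    | succ j =>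
      have : (2 : ℝ) ^ (j + 1) ≤ 2 ^ (j + 1 + 1) := pow_le_pow_right₀ one_le_two (by omega)
      simp only [lpCut]
      rw [lowCut_eq_zero l hl.le, lowCut_eq_zero l (this.trans hl.le), sub_zero]
  constructor
  · cases j with
    | zero => have := one_le_jb ξ; simp only [pow_zero]; nlinarith
    | succ j =>
      by_contra h
      push Not at h
      apply hξ'
      have hs : ∀ l, |(ξ l : ℝ)| ≤ 2 ^ j := fun l => by
        have := abs_le_jb ξ l
        rw [pow_succ] at h
        nlinarith
      have hs' : ∀ l, |(ξ l : ℝ)| ≤ 2 ^ (j + 1) := fun l =>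
        (hs l).trans (pow_le_pow_right₀ one_le_two (by omega))
      simp only [lpCut]
      rw [lowCut_eq_one hs, lowCut_eq_one hs', sub_self]
  · have := jb_le_of_abs_le (one_le_pow₀ one_le_two) hup
    rw [pow_succ] at this
    linarith

theorem IsDyadic.mul_left {n : ℕ} {c : ℝ} {j : ℕ} {v : (Fin n → ℤ) → ℂ} (hv : IsDyadic c j v)
    (u : (Fin n → ℤ) → ℂ) : IsDyadic c j fun ξ => u ξ * v ξ :=
  fun ξ hξ => hv ξ (right_ne_zero_of_mul hξ)

theorem IsDyadic.dd_iterate {n : ℕ} {c : ℝ} (hc : 0 ≤ c) {j : ℕ} {u : (Fin n → ℤ) → ℂ}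
    (hu : IsDyadic c j u) (l : Fin n) (i : ℕ) : IsDyadic (2 ^ i * c) j ((dd l)^[i] u) := by
  induction i with
  | zero => simpa using hu
  | succ i ih =>
    rw [Function.iterate_succ_apply']
    intro ξ hξ
    have hp := jb_pos ξ
    by_cases h : (dd l)^[i] u ξ = 0
    · have h2 : (dd l)^[i] u (ξ + Pi.single l 1) ≠ 0 := by
        intro h3; apply hξ; simp [dd, h, h3]
      obtain ⟨h4, h5⟩ := ih _ h2
      have h6 := jb_add_single_le ξ l 1 (by norm_num)
      have h7 := jb_le_jb_add_single ξ l
      have hc' : 0 ≤ 2 ^ i * c := by positivity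
      constructor
      · rw [pow_succ]
        nlinarith [mul_le_mul_of_nonneg_left h6 hc']
      · rw [pow_succ]; nlinarith
    · obtain ⟨h4, h5⟩ := ih _ h
      have hc' : 0 ≤ 2 ^ i * c := by positivity
      have h8 : (0 : ℝ) < 2 ^ j := by positivity
      constructor
      · rw [pow_succ]
        nlinarith [mul_nonneg hc' hp.le]
      · rw [pow_succ]; nlinarith [mul_nonneg hc' h8.le]

theorem exists_card_dyadic_le (n : ℕ) (c : ℝ) : ∃ C : ℝ, 0 < C ∧ ∀ (j : ℕ)
    (S : Finset (Fin n → ℤ)), (∀ ξ ∈ S, jb ξ ≤ c * 2 ^ j) → (S.card : ℝ) ≤ C * (2 ^ j) ^ n := by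
  refine ⟨(2 * ⌈c⌉₊ + 1 : ℝ) ^ n, by positivity, fun j S hS => ?_⟩
  set M : ℤ := ⌈c⌉₊ * 2 ^ j with hM
  have hsub : S ⊆ Fintype.piFinset fun _ => Finset.Icc (-M) M := by
    intro ξ hξ
    rw [Fintype.mem_piFinset]
    intro l
    have h1 : |(ξ l : ℝ)| ≤ (M : ℝ) := by
      refine (abs_le_jb ξ l).trans ((hS ξ hξ).trans ?_)
      rw [hM]; push_cast
      gcongr; exact Nat.le_ceil c
    have h2 : |ξ l| ≤ M := by exact_mod_cast h1
    exact Finset.mem_Icc.2 (abs_le.1 h2)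
  have h1 := Finset.card_le_card hsub
  rw [Fintype.card_piFinset_const, Int.card_Icc] at h1
  have h2 : ((M + 1 - -M).toNat : ℝ) ≤ (2 * ⌈c⌉₊ + 1 : ℝ) * 2 ^ j := by
    have : (0 : ℤ) ≤ M := by positivity
    have h3 : (((M + 1 - -M).toNat : ℤ) : ℝ) = ((2 * M + 1 : ℤ) : ℝ) := by
      congr 1; rw [Int.toNat_of_nonneg (by omega)]; ring
    rw [← Int.cast_natCast (R := ℝ), h3, hM]
    push_cast
    have : (1 : ℝ) ≤ 2 ^ j := one_le_pow₀ one_le_two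
    nlinarith
  calc (S.card : ℝ) ≤ ((M + 1 - -M).toNat : ℝ) ^ n := by exact_mod_cast h1
    _ ≤ ((2 * ⌈c⌉₊ + 1 : ℝ) * 2 ^ j) ^ n := by gcongr
    _ = _ := mul_pow _ _ _

theorem exists_symCl_lpCut (n s : ℕ) : ∃ B : ℝ, 0 < B ∧ ∀ j : ℕ,
    SymCl s 1 0 B fun ξ : Fin n → ℤ => ((lpCut j ξ : ℝ) : ℂ) := by
  choose M hM0 hM using exists_iteratedDeriv_bump_le
  have hlow : ∀ (l : Fin n) (i j : ℕ) (ξ : Fin n → ℤ),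
      ‖(dd l)^[i] (fun ξ : Fin n → ℤ => ((lowCut j ξ : ℝ) : ℂ)) ξ‖ ≤ M i * ((1 / 2) ^ j) ^ i := by
    intro l i j ξ
    have h1 : (fun ξ : Fin n → ℤ => ((lowCut j ξ : ℝ) : ℂ)) = fun ξ =>
        ((bump (ξ l * (1 / 2) ^ j) : ℝ) : ℂ) *
          ((∏ k ∈ Finset.univ.erase l, bump (ξ k * (1 / 2) ^ j) : ℝ) : ℂ) := by
      ext ξ
      rw [lowCut, ← Finset.mul_prod_erase _ _ (Finset.mem_univ l), Complex.ofReal_mul]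
    rw [h1, dd_iterate_mul_of_invariant, norm_mul]
    · refine (mul_le_of_le_one_right (norm_nonneg _) ?_).trans
        (norm_dd_iterate_le_of_iteratedDeriv l (by positivity) i bump (M i) bump.contDiff (hM i) ξ)
      rw [Complex.norm_real, Real.norm_of_nonneg (Finset.prod_nonneg fun _ _ => bump.nonneg)]
      exact Finset.prod_le_one (fun _ _ => bump.nonneg) fun _ _ => bump.le_one
    · intro ξ
      congr 1
      refine Finset.prod_congr rfl fun k hk => ?_
      simp [Pi.single_eq_of_ne (Finset.ne_of_mem_erase hk)]
  have hlp : ∀ (l : Fin n) (i j : ℕ) (ξ : Fin n → ℤ),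
      ‖(dd l)^[i] (fun ξ : Fin n → ℤ => ((lpCut j ξ : ℝ) : ℂ)) ξ‖
        ≤ 2 ^ (i + 1) * M i * ((1 / 2) ^ j) ^ i := by
    intro l i j ξ
    have hMi := hM0 i
    cases j with
    | zero =>
      refine (hlow l i 0 ξ).trans ?_
      have : (1 : ℝ) ≤ 2 ^ (i + 1) := one_le_pow₀ one_le_two
      rw [mul_assoc]
      exact le_mul_of_one_le_left (by positivity) this
    | succ j =>
      have : (fun ξ : Fin n → ℤ => ((lpCut (j + 1) ξ : ℝ) : ℂ)) =
          fun ξ => ((lowCut (j + 1) ξ : ℝ) : ℂ) - ((lowCut j ξ : ℝ) : ℂ) := by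
        ext ξ; simp [lpCut]
      rw [this, dd_iterate_sub]
      refine (norm_sub_le _ _).trans ((add_le_add (hlow l i _ ξ) (hlow l i _ ξ)).trans ?_)
      have h1 : ((1 / 2 : ℝ) ^ (j + 1)) ^ i ≤ ((1 / 2) ^ j) ^ i := by
        gcongr ?_ ^ i
        exact pow_le_pow_of_le_one (by norm_num) (by norm_num) (by omega)
      have h2 : (2 : ℝ) ^ (i + 1) * M i * ((1 / 2) ^ (j + 1)) ^ i
          = 2 * (M i * ((1 / 2) ^ j) ^ i) := by
        have h3 : (2 : ℝ) ^ i * (1 / 2) ^ i = 1 := by rw [← mul_pow]; norm_num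
        rw [pow_succ (1 / 2 : ℝ) j, mul_pow, pow_succ]
        linear_combination 2 * M i * ((1 / 2) ^ j) ^ i * h3
      rw [h2]
      nlinarith [mul_le_mul_of_nonneg_left h1 hMi.le]
  set c : ℝ := 2 * (1 + n) with hc
  have hc0 : 0 < c := by positivity
  refine ⟨∑ i ∈ Finset.range (s + 1), 2 ^ (i + 1) * M i * (2 ^ i * c) ^ i, ?_,
    fun j l i hi ξ => ?_⟩
  · refine Finset.sum_pos (fun i _ => ?_) (by simp)
    have := hM0 i
    positivity
  have hsum := Finset.single_le_sum (f := fun i => 2 ^ (i + 1) * M i * (2 ^ i * c) ^ i)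
    (fun i _ => by have := hM0 i; positivity) (Finset.mem_range.2 (by omega : i < s + 1))
  have hp := jb_pos ξ
  refine le_trans ?_ (mul_le_mul_of_nonneg_right hsum (by positivity))
  have hMi := hM0 i
  by_cases h : (dd l)^[i] (fun ξ : Fin n → ℤ => ((lpCut j ξ : ℝ) : ℂ)) ξ = 0
  · rw [h, norm_zero]; positivity
  · have h2 := ((dyadic_lpCut j).dd_iterate hc0.le l i ξ h).2
    refine (hlp l i j ξ).trans ?_
    simp only [mul_assoc]
    gcongr ?_ * (?_ * ?_)
    rw [zero_sub, one_mul, Real.rpow_neg hp.le, Real.rpow_natCast, ← inv_pow, ← mul_pow]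
    gcongr ?_ ^ i
    rw [one_div, inv_pow, ← div_eq_mul_inv, le_div_iff₀ hp, inv_mul_le_iff₀ (by positivity)]
    linarith

theorem SymL2.of_dyadic (n : ℕ) (hn : 1 ≤ n) (ρ μ c : ℝ) (hc : 1 ≤ c) : ∃ K : ℝ, 0 < K ∧
    ∀ (u : (Fin n → ℤ) → ℂ) (A : ℝ) (j : ℕ), 0 ≤ A → SymCl (n / 2 + 1) ρ μ A u → IsDyadic c j u →
      SymL2 (K * A * ((2 : ℝ) ^ j) ^ ((n : ℝ) / 2 + μ)) (((2 : ℝ) ^ j) ^ ρ) u := by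
  set s := n / 2 + 1 with hs
  set c' : ℝ := 2 ^ s * c with hc'
  have h2s : (1 : ℝ) ≤ 2 ^ s := one_le_pow₀ one_le_two
  have hc'1 : 1 ≤ c' := by nlinarith
  have hcc' : c ≤ c' := by nlinarith
  obtain ⟨D, hD, hcard⟩ := exists_card_dyadic_le n c'
  set E : ℝ := c' ^ |μ| + c' ^ |μ - ρ * s| with hE
  have hE0 : 0 < E := by positivity
  have key : ∀ (v : (Fin n → ℤ) → ℂ) (A ν : ℝ) (j : ℕ), 0 ≤ A → c' ^ |ν| ≤ E →
      (∀ ξ, ‖v ξ‖ ≤ A * jb ξ ^ ν) → IsDyadic c' j v → ∀ S : Finset (Fin n → ℤ),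
        ∑ ξ ∈ S, ‖v ξ‖ ^ 2 ≤ D * ((2 : ℝ) ^ j) ^ n * (A * E * ((2 : ℝ) ^ j) ^ ν) ^ 2 := by
    intro v A ν j hA hν hv hdy S
    classical
    rw [← Finset.sum_filter_add_sum_filter_not S (fun ξ => v ξ ≠ 0)]
    have hz : ∑ ξ ∈ S.filter (fun ξ => ¬ v ξ ≠ 0), ‖v ξ‖ ^ 2 = 0 :=
      Finset.sum_eq_zero fun ξ hξ => by
        have := (Finset.mem_filter.1 hξ).2
        simp only [not_not] at this
        simp [this]
    rw [hz, add_zero]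
    have hb : ∀ ξ ∈ S.filter (fun ξ => v ξ ≠ 0), ‖v ξ‖ ^ 2 ≤ (A * E * ((2 : ℝ) ^ j) ^ ν) ^ 2 := by
      intro ξ hξ
      obtain ⟨h1, h2⟩ := hdy ξ (Finset.mem_filter.1 hξ).2
      refine pow_le_pow_left₀ (norm_nonneg _) ((hv ξ).trans ?_) 2
      rw [mul_assoc]
      refine mul_le_mul_of_nonneg_left ?_ hA
      refine (rpow_le_of_comparable hc'1 (by positivity) (jb_pos ξ) h1 h2 ν).trans ?_
      gcongr
    refine (Finset.sum_le_card_nsmul _ _ _ hb).trans ?_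
    rw [nsmul_eq_mul]
    gcongr
    exact hcard j _ fun ξ hξ => (hdy ξ (Finset.mem_filter.1 hξ).2).2
  refine ⟨(D + 1) * E, by positivity, fun u A j hA hu hdy => ?_⟩
  have hdy' : IsDyadic c' j u := fun ξ hξ => by
    obtain ⟨h1, h2⟩ := hdy ξ hξ
    have := jb_pos ξ
    constructor
    · nlinarith
    · exact h2.trans (by gcongr)
  set N : ℝ := (2 : ℝ) ^ j with hN
  have hN0 : 0 < N := by positivity
  have hV : D * N ^ n * (A * E * N ^ μ) ^ 2 ≤ ((D + 1) * E * A * N ^ ((n : ℝ) / 2 + μ)) ^ 2 := by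
    have : N ^ ((n : ℝ) / 2 + μ) = N ^ ((n : ℝ) / 2) * N ^ μ := Real.rpow_add hN0 _ _
    have h2 : (N ^ ((n : ℝ) / 2)) ^ 2 = N ^ n := by
      rw [← Real.rpow_natCast, ← Real.rpow_mul hN0.le, ← Real.rpow_natCast]
      congr 1; push_cast; ring
    rw [this, ← h2]
    have h3 : D ≤ (D + 1) ^ 2 := by nlinarith
    calc _ = D * ((N ^ ((n : ℝ) / 2)) ^ 2 * (A * E * N ^ μ) ^ 2) := by ring
      _ ≤ (D + 1) ^ 2 * ((N ^ ((n : ℝ) / 2)) ^ 2 * (A * E * N ^ μ) ^ 2) := by gcongr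
      _ = _ := by ring
  refine ⟨?_, fun S => ?_, fun l S => ?_⟩
  · have hsub : u.support ⊆ {ξ | ∀ l, ξ l ∈ Set.Icc (-(⌈c⌉₊ * 2 ^ j : ℤ)) (⌈c⌉₊ * 2 ^ j)} := by
      intro ξ hξ l
      have h2 := (abs_le_jb ξ l).trans (hdy ξ hξ).2
      have h1 : |(ξ l : ℝ)| ≤ ((⌈c⌉₊ * 2 ^ j : ℤ) : ℝ) := by
        refine h2.trans ?_
        push_cast; gcongr; exact Nat.le_ceil c
      exact abs_le.1 (by exact_mod_cast h1)
    refine Set.Finite.subset ?_ hsub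
    have := Set.Finite.pi' (ι := Fin n) (t := fun _ => Set.Icc (-(⌈c⌉₊ * 2 ^ j : ℤ)) (⌈c⌉₊ * 2 ^ j))
      fun _ => Set.finite_Icc _ _
    exact this
  · exact (key u A μ j hA (by rw [hE]; linarith [show 0 ≤ c' ^ |μ - ρ * s| by positivity])
      (hu.norm_le hn) hdy' S).trans hV
  · have h1 := key ((dd l)^[s] u) A (μ - ρ * s) j hA
      (by rw [hE]; linarith [show 0 ≤ c' ^ |μ| by positivity])
      (hu l s le_rfl) (hdy.dd_iterate (by linarith) l s) S
    refine (mul_le_mul_of_nonneg_left h1 (by positivity)).trans (le_trans (le_of_eq ?_) hV)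
    have : N ^ μ = N ^ (μ - ρ * s) * N ^ (ρ * s) := by rw [← Real.rpow_add hN0]; congr 1; ring
    have h2 : (N ^ ρ) ^ (2 * s) = (N ^ (ρ * s)) ^ 2 := by
      rw [Real.rpow_mul hN0.le, Real.rpow_natCast, ← pow_mul, mul_comm 2 s]
    rw [this, h2]; ring

/-! ### Dyadic averages and a good-`λ` inequality -/

/-- Index of the dyadic cube of side `2^{-k}` containing `x`. -/
def dq {n : ℕ} (k : ℕ) (x : Fin n → ℝ) : Fin n → ℤ := fun l => ⌊2 ^ k * x l⌋

/-- Average of `h` over the dyadic cube of side `2^{-k}` containing `x`. -/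
def dE {n : ℕ} (k : ℕ) (h : (Fin n → ℝ) → ℝ≥0∞) (x : Fin n → ℝ) : ℝ≥0∞ :=
  (2 ^ n) ^ k * ∫⁻ y in {y | dq k y = dq k x}, h y ∂(μT n)

theorem measurable_dq {n : ℕ} (k : ℕ) : Measurable (dq (n := n) k) :=
  measurable_pi_lambda _ fun l => Int.measurable_floor.comp ((measurable_pi_apply l).const_mul _)

theorem measurableSet_dq_eq {n : ℕ} (k : ℕ) (v : Fin n → ℤ) : MeasurableSet {y | dq k y = v} :=
  measurable_dq k (measurableSet_singleton v)

theorem dq_eq_of_succ {n : ℕ} {k : ℕ} {x y : Fin n → ℝ} (h : dq (k + 1) x = dq (k + 1) y) :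
    dq k x = dq k y := by
  have key : ∀ (t : ℝ), ⌊2 ^ k * t⌋ = ⌊2 ^ (k + 1) * t⌋ / 2 := by
    intro t
    have := Int.floor_div_natCast (2 ^ (k + 1) * t) 2
    push_cast at this
    rw [← this]; congr 1; rw [pow_succ]; ring
  ext l
  have h' := congrFun h l
  simp only [dq] at h' ⊢
  rw [key, key, h']

theorem dq_eq_of_le {n : ℕ} {k k' : ℕ} (hk : k ≤ k') {x y : Fin n → ℝ} (h : dq k' x = dq k' y) :
    dq k x = dq k y := by
  induction k', hk using Nat.le_induction with
  | base => exact h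
  | succ m _ ih => exact ih (dq_eq_of_succ h)

theorem abs_sub_lt_of_dq_eq {n : ℕ} {k : ℕ} {x y : Fin n → ℝ} (h : dq k x = dq k y) (l : Fin n) :
    |x l - y l| < (1 / 2) ^ k := by
  have h1 := Int.abs_sub_lt_one_of_floor_eq_floor (congrFun h l)
  rw [← mul_sub, abs_mul, abs_of_pos (by positivity : (0 : ℝ) < 2 ^ k)] at h1
  rwa [one_div, inv_pow, ← one_div, lt_div_iff₀' (by positivity)]

theorem dE_congr {n : ℕ} {k : ℕ} {x y : Fin n → ℝ} (h : dq k x = dq k y)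
    (g : (Fin n → ℝ) → ℝ≥0∞) : dE k g x = dE k g y := by
  rw [dE, dE, h]

theorem setOf_dq_eq {n : ℕ} (k : ℕ) (v : Fin n → ℤ) :
    {y : Fin n → ℝ | dq k y = v} =
      Set.univ.pi fun l => Set.Ico ((v l : ℝ) / 2 ^ k) ((v l + 1 : ℝ) / 2 ^ k) := by
  ext y
  simp only [Set.mem_ofPred_eq, funext_iff, dq, Int.floor_eq_iff, Set.mem_univ_pi, Set.mem_Ico]
  refine forall_congr' fun l => ?_
  rw [div_le_iff₀' (by positivity), lt_div_iff₀' (by positivity)]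

theorem volume_dq_eq {n : ℕ} (k : ℕ) (v : Fin n → ℤ) :
    (2 ^ n) ^ k * volume {y : Fin n → ℝ | dq k y = v} = 1 := by
  have h1 : ∀ l, volume (Set.Ico ((v l : ℝ) / 2 ^ k) ((v l + 1 : ℝ) / 2 ^ k)) = (2 ^ k)⁻¹ := by
    intro l
    rw [Real.volume_Ico, ← sub_div, add_sub_cancel_left, one_div, ENNReal.ofReal_inv_of_pos
      (by positivity), ENNReal.ofReal_pow (by norm_num), ENNReal.ofReal_ofNat]
  rw [setOf_dq_eq, volume_pi_pi]
  simp only [h1, Finset.prod_const, Finset.card_univ, Fintype.card_fin]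
  rw [← pow_mul, mul_comm n k, pow_mul, ← mul_pow, ENNReal.mul_inv_cancel (by positivity)
    (by finiteness), one_pow]

theorem measure_dq_eq_le {n : ℕ} (k : ℕ) (x : Fin n → ℝ) :
    (2 ^ n) ^ k * μT n {y | dq k y = dq k x} ≤ 1 := by
  rw [← volume_dq_eq k (dq k x)]
  gcongr
  exact Measure.restrict_le_self

theorem measure_dq_eq {n : ℕ} (k : ℕ) {x : Fin n → ℝ} (hx : x ∈ cube n) :
    (2 ^ n) ^ k * μT n {y | dq k y = dq k x} = 1 := by
  rw [← volume_dq_eq k (dq k x), μT, Measure.restrict_apply (measurableSet_dq_eq k _),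
    Set.inter_eq_left.2]
  intro y hy l _
  have hy' := congrFun (dq_eq_of_le (Nat.zero_le k) hy) l
  have hxl := hx l trivial
  simp only [dq, pow_zero, one_mul] at hy'
  rwa [Int.floor_eq_zero_iff.2 hxl, Int.floor_eq_zero_iff] at hy'

theorem ae_mem_cube (n : ℕ) : ∀ᵐ x ∂(μT n), x ∈ cube n :=
  ae_restrict_mem (measurableSet_cube n)

theorem measurable_dE {n : ℕ} (k : ℕ) (h : (Fin n → ℝ) → ℝ≥0∞) : Measurable (dE k h) := by
  have : dE k h = (fun v => (2 ^ n) ^ k * ∫⁻ y in {y | dq k y = v}, h y ∂(μT n)) ∘ dq k := rfl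
  rw [this]
  exact (Measurable.of_discrete).comp (measurable_dq k)

theorem dE_mono {n : ℕ} (k : ℕ) {g h : (Fin n → ℝ) → ℝ≥0∞} (hgh : ∀ x, g x ≤ h x)
    (x : Fin n → ℝ) : dE k g x ≤ dE k h x := by
  unfold dE; gcongr; exact hgh _

theorem dE_add {n : ℕ} (k : ℕ) {g : (Fin n → ℝ) → ℝ≥0∞} (hg : Measurable g)
    (h : (Fin n → ℝ) → ℝ≥0∞) (x : Fin n → ℝ) :
    dE k (fun y => g y + h y) x = dE k g x + dE k h x := by
  unfold dE; rw [lintegral_add_left hg, mul_add]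

theorem dE_const_mul {n : ℕ} (k : ℕ) {g : (Fin n → ℝ) → ℝ≥0∞} (hg : Measurable g)
    (c : ℝ≥0∞) (x : Fin n → ℝ) : dE k (fun y => c * g y) x = c * dE k g x := by
  unfold dE; rw [lintegral_const_mul _ hg, mul_left_comm]

theorem dE_level_le {n : ℕ} (k : ℕ) {k' : ℕ} (hk : k ≤ k') (c : (Fin n → ℤ) → ℝ≥0∞)
    (x : Fin n → ℝ) : dE k' (fun y => c (dq k y)) x ≤ c (dq k x) := by
  unfold dE
  rw [setLIntegral_congr_fun (measurableSet_dq_eq k' _) (g := fun _ => c (dq k x))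
    (fun y hy => by simp only [dq_eq_of_le hk hy]), setLIntegral_const, mul_left_comm]
  exact mul_le_of_le_one_right' (measure_dq_eq_le k' x)

theorem dE_level {n : ℕ} (k : ℕ) (c : (Fin n → ℤ) → ℝ≥0∞)
    {x : Fin n → ℝ} (hx : x ∈ cube n) : dE k (fun y => c (dq k y)) x = c (dq k x) := by
  unfold dE
  rw [setLIntegral_congr_fun (measurableSet_dq_eq k _) (g := fun _ => c (dq k x))
    (fun y hy => by rw [hy]), setLIntegral_const, mul_left_comm, measure_dq_eq k hx, mul_one]

theorem dE_le_of_le {n : ℕ} (k : ℕ) {h : (Fin n → ℝ) → ℝ≥0∞} {M : ℝ≥0∞} (hM : ∀ x, h x ≤ M)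
    (x : Fin n → ℝ) : dE k h x ≤ M :=
  (dE_mono k hM x).trans (dE_level_le k le_rfl (fun _ => M) x)

theorem dE_succ_le {n : ℕ} (k : ℕ) (h : (Fin n → ℝ) → ℝ≥0∞) (x : Fin n → ℝ) :
    dE (k + 1) h x ≤ 2 ^ n * dE k h x := by
  unfold dE
  rw [pow_succ, mul_comm ((2 ^ n : ℝ≥0∞) ^ k), mul_assoc]
  refine mul_le_mul_right (mul_le_mul_right ?_ _) _
  exact lintegral_mono_set fun y hy => dq_eq_of_succ hy

/-- Sets which are unions of dyadic cubes of side `2^{-k}`. -/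
def IsLevel {n : ℕ} (k : ℕ) (B : Set (Fin n → ℝ)) : Prop :=
  ∀ x y, dq k x = dq k y → x ∈ B → y ∈ B

theorem IsLevel.eq_preimage {n k : ℕ} {B : Set (Fin n → ℝ)} (hB : IsLevel k B) :
    B = dq k ⁻¹' (dq k '' B) := by
  refine (Set.subset_preimage_image _ _).antisymm ?_
  rintro y ⟨x, hx, hxy⟩
  exact hB x y hxy hx

theorem IsLevel.measurableSet {n k : ℕ} {B : Set (Fin n → ℝ)} (hB : IsLevel k B) :
    MeasurableSet B := by
  rw [hB.eq_preimage]; exact measurable_dq k (Set.to_countable _).measurableSet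

theorem IsLevel.mono {n k k' : ℕ} (hk : k ≤ k') {B : Set (Fin n → ℝ)} (hB : IsLevel k B) :
    IsLevel k' B := fun x y h hx => hB x y (dq_eq_of_le hk h) hx

theorem IsLevel.inter {n k : ℕ} {B B' : Set (Fin n → ℝ)} (hB : IsLevel k B) (hB' : IsLevel k B') :
    IsLevel k (B ∩ B') := fun x y h hx => ⟨hB x y h hx.1, hB' x y h hx.2⟩

theorem isLevel_dE {n k k' : ℕ} (hk : k ≤ k') (h : (Fin n → ℝ) → ℝ≥0∞) (P : ℝ≥0∞ → Prop) :
    IsLevel k' {x | P (dE k h x)} := by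
  intro x y hxy hx
  rwa [Set.mem_ofPred_eq, ← dE_congr (dq_eq_of_le hk hxy)]

theorem lintegral_dE {n k : ℕ} {B : Set (Fin n → ℝ)} (hB : IsLevel k B)
    (h : (Fin n → ℝ) → ℝ≥0∞) : ∫⁻ x in B, dE k h x ∂(μT n) = ∫⁻ x in B, h x ∂(μT n) := by
  have hU : B = ⋃ v ∈ dq k '' B, {y | dq k y = v} := by
    ext y
    simp only [Set.mem_iUnion, Set.mem_ofPred_eq, exists_prop, exists_eq_right']
    constructor
    · intro hy; exact ⟨y, hy, rfl⟩
    · rintro ⟨x, hx, hxy⟩; exact hB x y hxy hx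
  have hd : (dq k '' B).PairwiseDisjoint fun v => {y : Fin n → ℝ | dq k y = v} := by
    intro v _ w _ hvw
    rw [Function.onFun, Set.disjoint_left]
    rintro y rfl hy
    exact hvw hy
  rw [hU, lintegral_biUnion (Set.to_countable _) (fun v _ => measurableSet_dq_eq k v) hd,
    lintegral_biUnion (Set.to_countable _) (fun v _ => measurableSet_dq_eq k v) hd]
  congr 1
  ext ⟨v, hv⟩
  by_cases hv' : ∃ x ∈ cube n, dq k x = v
  · obtain ⟨x, hx, rfl⟩ := hv'
    rw [setLIntegral_congr_fun (measurableSet_dq_eq k _) (g := fun _ => dE k h x)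
      (fun y hy => dE_congr hy h), setLIntegral_const, dE, mul_right_comm, measure_dq_eq k hx,
      one_mul]
  · have h0 : μT n {y | dq k y = v} = 0 := by
      rw [μT, Measure.restrict_apply (measurableSet_dq_eq k _)]
      convert measure_empty (μ := (volume : Measure (Fin n → ℝ)))
      ext y
      simp only [Set.mem_inter_iff, Set.mem_ofPred_eq, Set.mem_empty_iff_false, iff_false, not_and]
      exact fun h1 h2 => hv' ⟨y, h2, h1⟩
    rw [Measure.restrict_eq_zero.2 h0, lintegral_zero_measure, lintegral_zero_measure]

/-- Local weak type estimate for the dyadic maximal function. -/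
theorem dyadic_weak_type {n : ℕ} {h : (Fin n → ℝ) → ℝ≥0∞} (lam : ℝ≥0∞) (m : ℕ) :
    ∀ (k : ℕ) (B : Set (Fin n → ℝ)), IsLevel k B →
      lam * μT n (B ∩ {x | ∃ k', k ≤ k' ∧ k' ≤ k + m ∧ lam < dE k' h x}) ≤
        ∫⁻ x in B, h x ∂(μT n) := by
  have base : ∀ (k : ℕ) (B : Set (Fin n → ℝ)), IsLevel k B →
      lam * μT n (B ∩ {x | lam < dE k h x}) ≤ ∫⁻ x in B ∩ {x | lam < dE k h x}, h x ∂(μT n) := by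
    intro k B hB
    have hl := hB.inter (isLevel_dE le_rfl h (fun t => lam < t))
    rw [← lintegral_dE hl, ← setLIntegral_const]
    exact setLIntegral_mono' hl.measurableSet fun x hx => (le_of_lt hx.2)
  induction m with
  | zero =>
    intro k B hB
    refine le_trans ?_ ((base k B hB).trans (lintegral_mono_set Set.inter_subset_left))
    gcongr
    rintro ⟨k', h1, h2, h3⟩
    rwa [show k = k' by omega]
  | succ m ih =>
    intro k B hB
    set B₁ := B ∩ {x | lam < dE k h x} with hB₁
    set B₂ := B ∩ {x | ¬ lam < dE k h x} with hB₂
    have hl₁ : IsLevel k B₁ := hB.inter (isLevel_dE le_rfl h (fun t => lam < t))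
    have hl₂ : IsLevel k B₂ := hB.inter (isLevel_dE le_rfl h (fun t => ¬ lam < t))
    have hsub : B ∩ {x | ∃ k', k ≤ k' ∧ k' ≤ k + (m + 1) ∧ lam < dE k' h x} ⊆
        B₁ ∪ (B₂ ∩ {x | ∃ k', k + 1 ≤ k' ∧ k' ≤ k + 1 + m ∧ lam < dE k' h x}) := by
      rintro x ⟨hxB, k', h1, h2, h3⟩
      by_cases hx : lam < dE k h x
      · exact Or.inl ⟨hxB, hx⟩
      · refine Or.inr ⟨⟨hxB, hx⟩, k', ?_, by omega, h3⟩
        rcases h1.eq_or_lt with rfl | h4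
        · exact absurd h3 hx
        · exact h4
    have hun : B = B₁ ∪ B₂ := by
      rw [hB₁, hB₂, ← Set.inter_union_distrib_left]
      ext x; simp [lt_or_ge]
    have hdis : Disjoint B₁ B₂ := by
      rw [Set.disjoint_left]; rintro x ⟨_, h1⟩ ⟨_, h2⟩; exact h2 h1
    calc _ ≤ lam * (μT n B₁ + μT n (B₂ ∩
          {x | ∃ k', k + 1 ≤ k' ∧ k' ≤ k + 1 + m ∧ lam < dE k' h x})) := by
          gcongr
          exact (measure_mono hsub).trans (measure_union_le _ _)
      _ ≤ ∫⁻ x in B₁, h x ∂(μT n) + ∫⁻ x in B₂, h x ∂(μT n) := by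
          rw [mul_add]
          exact add_le_add (base k B hB) (ih (k + 1) B₂ (hl₂.mono (Nat.le_succ k)))
      _ = ∫⁻ x in B, h x ∂(μT n) := by
          rw [← lintegral_union hl₂.measurableSet hdis, ← hun]

theorem dE_norm_le {n : ℕ} (k : ℕ) {B : (Fin n → ℝ) → ℂ} (hB : Measurable B) {t : ℝ≥0∞}
    (ht : t ≠ ∞) (ht0 : t ≠ 0) {x : Fin n → ℝ}
    (hx : dE k (fun y => ‖B y‖ₑ ^ 2) x ≤ t ^ 2) : dE k (fun y => ‖B y‖ₑ) x ≤ 2 * t := by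
  have h1 : ∀ b : ℝ≥0∞, b ≤ t + t⁻¹ * b ^ 2 := by
    intro b
    rcases le_total b t with h | h
    · exact h.trans le_self_add
    · calc b = t⁻¹ * t * b := by rw [ENNReal.inv_mul_cancel ht0 ht, one_mul]
        _ ≤ t⁻¹ * b * b := by gcongr
        _ = t⁻¹ * b ^ 2 := by ring
        _ ≤ _ := le_add_self
  calc _ ≤ dE k (fun y => t + t⁻¹ * ‖B y‖ₑ ^ 2) x := dE_mono k (fun y => h1 _) x
    _ = dE k (fun _ => t) x + t⁻¹ * dE k (fun y => ‖B y‖ₑ ^ 2) x := by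
        rw [dE_add k measurable_const, dE_const_mul k (hB.enorm.pow_const 2)]
    _ ≤ t + t⁻¹ * t ^ 2 := by
        gcongr
        exact dE_le_of_le k (fun _ => le_rfl) x
    _ = 2 * t := by
        rw [pow_two, ← mul_assoc, ENNReal.inv_mul_cancel ht0 ht, one_mul, two_mul]

/-- The good-`λ` inequality for the dyadic maximal function of `F = G + B`, where `G` has small
mean oscillation and `B` is small in `L²`. -/
theorem good_lambda {n : ℕ} {F G B : (Fin n → ℝ) → ℂ} (hG : Measurable G)
    (hB : Measurable B) (hF : ∀ x, F x = G x + B x) (c : ℕ → (Fin n → ℤ) → ℂ)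
    (C₀ lam t : ℝ≥0∞) (ht : t ≠ ∞) (ht0 : t ≠ 0) (hlam : lam ≠ ∞)
    (hC : (C₀ + 2) * t ≤ lam)
    (hosc : ∀ k, ∀ x ∈ cube n, dE k (fun y => ‖G y - c k (dq k y)‖ₑ) x ≤ C₀ * t)
    (hzero : ∀ x ∈ cube n, dE 0 (fun y => ‖G y‖ₑ) x ≤ C₀ * t) (K : ℕ) :
    μT n {x | ∃ k ≤ K, (2 ^ n + 2) * lam < dE k (fun y => ‖F y‖ₑ) x} ≤
      t⁻¹ ^ 2 * ∫⁻ x, ‖B x‖ₑ ^ 2 ∂(μT n) +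
        (C₀ + 2) * t / lam * μT n {x | ∃ k ≤ K, lam < dE k (fun y => ‖F y‖ₑ) x} := by
  classical
  have hF' : F = fun x => G x + B x := funext hF
  have hFm : Measurable F := by rw [hF']; exact hG.add hB
  set f : (Fin n → ℝ) → ℝ≥0∞ := fun y => ‖F y‖ₑ with hf
  have hlam0 : lam ≠ 0 := by
    rintro rfl
    have : (C₀ + 2) * t = 0 := le_antisymm hC (by simp)
    simp [ht0] at this
  set N : Set (Fin n → ℝ) := {x | ∃ k ≤ K, t ^ 2 < dE k (fun y => ‖B y‖ₑ ^ 2) x} with hN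
  have hNm : μT n N ≤ t⁻¹ ^ 2 * ∫⁻ x, ‖B x‖ₑ ^ 2 ∂(μT n) := by
    have := dyadic_weak_type (n := n) (h := fun y => ‖B y‖ₑ ^ 2) (t ^ 2) K 0 Set.univ
      (fun _ _ _ _ => trivial)
    simp only [Set.univ_inter, zero_le, true_and, zero_add, Measure.restrict_univ] at this
    calc μT n N = t⁻¹ ^ 2 * (t ^ 2 * μT n N) := by
          rw [← mul_assoc, ← mul_pow, ENNReal.inv_mul_cancel ht0 ht, one_pow, one_mul]
      _ ≤ _ := by gcongr
  have hBN : ∀ x ∉ N, ∀ k ≤ K, dE k (fun y => ‖B y‖ₑ) x ≤ 2 * t := by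
    intro x hx k hk
    refine dE_norm_le k hB ht ht0 (not_lt.1 fun h => hx ⟨k, hk, h⟩)
  have hcm : ∀ k, Measurable fun y => c k (dq k y) := fun k =>
    Measurable.of_discrete.comp (measurable_dq k)
  set d : ℕ → (Fin n → ℝ) → ℝ≥0∞ := fun k y => ‖F y - c k (dq k y)‖ₑ with hd
  have hdm : ∀ k, Measurable (d k) := fun k => (hFm.sub (hcm k)).enorm
  have hdN : ∀ x ∈ cube n, x ∉ N → ∀ k ≤ K, dE k (d k) x ≤ (C₀ + 2) * t := by
    intro x hxc hx k hk
    calc dE k (d k) x ≤ dE k (fun y => ‖G y - c k (dq k y)‖ₑ + ‖B y‖ₑ) x := by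
          refine dE_mono k (fun y => ?_) x
          rw [hd]
          simp only [hF]
          rw [add_sub_right_comm]
          exact enorm_add_le _ _
      _ ≤ C₀ * t + 2 * t := by
          rw [dE_add k (g := fun y => ‖G y - c k (dq k y)‖ₑ) (hG.sub (hcm k)).enorm]
          exact add_le_add (hosc k x hxc) (hBN x hx k hk)
      _ = _ := by ring
  have hF0 : ∀ x ∈ cube n, x ∉ N → dE 0 f x ≤ lam := by
    intro x hxc hx
    refine le_trans ?_ hC
    calc dE 0 f x ≤ dE 0 (fun y => ‖G y‖ₑ + ‖B y‖ₑ) x := by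
          refine dE_mono 0 (fun y => ?_) x
          rw [hf]; simp only [hF]; exact enorm_add_le _ _
      _ ≤ C₀ * t + 2 * t := by
          rw [dE_add 0 hG.enorm]
          exact add_le_add (hzero x hxc) (hBN x hx 0 (Nat.zero_le _))
      _ = _ := by ring
  set A : ℕ → Set (Fin n → ℝ) := fun k => {x | lam < dE k f x} ∩ {x | ∀ i < k, ¬ lam < dE i f x}
    with hA
  have hAl : ∀ k, IsLevel k (A k) := by
    intro k
    refine (isLevel_dE le_rfl f (fun s => lam < s)).inter ?_
    intro x y hxy hx i hi
    exact isLevel_dE hi.le f (fun s => ¬ lam < s) x y hxy (hx i hi)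
  set S : ℕ → Set (Fin n → ℝ) := fun k => A k ∩ {x | dE k (d k) x ≤ (C₀ + 2) * t} with hS
  have hSl : ∀ k, IsLevel k (S k) := fun k =>
    (hAl k).inter (isLevel_dE le_rfl (d k) (fun s => s ≤ (C₀ + 2) * t))
  set W : ℕ → Set (Fin n → ℝ) := fun k =>
    S k ∩ {x | ∃ k', k ≤ k' ∧ k' ≤ k + K ∧ lam < dE k' (d k) x}
    with hW
  have hWm : ∀ k, μT n (W k) ≤ (C₀ + 2) * t / lam * μT n (A k) := by
    intro k
    have h1 := dyadic_weak_type (h := d k) lam K k (S k) (hSl k)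
    have h2 : ∫⁻ x in S k, d k x ∂(μT n) ≤ (C₀ + 2) * t * μT n (A k) := by
      rw [← lintegral_dE (hSl k)]
      refine (setLIntegral_mono' (g := fun _ => (C₀ + 2) * t) (hSl k).measurableSet
        fun x hx => hx.2).trans ?_
      rw [setLIntegral_const]
      gcongr
      exact Set.inter_subset_left
    rw [ENNReal.div_eq_inv_mul, mul_assoc]
    calc μT n (W k) = lam⁻¹ * (lam * μT n (W k)) := by
          rw [← mul_assoc, ENNReal.inv_mul_cancel hlam0 hlam, one_mul]
      _ ≤ _ := mul_le_mul_right (h1.trans h2) _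
  have hcover : {x | ∃ k ≤ K, (2 ^ n + 2) * lam < dE k f x} ∩ cube n ⊆
      N ∪ ⋃ k ∈ Finset.range (K + 1), W k := by
    rintro x ⟨⟨k₁, hk₁, hx₁⟩, hxc⟩
    by_cases hxN : x ∈ N
    · exact Or.inl hxN
    refine Or.inr ?_
    have hbig : lam ≤ (2 ^ n + 2) * lam := by
      refine le_mul_of_one_le_left' ?_
      exact le_trans (by norm_num : (1 : ℝ≥0∞) ≤ 2) le_add_self
    have hex : ∃ k, lam < dE k f x := ⟨k₁, hbig.trans_lt hx₁⟩
    set k := Nat.find hex with hk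
    have hkspec := Nat.find_spec hex
    have hkk : k ≤ k₁ := Nat.find_min' hex (hbig.trans_lt hx₁)
    have hk0 : k ≠ 0 := by
      intro h0
      rw [← hk, h0] at hkspec
      exact absurd (hF0 x hxc hxN) (not_le.2 hkspec)
    obtain ⟨i, hi⟩ := Nat.exists_eq_succ_of_ne_zero hk0
    have hi2 : dE i f x ≤ lam := not_lt.1 (Nat.find_min hex (by omega))
    have hdx := hdN x hxc hxN k (hkk.trans hk₁)
    have hcx : ‖c k (dq k x)‖ₑ ≤ (2 ^ n + 1) * lam := by
      rw [← dE_level k (fun v => ‖c k v‖ₑ) hxc]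
      calc _ ≤ dE k (fun y => f y + d k y) x := by
            refine dE_mono k (fun y => ?_) x
            rw [hf, hd]
            have := enorm_sub_le (a := F y) (b := F y - c k (dq k y))
            rwa [_root_.sub_sub_cancel] at this
        _ = dE k f x + dE k (d k) x := dE_add k hFm.enorm _ x
        _ ≤ 2 ^ n * lam + lam := by
            refine add_le_add ?_ (hdx.trans hC)
            rw [hi]
            exact (dE_succ_le i f x).trans (by gcongr)
        _ = _ := by ring
    refine Set.mem_biUnion (x := k) (by simp; omega) ⟨⟨⟨hkspec, fun i hi => Nat.find_min hex hi⟩,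
      hdx⟩, k₁, hkk, by omega, ?_⟩
    by_contra hcon
    push Not at hcon
    refine absurd hx₁ (not_lt.2 ?_)
    calc dE k₁ f x ≤ dE k₁ (fun y => d k y + ‖c k (dq k y)‖ₑ) x := by
          refine dE_mono k₁ (fun y => ?_) x
          rw [hf, hd]
          have := enorm_add_le (F y - c k (dq k y)) (c k (dq k y))
          rwa [sub_add_cancel] at this
      _ = dE k₁ (d k) x + dE k₁ (fun y => ‖c k (dq k y)‖ₑ) x := dE_add k₁ (hdm k) _ x
      _ ≤ lam + (2 ^ n + 1) * lam := by
          refine add_le_add hcon (le_trans ?_ hcx)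
          exact dE_level_le k hkk (fun v => ‖c k v‖ₑ) x
      _ = (2 ^ n + 2) * lam := by ring
  have hdis : ((Finset.range (K + 1) : Finset ℕ) : Set ℕ).PairwiseDisjoint A := by
    intro i _ j _ hij
    rw [Function.onFun, Set.disjoint_left]
    rintro x ⟨h1, h2⟩ ⟨h3, h4⟩
    rcases lt_or_gt_of_ne hij with h | h
    · exact h4 i h h1
    · exact h2 j h h3
  calc μT n {x | ∃ k ≤ K, (2 ^ n + 2) * lam < dE k f x}
      = μT n ({x | ∃ k ≤ K, (2 ^ n + 2) * lam < dE k f x} ∩ cube n) := by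
        rw [Set.inter_comm, Measure.measure_inter_eq_of_ae (ae_mem_cube n)]
    _ ≤ μT n N + μT n (⋃ k ∈ Finset.range (K + 1), W k) :=
        (measure_mono hcover).trans (measure_union_le _ _)
    _ ≤ μT n N + ∑ k ∈ Finset.range (K + 1), (C₀ + 2) * t / lam * μT n (A k) := by
        gcongr
        exact (measure_biUnion_finset_le _ _).trans (Finset.sum_le_sum fun k _ => hWm k)
    _ = μT n N + (C₀ + 2) * t / lam * μT n (⋃ k ∈ Finset.range (K + 1), A k) := by
        rw [← Finset.mul_sum, measure_biUnion_finset hdis fun k _ => (hAl k).measurableSet]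
    _ ≤ _ := by
        gcongr
        intro x hx
        simp only [Set.mem_iUnion, Finset.mem_range, exists_prop] at hx
        obtain ⟨k, hk, hx⟩ := hx
        exact ⟨k, by omega, hx.1⟩

theorem exists_le_dE {n : ℕ} {F : (Fin n → ℝ) → ℂ} (hF : Continuous F) {x : Fin n → ℝ}
    (hx : x ∈ cube n) {a : ℝ≥0∞} (ha : a < ‖F x‖ₑ) :
    ∀ᶠ K in Filter.atTop, a ≤ dE K (fun y => ‖F y‖ₑ) x := by
  have h1 : ∀ᶠ y in nhds x, a < ‖F y‖ₑ := hF.enorm.continuousAt.eventually (lt_mem_nhds ha)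
  obtain ⟨ε, hε, hball⟩ := Metric.eventually_nhds_iff.1 h1
  have h2 : ∀ᶠ K : ℕ in Filter.atTop, ((1 : ℝ) / 2) ^ K < ε :=
    (_root_.tendsto_pow_atTop_nhds_zero_of_lt_one (by norm_num) (by norm_num)).eventually
      (gt_mem_nhds hε)
  filter_upwards [h2] with K hK
  calc a = (2 ^ n) ^ K * μT n {y | dq K y = dq K x} * a := by rw [measure_dq_eq K hx, one_mul]
    _ = (2 ^ n) ^ K * ∫⁻ _ in {y | dq K y = dq K x}, a ∂(μT n) := by
        rw [setLIntegral_const, mul_assoc, mul_comm a]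
    _ ≤ _ := by
        refine mul_le_mul_right (setLIntegral_mono' (measurableSet_dq_eq K _) fun y hy => ?_) _
        refine (hball ?_).le
        refine lt_of_le_of_lt ((dist_pi_le_iff (by positivity)).2 fun l => ?_) hK
        exact (abs_sub_lt_of_dq_eq hy l).le

/-- Integrated form of the good-`λ` inequality. -/
theorem exists_lintegral_rpow_le_of_split (n : ℕ) {p : ℝ} (hp : 0 < p) {C₀ : ℝ} (hC₀ : 0 ≤ C₀) :
    ∃ γ > 0, ∃ C > 0, ∀ F : (Fin n → ℝ) → ℂ, Continuous F → BddMeas F → ∀ β : ℝ → ℝ≥0∞,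
      (∀ lam > 0, ∃ G B : (Fin n → ℝ) → ℂ, ∃ c : ℕ → (Fin n → ℤ) → ℂ, Measurable G ∧
        Measurable B ∧ (∀ x, F x = G x + B x) ∧
        (∀ k, ∀ x ∈ cube n, dE k (fun y => ‖G y - c k (dq k y)‖ₑ) x ≤
          ENNReal.ofReal (C₀ * (γ * lam))) ∧
        (∀ x ∈ cube n, dE 0 (fun y => ‖G y‖ₑ) x ≤ ENNReal.ofReal (C₀ * (γ * lam))) ∧
        ∫⁻ x, ‖B x‖ₑ ^ 2 ∂(μT n) ≤ β lam) →
      ∫⁻ x, ‖F x‖ₑ ^ p ∂(μT n) ≤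
        ENNReal.ofReal C * ∫⁻ t in Set.Ioi (0 : ℝ), ENNReal.ofReal (t ^ (p - 3)) * β t := by
  have := isProbabilityMeasure_μT n
  set H : ℝ := 2 ^ n + 2 with hH
  have hH1 : 1 ≤ H := by have : (0 : ℝ) < 2 ^ n := by positivity
                         linarith
  have hH0 : 0 < H := by linarith
  have hHp : 0 < H ^ (-p) := by positivity
  have hHp1 : H ^ (-p) ≤ 1 := Real.rpow_le_one_of_one_le_of_nonpos hH1 (by linarith)
  refine ⟨H ^ (-p) / (2 * (C₀ + 2)), by positivity,
    2 * H ^ p * p * (H ^ (-p) / (2 * (C₀ + 2)))⁻¹ ^ 2, by positivity, ?_⟩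
  set γ := H ^ (-p) / (2 * (C₀ + 2)) with hγ
  have hγ0 : 0 < γ := by positivity
  have hγC : (C₀ + 2) * γ = H ^ (-p) / 2 := by rw [hγ]; field_simp
  intro F hFc hFb β hsplit
  set D := ∫⁻ t in Set.Ioi (0 : ℝ), ENNReal.ofReal (t ^ (p - 3)) * β t with hD
  set f : (Fin n → ℝ) → ℝ≥0∞ := fun y => ‖F y‖ₑ with hf
  obtain ⟨M₀, hM₀⟩ := hFb.bdd
  have hfM : ∀ x, f x ≤ ENNReal.ofReal M₀ := fun x => by
    simp only [hf, ← ofReal_norm]; exact ENNReal.ofReal_le_ofReal (hM₀ x)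
  set M : ℕ → (Fin n → ℝ) → ℝ≥0∞ := fun K x => (Finset.range (K + 1)).sup fun k => dE k f x
    with hM
  have hMle : ∀ K x, M K x ≤ ENNReal.ofReal M₀ := fun K x =>
    Finset.sup_le fun k _ => dE_le_of_le k hfM x
  have hMtop : ∀ K x, M K x ≠ ∞ := fun K x => ((hMle K x).trans_lt ofReal_lt_top).ne
  have hMm : ∀ K, Measurable (M K) := fun K => by
    have h (s : Finset ℕ) : Measurable fun x => s.sup fun k => dE k f x := ?_
    · exact h _
    refine Finset.induction_on s ?_ fun k s _ hs => ?_
    · simp only [Finset.sup_empty]; exact measurable_const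
    · simp only [Finset.sup_insert]; exact (measurable_dE k f).max hs
  have hlt : ∀ K x (t : ℝ), t < (M K x).toReal ∧ 0 < t ↔
      (∃ k ≤ K, ENNReal.ofReal t < dE k f x) ∧ 0 < t := by
    intro K x t
    refine and_congr_left fun ht => ?_
    rw [← ENNReal.ofReal_lt_iff_lt_toReal ht.le (hMtop K x), hM]
    simp [Finset.lt_sup_iff]
  have main : ∀ K, ∫⁻ x, M K x ^ p ∂(μT n) ≤
      ENNReal.ofReal (2 * H ^ p * p * γ⁻¹ ^ 2) * D := by
    intro K
    set m : (Fin n → ℝ) → ℝ := fun x => (M K x).toReal with hm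
    have hmm : Measurable m := (hMm K).ennreal_toReal
    have hm0 : ∀ x, 0 ≤ m x := fun x => ENNReal.toReal_nonneg
    have hI : ∫⁻ x, M K x ^ p ∂(μT n) = ∫⁻ x, ENNReal.ofReal (m x ^ p) ∂(μT n) := by
      refine lintegral_congr fun x => ?_
      rw [← ENNReal.ofReal_rpow_of_nonneg (hm0 x) hp.le, ENNReal.ofReal_toReal (hMtop K x)]
    have hfin : ∫⁻ x, ENNReal.ofReal (m x ^ p) ∂(μT n) ≠ ∞ := by
      rw [← hI]
      refine ((lintegral_mono fun x => ENNReal.rpow_le_rpow (hMle K x) hp.le).trans_lt ?_).ne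
      rw [lintegral_const]
      finiteness
    rw [hI]
    set I := ∫⁻ x, ENNReal.ofReal (m x ^ p) ∂(μT n) with hIdef
    have e1 : I = ENNReal.ofReal p * ∫⁻ t in Set.Ioi (0 : ℝ),
        μT n {a | t < m a} * ENNReal.ofReal (t ^ (p - 1)) :=
      lintegral_rpow_eq_lintegral_meas_lt_mul _ (Filter.Eventually.of_forall hm0)
        hmm.aemeasurable hp
    have e2 : ENNReal.ofReal (H ^ (-p)) * I = ENNReal.ofReal p * ∫⁻ t in Set.Ioi (0 : ℝ),
        μT n {a | t < m a / H} * ENNReal.ofReal (t ^ (p - 1)) := by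
      rw [← lintegral_rpow_eq_lintegral_meas_lt_mul _
        (Filter.Eventually.of_forall fun x => div_nonneg (hm0 x) hH0.le)
        (hmm.div_const H).aemeasurable hp, hIdef,
        ← lintegral_const_mul _ (by fun_prop)]
      refine lintegral_congr fun x => ?_
      rw [← ENNReal.ofReal_mul hHp.le, Real.div_rpow (hm0 x) hH0.le, Real.rpow_neg hH0.le]
      congr 1; ring
    have e3 : ∀ t ∈ Set.Ioi (0 : ℝ), μT n {a | t < m a / H} * ENNReal.ofReal (t ^ (p - 1)) ≤
        ENNReal.ofReal (γ⁻¹ ^ 2) * (ENNReal.ofReal (t ^ (p - 3)) * β t) +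
          ENNReal.ofReal ((C₀ + 2) * γ) *
            (μT n {a | t < m a} * ENNReal.ofReal (t ^ (p - 1))) := by
      intro t ht
      have ht : 0 < t := ht
      obtain ⟨G, B, c, hG, hB, hFGB, hosc, hzero, hβ⟩ := hsplit t ht
      have hγt : 0 < γ * t := by positivity
      have hg := good_lambda hG hB hFGB c (ENNReal.ofReal C₀) (ENNReal.ofReal t)
        (ENNReal.ofReal (γ * t)) ofReal_ne_top (by simpa using hγt) ofReal_ne_top
        (by
          rw [← ENNReal.ofReal_ofNat, ← ENNReal.ofReal_add hC₀ (by norm_num),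
            ← ENNReal.ofReal_mul (by positivity), ← mul_assoc, hγC]
          refine ENNReal.ofReal_le_ofReal ?_
          nlinarith)
        (by simpa only [ENNReal.ofReal_mul hC₀] using hosc)
        (by simpa only [ENNReal.ofReal_mul hC₀] using hzero) K
      have hset : {a | t < m a / H} = {x | ∃ k ≤ K, (2 ^ n + 2) * ENNReal.ofReal t <
          dE k (fun y => ‖F y‖ₑ) x} := by
        ext x
        have h1 := hlt K x (H * t)
        have hHt : 0 < H * t := by positivity
        have h2 : ENNReal.ofReal (H * t) = (2 ^ n + 2) * ENNReal.ofReal t := by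
          rw [ENNReal.ofReal_mul hH0.le, hH, ENNReal.ofReal_add (by positivity) (by norm_num),
            ENNReal.ofReal_pow (by norm_num), ENNReal.ofReal_ofNat]
        rw [and_iff_left hHt, and_iff_left hHt, h2] at h1
        rw [Set.mem_ofPred_eq, Set.mem_ofPred_eq, ← h1, lt_div_iff₀' hH0]
      have hset2 : {a | t < m a} = {x | ∃ k ≤ K, ENNReal.ofReal t <
          dE k (fun y => ‖F y‖ₑ) x} := by
        ext x
        have h1 := hlt K x t
        rw [and_iff_left ht, and_iff_left ht] at h1
        exact h1
      rw [← hset, ← hset2] at hg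
      have hk1 : (ENNReal.ofReal (γ * t))⁻¹ ^ 2 * ENNReal.ofReal (t ^ (p - 1)) =
          ENNReal.ofReal (γ⁻¹ ^ 2) * ENNReal.ofReal (t ^ (p - 3)) := by
        rw [← ENNReal.ofReal_inv_of_pos hγt, ← ENNReal.ofReal_pow (by positivity),
          ← ENNReal.ofReal_mul (by positivity), ← ENNReal.ofReal_mul (by positivity)]
        congr 1
        rw [show p - 1 = p - 3 + (2 : ℕ) by push_cast; ring, Real.rpow_add ht,
          Real.rpow_natCast]
        field_simp
      have hk2 : (ENNReal.ofReal C₀ + 2) * ENNReal.ofReal (γ * t) / ENNReal.ofReal t =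
          ENNReal.ofReal ((C₀ + 2) * γ) := by
        rw [← ENNReal.ofReal_ofNat, ← ENNReal.ofReal_add hC₀ (by norm_num),
          ← ENNReal.ofReal_mul (by positivity), ← ENNReal.ofReal_div_of_pos ht]
        congr 1
        field_simp
      rw [hk2] at hg
      calc _ ≤ ((ENNReal.ofReal (γ * t))⁻¹ ^ 2 * β t + ENNReal.ofReal ((C₀ + 2) * γ) *
            μT n {a | t < m a}) * ENNReal.ofReal (t ^ (p - 1)) := by
              refine mul_le_mul_left (hg.trans ?_) _
              gcongr
        _ = _ := by
              rw [add_mul, mul_right_comm, hk1]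
              ring
    have hanti : Measurable fun t : ℝ => μT n {a | t < m a} := by
      refine Antitone.measurable fun s t hst => measure_mono fun x hx => ?_
      exact lt_of_le_of_lt hst hx
    have hmeas : Measurable fun t : ℝ => ENNReal.ofReal ((C₀ + 2) * γ) *
        (μT n {a | t < m a} * ENNReal.ofReal (t ^ (p - 1))) := by fun_prop
    have e4 : ENNReal.ofReal (H ^ (-p)) * I ≤ ENNReal.ofReal (p * γ⁻¹ ^ 2) * D +
        ENNReal.ofReal (H ^ (-p) / 2) * I := by
      rw [e2]
      refine (mul_le_mul_right (setLIntegral_mono' measurableSet_Ioi e3) _).trans ?_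
      rw [lintegral_add_right _ hmeas, lintegral_const_mul' _ _ ofReal_ne_top,
        lintegral_const_mul' _ _ ofReal_ne_top, mul_add, ← mul_assoc,
        ← ENNReal.ofReal_mul hp.le, mul_left_comm, ← e1, hγC]
    have e5 : ENNReal.ofReal (H ^ (-p)) * I = ENNReal.ofReal (H ^ (-p) / 2) * I +
        ENNReal.ofReal (H ^ (-p) / 2) * I := by
      rw [← add_mul, ← ENNReal.ofReal_add (by positivity) (by positivity), add_halves]
    rw [e5] at e4
    have e6 := (ENNReal.add_le_add_iff_right (ENNReal.mul_ne_top ofReal_ne_top hfin)).1 e4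
    calc I = ENNReal.ofReal (2 * H ^ p) * (ENNReal.ofReal (H ^ (-p) / 2) * I) := by
          rw [← mul_assoc, ← ENNReal.ofReal_mul (by positivity), Real.rpow_neg hH0.le]
          rw [show 2 * H ^ p * ((H ^ p)⁻¹ / 2) = 1 by field_simp]
          simp
      _ ≤ ENNReal.ofReal (2 * H ^ p) * (ENNReal.ofReal (p * γ⁻¹ ^ 2) * D) := by gcongr
      _ = _ := by
          rw [← mul_assoc, ← ENNReal.ofReal_mul (by positivity)]
          congr 2; ring
  calc ∫⁻ x, ‖F x‖ₑ ^ p ∂(μT n)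
      ≤ ∫⁻ x, Filter.liminf (fun K => M K x ^ p) Filter.atTop ∂(μT n) := by
        refine lintegral_mono_ae ?_
        filter_upwards [ae_mem_cube n] with x hx
        refine le_of_forall_lt fun b hb => ?_
        obtain ⟨b', hb1, hb2⟩ := exists_between hb
        refine hb1.trans_le (Filter.le_liminf_of_le (by isBoundedDefault) ?_)
        have hb3 : b' ^ p⁻¹ < ‖F x‖ₑ := by
          rw [ENNReal.rpow_inv_lt_iff hp]; exact hb2
        filter_upwards [exists_le_dE hFc hx hb3] with K hK
        rw [← ENNReal.rpow_inv_le_iff hp]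
        exact hK.trans (Finset.le_sup (f := fun k => dE k f x) (by simp))
    _ ≤ Filter.liminf (fun K => ∫⁻ x, M K x ^ p ∂(μT n)) Filter.atTop :=
        lintegral_liminf_le fun K => (hMm K).pow_const p
    _ ≤ _ := Filter.liminf_le_of_le (by isBoundedDefault) fun b hb => by
        obtain ⟨K, hK⟩ := hb.exists
        exact hK.trans (main K)

/-! ### Oscillation of sums of dyadic Fourier multipliers -/

/-- The Fourier multiplier with symbol `u`. -/
def mulOp {n : ℕ} (u : (Fin n → ℤ) → ℂ) (g : (Fin n → ℝ) → ℂ) : (Fin n → ℝ) → ℂ :=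
  trig fun ξ => u ξ * fc g ξ

theorem finite_support_mul_fc {n : ℕ} {u : (Fin n → ℤ) → ℂ} (hu : u.support.Finite)
    (v : (Fin n → ℤ) → ℂ) : (fun ξ => u ξ * v ξ).support.Finite :=
  hu.subset fun ξ hξ h => hξ (by simp [h])

theorem BddMeas.mulOp {n : ℕ} {u : (Fin n → ℤ) → ℂ} (hu : u.support.Finite)
    (g : (Fin n → ℝ) → ℂ) : BddMeas (_root_.mulOp u g) :=
  BddMeas.trig (finite_support_mul_fc hu _)

theorem continuous_mulOp {n : ℕ} {u : (Fin n → ℤ) → ℂ} (hu : u.support.Finite)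
    (g : (Fin n → ℝ) → ℂ) : Continuous (mulOp u g) :=
  (contDiff_trig (finite_support_mul_fc hu _)).continuous

theorem fc_add {n : ℕ} {f g : (Fin n → ℝ) → ℂ} (hf : BddMeas f) (hg : BddMeas g)
    (ξ : Fin n → ℤ) : fc (fun x => f x + g x) ξ = fc f ξ + fc g ξ := by
  simp only [fc_eq, mul_add]
  exact integral_add ((BddMeas.eChar ξ).conj.mul hf).integrable
    ((BddMeas.eChar ξ).conj.mul hg).integrable

theorem trig_add {n : ℕ} {a b : (Fin n → ℤ) → ℂ} (ha : a.support.Finite) (hb : b.support.Finite)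
    (x : Fin n → ℝ) : trig (fun ξ => a ξ + b ξ) x = trig a x + trig b x := by
  classical
  have hS : ∀ ξ ∉ ha.toFinset ∪ hb.toFinset, a ξ = 0 ∧ b ξ = 0 := by
    intro ξ hξ
    rw [Finset.mem_union, not_or] at hξ
    exact ⟨eq_zero_of_notMem_toFinset ha ξ hξ.1, eq_zero_of_notMem_toFinset hb ξ hξ.2⟩
  rw [trig_eq_sum (S := ha.toFinset ∪ hb.toFinset) (fun ξ hξ => (hS ξ hξ).1),
    trig_eq_sum (S := ha.toFinset ∪ hb.toFinset) (fun ξ hξ => (hS ξ hξ).2),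
    trig_eq_sum (S := ha.toFinset ∪ hb.toFinset) (fun ξ hξ => by simp [hS ξ hξ]),
    ← Finset.sum_add_distrib]
  exact Finset.sum_congr rfl fun ξ _ => add_mul _ _ _

theorem trig_finset_sum {n : ℕ} {ι : Type*} (S : Finset ι) {a : ι → (Fin n → ℤ) → ℂ}
    (ha : ∀ i ∈ S, (a i).support.Finite) (x : Fin n → ℝ) :
    trig (fun ξ => ∑ i ∈ S, a i ξ) x = ∑ i ∈ S, trig (a i) x := by
  classical
  have hS : ∀ ξ ∉ S.biUnion fun i => if h : (a i).support.Finite then h.toFinset else ∅,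
      ∀ i ∈ S, a i ξ = 0 := by
    intro ξ hξ i hi
    by_contra h
    refine hξ (Finset.mem_biUnion.2 ⟨i, hi, ?_⟩)
    rw [dif_pos (ha i hi)]
    simpa using h
  rw [trig_eq_sum (fun ξ hξ => Finset.sum_eq_zero (hS ξ hξ)),
    Finset.sum_congr rfl fun i hi => trig_eq_sum (fun ξ hξ => hS ξ hξ i hi) x, Finset.sum_comm]
  exact Finset.sum_congr rfl fun ξ _ => Finset.sum_mul _ _ _

theorem mulOp_add {n : ℕ} {u : (Fin n → ℤ) → ℂ} (hu : u.support.Finite) {f g : (Fin n → ℝ) → ℂ}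
    (hf : BddMeas f) (hg : BddMeas g) (x : Fin n → ℝ) :
    mulOp u (fun x => f x + g x) x = mulOp u f x + mulOp u g x := by
  rw [mulOp, mulOp, mulOp, ← trig_add (finite_support_mul_fc hu _) (finite_support_mul_fc hu _)]
  simp only [fc_add hf hg, mul_add]

theorem exists_mulOp_dyadic_le (n : ℕ) (hn : 1 ≤ n) (ρ μ c : ℝ) (hc : 1 ≤ c) :
    ∃ K : ℝ, 0 < K ∧ ∀ (u : (Fin n → ℤ) → ℂ) (A : ℝ) (j : ℕ), 0 < A →
      SymCl (n / 2 + 1) ρ μ A u → IsDyadic c j u → ∀ (x : Fin n → ℝ) (r N : ℝ), 0 ≤ r → 0 ≤ N →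
        ∀ g : (Fin n → ℝ) → ℂ, BddMeas g → (∀ y, ‖g y‖ ≤ N) →
        (∀ y, g y ≠ 0 → ∃ l, r ≤ chord (x l) (y l)) →
        ‖mulOp u g x‖ ≤ K * A * ((2 : ℝ) ^ j) ^ ((n : ℝ) / 2 + μ - ρ * (n / 2)) *
          (1 + ((2 : ℝ) ^ j) ^ ρ * r) ^ (-(1 / (4 * (n : ℝ)))) * N := by
  obtain ⟨K₁, hK₁, h1⟩ := exists_norm_multiplier_le n hn
  obtain ⟨K₂, hK₂, h2⟩ := SymL2.of_dyadic n hn ρ μ c hc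
  refine ⟨K₁ * K₂, by positivity, fun u A j hA hu hd x r N hr hN g hg hgN hgr => ?_⟩
  have h2j : (0 : ℝ) < 2 ^ j := by positivity
  refine (h1 _ _ (by positivity) (by positivity) u (h2 u A j hA.le hu hd) x r N hr hN g hg hgN
    hgr).trans (le_of_eq ?_)
  rw [← Real.rpow_mul h2j.le, show (n : ℝ) / 2 + μ - ρ * (n / 2) = (n : ℝ) / 2 + μ +
    ρ * (-((n : ℝ) / 2)) by ring, Real.rpow_add h2j ((n : ℝ) / 2 + μ)]
  ring

theorem hasFDerivAt_eChar {n : ℕ} (ξ : Fin n → ℤ) (z v : Fin n → ℝ) (t : ℝ) :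
    HasDerivAt (fun t : ℝ => eChar (z + t • v) ξ)
      (2 * π * Complex.I * (∑ l, (v l : ℂ) * (ξ l : ℂ)) * eChar (z + t • v) ξ) t := by
  unfold eChar
  have h1 : HasDerivAt (fun t : ℝ => 2 * (π : ℂ) * Complex.I *
      ∑ j, (((z + t • v) j : ℝ) : ℂ) * (ξ j : ℂ))
      (2 * π * Complex.I * (∑ l, (v l : ℂ) * (ξ l : ℂ))) t := by
    refine HasDerivAt.const_mul _ (HasDerivAt.fun_sum fun j _ => HasDerivAt.mul_const ?_ _)
    have h2 : HasDerivAt (fun t : ℝ => z j + t * v j) (v j) t := by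
      simpa using ((hasDerivAt_id t).mul_const (v j)).const_add (z j)
    simpa using h2.ofReal_comp
  have := h1.cexp
  rwa [mul_comm (Complex.exp _)] at this

theorem norm_trig_sub_le {n : ℕ} {a : (Fin n → ℤ) → ℂ} (ha : a.support.Finite) {M : ℝ}
    (hM : ∀ l w, ‖trig (fun ξ => a ξ * (ξ l : ℂ)) w‖ ≤ M) (y z : Fin n → ℝ) :
    ‖trig a y - trig a z‖ ≤ 2 * π * ∑ l, |y l - z l| * M := by
  set S := ha.toFinset
  have hS : ∀ ξ ∉ S, a ξ = 0 := eq_zero_of_notMem_toFinset ha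
  have hd : ∀ t : ℝ, HasDerivAt (fun t : ℝ => trig a (z + t • (y - z)))
      (2 * π * Complex.I * ∑ l, ((y - z) l : ℂ) * trig (fun ξ => a ξ * (ξ l : ℂ))
        (z + t • (y - z))) t := by
    intro t
    have e1 : (fun t : ℝ => trig a (z + t • (y - z))) = fun t : ℝ =>
        ∑ ξ ∈ S, a ξ * eChar (z + t • (y - z)) ξ := funext fun t => trig_eq_sum hS _
    rw [e1]
    have := HasDerivAt.fun_sum (u := S) fun ξ _ =>
      (hasFDerivAt_eChar ξ z (y - z) t).const_mul (a ξ)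
    refine this.congr_deriv ?_
    rw [Finset.mul_sum]
    have e2 : ∀ l w, trig (fun ξ => a ξ * (ξ l : ℂ)) w =
        ∑ ξ ∈ S, a ξ * (ξ l : ℂ) * eChar w ξ := fun l w =>
      trig_eq_sum (fun ξ hξ => by simp [hS ξ hξ]) w
    simp_rw [e2, Finset.mul_sum, Finset.sum_mul, Finset.mul_sum]
    rw [Finset.sum_comm]
    refine Finset.sum_congr rfl fun l _ => Finset.sum_congr rfl fun ξ _ => by ring
  have := Convex.norm_image_sub_le_of_norm_hasDerivWithin_le (s := Set.univ)
    (fun t _ => (hd t).hasDerivWithinAt) (C := 2 * π * ∑ l, |y l - z l| * M) (fun t _ => ?_)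
    convex_univ (Set.mem_univ 0) (Set.mem_univ 1)
  · simpa using this
  · rw [norm_mul]
    have h2 : ‖(2 * π * Complex.I : ℂ)‖ = 2 * π := by simp [abs_of_pos Real.pi_pos]
    rw [h2]
    gcongr
    refine (norm_sum_le _ _).trans (Finset.sum_le_sum fun l _ => ?_)
    rw [norm_mul]
    gcongr
    · exact (by rw [Complex.norm_real]; rfl : ‖(((y - z) l : ℝ) : ℂ)‖ = |y l - z l|).le
    · exact hM l _

theorem sum_pow_le_of_injOn {θ : ℝ} (h0 : 0 ≤ θ) (h1 : θ < 1) (S : Finset ℕ) {e : ℕ → ℕ}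
    (he : Set.InjOn e S) : ∑ j ∈ S, θ ^ e j ≤ (1 - θ)⁻¹ := by
  rw [← Finset.sum_image (f := fun i => θ ^ i) he, ← tsum_geometric_of_lt_one h0 h1]
  exact (summable_geometric_of_lt_one h0 h1).sum_le_tsum _ fun i _ => by positivity

theorem measurableSet_nbhd {n : ℕ} (x : Fin n → ℝ) (r : ℝ) :
    MeasurableSet {y : Fin n → ℝ | ∀ l, chord (x l) (y l) < r} := by
  simp only [Set.ofPred_forall]
  refine MeasurableSet.iInter fun l => measurableSet_lt ?_ measurable_const
  exact (continuous_chord.comp (continuous_const.prodMk (continuous_apply l))).measurable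

theorem exists_measure_nbhd_le (n : ℕ) {L : ℝ} (hL : 0 ≤ L) :
    ∃ C : ℝ, 0 < C ∧ ∀ R : ℝ, 0 < R → ∀ x : Fin n → ℝ,
      (μT n).real {y | ∀ l, chord (x l) (y l) < L / R} ≤ C * R ^ (-(n : ℝ)) := by
  have := isProbabilityMeasure_μT n
  obtain ⟨C, hC, h⟩ := exists_integral_kw_le n (β := 2) (by norm_num)
  refine ⟨((1 + L) ^ n) ^ (2 : ℝ) * C, by positivity, fun R hR x => ?_⟩
  have hk0 : ∀ y, 0 < kw R x y := fun y => one_pos.trans_le (one_le_kw hR.le x y)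
  have hint : Integrable (fun y => kw R x y ^ (-2 : ℝ)) (μT n) := by
    refine Integrable.of_bound ((continuous_kw R x).rpow_const
      fun y => Or.inl (hk0 y).ne').aestronglyMeasurable 1 (Filter.Eventually.of_forall fun y => ?_)
    rw [Real.norm_of_nonneg (Real.rpow_nonneg (hk0 y).le _)]
    exact Real.rpow_le_one_of_one_le_of_nonpos (one_le_kw hR.le x y) (by norm_num)
  rw [← integral_indicator_one (measurableSet_nbhd x _), mul_assoc]
  refine le_trans ?_ (mul_le_mul_of_nonneg_left (h R hR x) (by positivity))
  rw [← integral_const_mul]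
  refine integral_mono_of_nonneg (Filter.Eventually.of_forall fun y =>
    Set.indicator_nonneg (fun _ _ => zero_le_one) y) (hint.const_mul _)
    (Filter.Eventually.of_forall fun y => ?_)
  have hpos : 0 ≤ ((1 + L) ^ n) ^ (2 : ℝ) * kw R x y ^ (-2 : ℝ) :=
    mul_nonneg (by positivity) (Real.rpow_nonneg (hk0 y).le _)
  refine Set.indicator_le' (g := fun y => ((1 + L) ^ n) ^ (2 : ℝ) * kw R x y ^ (-2 : ℝ))
    (fun y hy => ?_) (fun y _ => mul_nonneg (by positivity) (Real.rpow_nonneg (hk0 y).le _)) y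
  have hle : kw R x y ≤ (1 + L) ^ n := by
    unfold kw
    refine (Finset.prod_le_prod (fun l _ => ?_) (g := fun _ => 1 + L) fun l _ => ?_).trans (by simp)
    · have := chord_nonneg (x l) (y l); positivity
    · have := (lt_div_iff₀' hR).1 (hy l); linarith
  rw [Real.rpow_neg (hk0 y).le, Pi.one_apply, ← div_eq_mul_inv, one_le_div
    (Real.rpow_pos_of_pos (hk0 y) _)]
  exact Real.rpow_le_rpow (hk0 y).le hle (by norm_num)

theorem dE_mono_on {n : ℕ} (k : ℕ) {g h : (Fin n → ℝ) → ℝ≥0∞} {x : Fin n → ℝ}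
    (hgh : ∀ y, dq k y = dq k x → g y ≤ h y) : dE k g x ≤ dE k h x :=
  mul_le_mul_right (setLIntegral_mono' (measurableSet_dq_eq k _) hgh) _

theorem dE_norm_le_of_integral {n : ℕ} (k : ℕ) {B : (Fin n → ℝ) → ℂ} (hB : BddMeas B) {D : ℝ}
    (hD : 0 < D) (h : ∫ y, ‖B y‖ ^ 2 ∂(μT n) ≤ D ^ 2 * ((2 : ℝ) ^ k) ^ (-(n : ℝ)))
    (x : Fin n → ℝ) : dE k (fun y => ‖B y‖ₑ) x ≤ ENNReal.ofReal (2 * D) := by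
  rw [ENNReal.ofReal_mul (by norm_num), ENNReal.ofReal_ofNat]
  refine dE_norm_le k hB.measurable ofReal_ne_top (by simpa using hD) ?_
  have h1 : ∫⁻ y, ‖B y‖ₑ ^ 2 ∂(μT n) = ENNReal.ofReal (∫ y, ‖B y‖ ^ 2 ∂(μT n)) := by
    rw [ofReal_integral_eq_lintegral_ofReal hB.integrable_norm_sq
      (Filter.Eventually.of_forall fun y => by positivity)]
    refine lintegral_congr fun y => ?_
    rw [ENNReal.ofReal_pow (norm_nonneg _), ofReal_norm]
  calc dE k (fun y => ‖B y‖ₑ ^ 2) x ≤ (2 ^ n) ^ k * ∫⁻ y, ‖B y‖ₑ ^ 2 ∂(μT n) :=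
        mul_le_mul_right (setLIntegral_le_lintegral _ _) _
    _ ≤ (2 ^ n) ^ k * ENNReal.ofReal (D ^ 2 * ((2 : ℝ) ^ k) ^ (-(n : ℝ))) := by
        rw [h1]; gcongr
    _ = ENNReal.ofReal D ^ 2 := by
        rw [← ENNReal.ofReal_pow hD.le, ← ENNReal.ofReal_ofNat, ← ENNReal.ofReal_pow (by norm_num),
          ← ENNReal.ofReal_pow (by positivity), ← ENNReal.ofReal_mul (by positivity)]
        congr 1
        rw [Real.rpow_neg (by positivity), Real.rpow_natCast, ← pow_mul, ← pow_mul, mul_comm k n]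
        field_simp

set_option maxHeartbeats 1000000 in
/-- Mean oscillation of a sum of dyadic multipliers of critical order applied to bounded functions,
given the `L²` estimate for the high frequency part. -/
theorem exists_oscillation_le (n : ℕ) (hn : 1 ≤ n) {ρ p A L c : ℝ} (hρ0 : 0 < ρ) (hρ1 : ρ ≤ 1)
    (hA : 0 < A) (hL : 0 < L) (hc : 1 ≤ c) : ∃ C₀ : ℝ, 0 < C₀ ∧
    ∀ u : ℕ → (Fin n → ℤ) → ℂ,
      (∀ j, SymCl (n / 2 + 1) ρ (-(n * (1 - ρ) * (1 / 2 - 1 / p))) A (u j)) →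
      (∀ j, IsDyadic c j (u j)) → ∀ (S : Finset ℕ) (τ : ℝ), 0 < τ →
      ∀ g : ℕ → (Fin n → ℝ) → ℂ, (∀ j, BddMeas (g j)) →
      (∀ j x, ‖g j x‖ ≤ τ * ((2 : ℝ) ^ j) ^ (-(n * (1 - ρ) / p))) →
      (∀ k E, MeasurableSet E → ∫ x, ‖∑ j ∈ S with ¬ j ≤ k, mulOp (u j) (E.indicator (g j)) x‖ ^ 2
        ∂(μT n) ≤ L * τ ^ 2 * ((2 : ℝ) ^ k) ^ (-(n * (1 - ρ))) * (μT n).real E) →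
      ∃ ck : ℕ → (Fin n → ℤ) → ℂ,
        (∀ k, ∀ x ∈ cube n, dE k (fun y => ‖∑ j ∈ S, mulOp (u j) (g j) y - ck k (dq k y)‖ₑ) x ≤
          ENNReal.ofReal (C₀ * τ)) ∧
        ∀ x ∈ cube n, dE 0 (fun y => ‖∑ j ∈ S, mulOp (u j) (g j) y‖ₑ) x ≤
          ENNReal.ofReal (C₀ * τ) := by
  set m := n * (1 - ρ) * (1 / 2 - 1 / p) with hm
  set a := n * (1 - ρ) with ha
  obtain ⟨K₁, hK₁, h1⟩ := exists_mulOp_dyadic_le n hn ρ (-m) c hc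
  obtain ⟨K₂, hK₂, h2⟩ := exists_mulOp_dyadic_le n hn ρ (-m + 1) c hc
  obtain ⟨Km, hKm, h3⟩ := SymCl.exists_mul n (n / 2 + 1) ρ (-m) 1
  obtain ⟨CE, hCE, h4⟩ := exists_measure_nbhd_le n (L := 4 * π) (by positivity)
  obtain ⟨K0, hK0, h5⟩ := SymL2.of_dyadic n hn ρ (-m) c hc
  set δ : ℝ := 1 / (4 * (n : ℝ)) with hδ
  have hn' : (0 : ℝ) < n := by exact_mod_cast hn
  have hδ0 : 0 < δ := by positivity
  set θ : ℝ := 2 ^ (-(ρ * δ)) with hθ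
  have hθ0 : 0 < θ := by positivity
  have hθ1 : θ < 1 := Real.rpow_lt_one_of_one_lt_of_neg (by norm_num) (by nlinarith)
  set CL : ℝ := 2 * π * n * (K₂ * (Km * A * 1)) * 2 with hCL
  set CF : ℝ := K₁ * A * (1 - θ)⁻¹ with hCF
  have h1θ : 0 < 1 - θ := by linarith
  have hCL0 : 0 < CL := by positivity
  have hCF0 : 0 < CF := by positivity
  have hCE2 : 0 < √(L * CE) := Real.sqrt_pos.2 (by positivity)
  refine ⟨CL + CF + 2 * √(L * CE) + K₁ * A, by positivity, ?_⟩
  intro u hu hd S τ hτ g hg hgτ hL2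
  have hfin : ∀ j, (u j).support.Finite := fun j => (h5 _ A j hA.le (hu j) (hd j)).finite
  have h2p : ∀ j : ℕ, (0 : ℝ) < 2 ^ j := fun j => by positivity
  have hexp : ∀ j : ℕ, ((2 : ℝ) ^ j) ^ ((n : ℝ) / 2 + -m - ρ * (n / 2)) *
      ((2 : ℝ) ^ j) ^ (-(a / p)) = 1 := by
    intro j
    rw [← Real.rpow_add (h2p j), show (n : ℝ) / 2 + -m - ρ * (n / 2) + -(a / p) = 0 by
      rw [hm, ha]; ring, Real.rpow_zero]
  have hexp1 : ∀ j : ℕ, ((2 : ℝ) ^ j) ^ ((n : ℝ) / 2 + (-m + 1) - ρ * (n / 2)) *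
      ((2 : ℝ) ^ j) ^ (-(a / p)) = 2 ^ j := by
    intro j
    rw [← Real.rpow_add (h2p j), show (n : ℝ) / 2 + (-m + 1) - ρ * (n / 2) + -(a / p) = 1 by
      rw [hm, ha]; ring, Real.rpow_one]
  have hτj : ∀ j : ℕ, 0 ≤ τ * ((2 : ℝ) ^ j) ^ (-(a / p)) := fun j => by positivity
  have hT : ∀ j x, ‖mulOp (u j) (g j) x‖ ≤ K₁ * A * τ := by
    intro j x
    refine (h1 (u j) A j hA (hu j) (hd j) x 0 _ le_rfl (hτj j) (g j) (hg j) (hgτ j)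
      fun y _ => ⟨⟨0, hn⟩, chord_nonneg _ _⟩).trans (le_of_eq ?_)
    rw [mul_zero, add_zero, Real.one_rpow, mul_one, mul_assoc (K₁ * A), mul_left_comm _ τ, hexp,
      mul_one]
  have hLip : ∀ j y z, ‖mulOp (u j) (g j) y - mulOp (u j) (g j) z‖ ≤
      2 * π * ∑ l, |y l - z l| * (K₂ * (Km * A * 1) * 2 ^ j * τ) := by
    intro j y z
    refine norm_trig_sub_le (finite_support_mul_fc (hfin j) _) (fun l w => ?_) y z
    have e : (fun ξ => u j ξ * fc (g j) ξ * (ξ l : ℂ)) = fun ξ => u j ξ * (ξ l : ℂ) * fc (g j) ξ :=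
      funext fun ξ => mul_right_comm _ _ _
    rw [e]
    have hs := h3 (u j) (fun ξ => (ξ l : ℂ)) A 1 hA.le zero_le_one (hu j)
      ((SymCl.coord l).mono hρ1 le_rfl zero_le_one)
    have hd' : IsDyadic c j fun ξ => u j ξ * (ξ l : ℂ) := by
      have := (hd j).mul_left fun ξ => (ξ l : ℂ)
      simpa only [mul_comm] using this
    refine (h2 _ _ j (by positivity) hs hd' w 0 _ le_rfl (hτj j) (g j) (hg j) (hgτ j)
      fun y _ => ⟨⟨0, hn⟩, chord_nonneg _ _⟩).trans (le_of_eq ?_)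
    rw [mul_zero, add_zero, Real.one_rpow, mul_one, mul_assoc (K₂ * _), mul_left_comm _ τ, hexp1]
    ring
  set ck : ℕ → (Fin n → ℤ) → ℂ := fun k v => ∑ j ∈ S with j ≤ k,
    mulOp (u j) (g j) (fun l => (v l : ℝ) / 2 ^ k) with hck
  have key : ∀ k, ∀ x ∈ cube n,
      dE k (fun y => ‖∑ j ∈ S, mulOp (u j) (g j) y - ck k (dq k y)‖ₑ) x ≤
        ENNReal.ofReal ((CL + CF + 2 * √(L * CE)) * τ) := by
    intro k x hx
    set R : ℝ := ((2 : ℝ) ^ k) ^ ρ with hR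
    have hR0 : 0 < R := by positivity
    have hRk : ((1 : ℝ) / 2) ^ k ≤ 1 / R := by
      rw [one_div, inv_pow, one_div, hR]
      refine inv_anti₀ (by positivity) ?_
      calc ((2 : ℝ) ^ k) ^ ρ ≤ ((2 : ℝ) ^ k) ^ (1 : ℝ) :=
            Real.rpow_le_rpow_of_exponent_le (one_le_pow₀ (by norm_num)) hρ1
        _ = 2 ^ k := Real.rpow_one _
    set E : Set (Fin n → ℝ) := {y | ∀ l, chord (x l) (y l) < 4 * π / R} with hE
    have hEm : MeasurableSet E := measurableSet_nbhd x _
    set loc : (Fin n → ℝ) → ℂ := fun y => ∑ j ∈ S with ¬ j ≤ k, mulOp (u j) (E.indicator (g j)) y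
      with hloc
    set far : (Fin n → ℝ) → ℂ := fun y => ∑ j ∈ S with ¬ j ≤ k,
      mulOp (u j) (Eᶜ.indicator (g j)) y with hfar
    have hlocB : BddMeas loc := BddMeas.sum _ fun j _ => BddMeas.mulOp (hfin j) _
    have hsplit : ∀ y, ∑ j ∈ S, mulOp (u j) (g j) y - ck k (dq k y) =
        (∑ j ∈ S with j ≤ k, (mulOp (u j) (g j) y -
          mulOp (u j) (g j) (fun l => (dq k y l : ℝ) / 2 ^ k)) + far y) + loc y := by
      intro y
      rw [← Finset.sum_filter_add_sum_filter_not S (fun j => j ≤ k), Finset.sum_sub_distrib, hck]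
      have : ∑ j ∈ S with ¬ j ≤ k, mulOp (u j) (g j) y = far y + loc y := by
        rw [hfar, hloc, ← Finset.sum_add_distrib]
        refine Finset.sum_congr rfl fun j _ => ?_
        rw [← mulOp_add (hfin j) ((hg j).indicator hEm.compl) ((hg j).indicator hEm)]
        congr 1
        funext z
        exact (Set.indicator_compl_add_self_apply E (g j) z).symm
      rw [this]
      ring
    have hlow : ∀ y, ‖∑ j ∈ S with j ≤ k, (mulOp (u j) (g j) y -
        mulOp (u j) (g j) (fun l => (dq k y l : ℝ) / 2 ^ k))‖ ≤ CL * τ := by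
      intro y
      set z : Fin n → ℝ := fun l => (dq k y l : ℝ) / 2 ^ k
      have hz : dq k y = dq k z := by
        ext l
        have : (2 : ℝ) ^ k * z l = (dq k y l : ℤ) := by simp only [z]; field_simp
        rw [dq, dq, this, Int.floor_intCast]; rfl
      have hyz := fun l => (abs_sub_lt_of_dq_eq hz l).le
      refine (norm_sum_le _ _).trans ?_
      have hb : ∀ j ∈ S.filter (fun j => j ≤ k), ‖mulOp (u j) (g j) y - mulOp (u j) (g j) z‖ ≤
          2 * π * n * (K₂ * (Km * A * 1)) * τ * (1 / 2) ^ (k - j) := by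
        intro j hj
        have hjk : j ≤ k := (Finset.mem_filter.1 hj).2
        refine (hLip j y z).trans ?_
        have e : ((1 : ℝ) / 2) ^ k * 2 ^ j = (1 / 2) ^ (k - j) := by
          obtain ⟨i, rfl⟩ := Nat.exists_eq_add_of_le hjk
          rw [Nat.add_sub_cancel_left, pow_add, mul_right_comm, ← mul_pow]
          norm_num
        calc _ ≤ 2 * π * ∑ l : Fin n, (1 / 2) ^ k * (K₂ * (Km * A * 1) * 2 ^ j * τ) := by
              gcongr with l; exact hyz l
          _ = 2 * π * n * (K₂ * (Km * A * 1)) * τ * ((1 / 2) ^ k * 2 ^ j) := by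
              simp only [Finset.sum_const, Finset.card_univ, Fintype.card_fin, nsmul_eq_mul]
              ring
          _ = _ := by rw [e]
      refine (Finset.sum_le_sum hb).trans ?_
      rw [← Finset.mul_sum]
      have hs := sum_pow_le_of_injOn (θ := 1 / 2) (by norm_num) (by norm_num)
        (S.filter (fun j => j ≤ k)) (e := fun j => k - j) (by
          intro i hi j hj hij
          have hi' := (Finset.mem_filter.1 hi).2
          have hj' := (Finset.mem_filter.1 hj).2
          simp only at hij
          omega)
      calc _ ≤ 2 * π * n * (K₂ * (Km * A * 1)) * τ * (1 - 1 / 2)⁻¹ := by gcongr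
        _ = CL * τ := by rw [hCL]; norm_num; ring
    have hfarB : ∀ y, dq k y = dq k x → ‖far y‖ ≤ CF * τ := by
      intro y hyx
      refine (norm_sum_le _ _).trans ?_
      have hb : ∀ j ∈ S.filter (fun j => ¬ j ≤ k), ‖mulOp (u j) (Eᶜ.indicator (g j)) y‖ ≤
          K₁ * A * τ * θ ^ (j - k) := by
        intro j hj
        have hjk : ¬ j ≤ k := (Finset.mem_filter.1 hj).2
        refine (h1 (u j) A j hA (hu j) (hd j) y (1 / R) _ (by positivity) (hτj j) _
          ((hg j).indicator hEm.compl) (fun z => (norm_indicator_le_norm_self _ _).trans (hgτ j z))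
          fun z hz => ?_).trans ?_
        · have hzE : z ∈ Eᶜ := by
            by_contra hz'
            exact hz (Set.indicator_of_notMem hz' _)
          simp only [hE, Set.mem_compl_iff, Set.mem_ofPred_eq, not_forall, not_lt] at hzE
          obtain ⟨l, hl⟩ := hzE
          refine ⟨l, ?_⟩
          have t1 := chord_triangle (x l) (y l) (z l)
          have t2 := chord_le (x l) (y l)
          have t3 := (abs_sub_lt_of_dq_eq hyx.symm l).le.trans hRk
          have t4 : 2 * π * |x l - y l| ≤ 2 * π * (1 / R) := by gcongr
          have t5 : 4 * π / R = 4 * π * (1 / R) := by ring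
          have t6 : 1 * (1 / R) ≤ 2 * π * (1 / R) := by
            gcongr
            linarith [Real.pi_gt_three]
          linarith
        · have e1 : ((2 : ℝ) ^ j) ^ ρ * (1 / R) = ((2 : ℝ) ^ (j - k)) ^ ρ := by
            obtain ⟨i, rfl⟩ := Nat.exists_eq_add_of_le (not_le.1 hjk).le
            rw [Nat.add_sub_cancel_left, pow_add, Real.mul_rpow (by positivity) (by positivity), hR]
            field_simp
          have e2 : (1 + ((2 : ℝ) ^ j) ^ ρ * (1 / R)) ^ (-δ) ≤ θ ^ (j - k) := by
            rw [e1]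
            calc (1 + ((2 : ℝ) ^ (j - k)) ^ ρ) ^ (-δ) ≤ (((2 : ℝ) ^ (j - k)) ^ ρ) ^ (-δ) :=
                  Real.rpow_le_rpow_of_nonpos (by positivity) (by linarith) (by linarith)
              _ = θ ^ (j - k) := by
                  rw [hθ, ← Real.rpow_natCast, ← Real.rpow_natCast, ← Real.rpow_mul (by norm_num),
                    ← Real.rpow_mul (by norm_num), ← Real.rpow_mul (by norm_num)]
                  congr 1; ring
          calc _ = K₁ * A * τ * (((2 : ℝ) ^ j) ^ ((n : ℝ) / 2 + -m - ρ * (n / 2)) *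
                ((2 : ℝ) ^ j) ^ (-(a / p))) * (1 + ((2 : ℝ) ^ j) ^ ρ * (1 / R)) ^ (-δ) := by ring
            _ ≤ _ := by
                rw [hexp, mul_one]
                gcongr
      refine (Finset.sum_le_sum hb).trans ?_
      rw [← Finset.mul_sum]
      have hs := sum_pow_le_of_injOn hθ0.le hθ1
        (S.filter (fun j => ¬ j ≤ k)) (e := fun j => j - k) (by
          intro i hi j hj hij
          have hi' := (Finset.mem_filter.1 hi).2
          have hj' := (Finset.mem_filter.1 hj).2
          simp only at hij
          omega)
      calc _ ≤ K₁ * A * τ * (1 - θ)⁻¹ := by gcongr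
        _ = CF * τ := by rw [hCF]; ring
    have hlocE : dE k (fun y => ‖loc y‖ₑ) x ≤ ENNReal.ofReal (2 * (√(L * CE) * τ)) := by
      refine dE_norm_le_of_integral k hlocB (by positivity) ((hL2 k E hEm).trans ?_) x
      calc _ ≤ L * τ ^ 2 * ((2 : ℝ) ^ k) ^ (-a) * (CE * R ^ (-(n : ℝ))) := by
            gcongr; exact h4 R hR0 x
        _ = L * CE * τ ^ 2 * (((2 : ℝ) ^ k) ^ (-a) * R ^ (-(n : ℝ))) := by ring
        _ = _ := by
            rw [hR, ← Real.rpow_mul (h2p k).le, ← Real.rpow_add (h2p k), mul_pow,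
              Real.sq_sqrt (by positivity), show -a + ρ * -(n : ℝ) = -(n : ℝ) by rw [ha]; ring]
    calc _ ≤ dE k (fun y => ENNReal.ofReal ((CL + CF) * τ) + ‖loc y‖ₑ) x := by
          refine dE_mono_on k fun y hy => ?_
          rw [hsplit]
          refine (enorm_add_le _ _).trans ?_
          gcongr
          rw [← ofReal_norm]
          refine ENNReal.ofReal_le_ofReal ((norm_add_le _ _).trans ?_)
          rw [add_mul]
          exact add_le_add (hlow y) (hfarB y hy)
      _ ≤ ENNReal.ofReal ((CL + CF) * τ) + ENNReal.ofReal (2 * (√(L * CE) * τ)) := by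
          rw [dE_add k measurable_const]
          exact add_le_add (dE_le_of_le k (fun _ => le_rfl) x) hlocE
      _ = _ := by
          rw [← ENNReal.ofReal_add (by positivity) (by positivity)]
          congr 1; ring
  refine ⟨ck, fun k x hx => (key k x hx).trans (ENNReal.ofReal_le_ofReal ?_), fun x hx => ?_⟩
  · refine mul_le_mul_of_nonneg_right ?_ hτ.le
    have : 0 < K₁ * A := by positivity
    linarith
  · have hck0 : ∀ v, ‖ck 0 v‖ₑ ≤ ENNReal.ofReal (K₁ * A * τ) := by
      intro v
      rw [← ofReal_norm]
      refine ENNReal.ofReal_le_ofReal ((norm_sum_le _ _).trans ?_)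
      refine (Finset.sum_le_sum fun j _ => hT j _).trans ?_
      rw [Finset.sum_const, nsmul_eq_mul]
      refine mul_le_of_le_one_left (by positivity) ?_
      have : S.filter (fun j => j ≤ 0) ⊆ {0} := by
        intro j hj
        have := (Finset.mem_filter.1 hj).2
        simp; omega
      exact_mod_cast Finset.card_le_card this
    have hm : Measurable fun y => ‖∑ j ∈ S, mulOp (u j) (g j) y - ck 0 (dq 0 y)‖ₑ :=
      (((BddMeas.sum S fun j _ => BddMeas.mulOp (hfin j) (g j)).measurable).sub
        ((Measurable.of_discrete (f := ck 0)).comp (measurable_dq 0))).enorm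
    calc _ ≤ dE 0 (fun y => ‖∑ j ∈ S, mulOp (u j) (g j) y - ck 0 (dq 0 y)‖ₑ +
          ENNReal.ofReal (K₁ * A * τ)) x := by
          refine dE_mono 0 (fun y => ?_) x
          calc _ = ‖(∑ j ∈ S, mulOp (u j) (g j) y - ck 0 (dq 0 y)) + ck 0 (dq 0 y)‖ₑ := by
                rw [sub_add_cancel]
            _ ≤ _ := (enorm_add_le _ _).trans (by gcongr; exact hck0 _)
      _ ≤ ENNReal.ofReal ((CL + CF + 2 * √(L * CE)) * τ) + ENNReal.ofReal (K₁ * A * τ) := by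
          rw [dE_add 0 hm]
          exact add_le_add (key 0 x hx) (dE_le_of_le 0 (fun _ => le_rfl) x)
      _ = _ := by
          rw [← ENNReal.ofReal_add (by positivity) (by positivity)]
          congr 1; ring

/-! ### The multiplier theorem for `p > 2` -/

theorem lintegral_rpow_mul_ite {c p y : ℝ} (hc : 0 < c) (hp : 2 < p) (hy : 0 ≤ y) :
    ∫⁻ t in Set.Ioi (0 : ℝ), ENNReal.ofReal (t ^ (p - 3)) *
      (if c * t < y then ENNReal.ofReal (y ^ 2) else 0) =
      ENNReal.ofReal (c ^ (2 - p) / (p - 2) * y ^ p) := by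
  have hyc : 0 ≤ y / c := by positivity
  have e1 : ∀ t : ℝ, ENNReal.ofReal (t ^ (p - 3)) *
      (if c * t < y then ENNReal.ofReal (y ^ 2) else 0) =
      (Set.Iio (y / c)).indicator (fun t => ENNReal.ofReal (t ^ (p - 3)) * ENNReal.ofReal (y ^ 2))
        t := by
    intro t
    by_cases h : c * t < y
    · rw [if_pos h, Set.indicator_of_mem (by rwa [Set.mem_Iio, lt_div_iff₀' hc])]
    · rw [if_neg h, Set.indicator_of_notMem (by rwa [Set.mem_Iio, lt_div_iff₀' hc]), mul_zero]
  simp_rw [e1]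
  have hpi := intervalIntegral.intervalIntegrable_rpow' (a := 0) (b := y / c)
    (show -1 < p - 3 by linarith)
  rw [intervalIntegrable_iff_integrableOn_Ioc_of_le hyc] at hpi
  have e2 : ∫⁻ t in Set.Ioc 0 (y / c), ENNReal.ofReal (t ^ (p - 3)) =
      ENNReal.ofReal ((y / c) ^ (p - 2) / (p - 2)) := by
    rw [← ofReal_integral_eq_lintegral_ofReal hpi ((ae_restrict_iff' measurableSet_Ioc).2
      (ae_of_all _ fun t ht => Real.rpow_nonneg ht.1.le _)), ← intervalIntegral.integral_of_le hyc,
      integral_rpow (Or.inl (by linarith)), show p - 3 + 1 = p - 2 by ring,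
      Real.zero_rpow (by linarith), sub_zero]
  rw [setLIntegral_indicator measurableSet_Iio, Set.inter_comm, Set.Ioi_inter_Iio,
    setLIntegral_congr Ioo_ae_eq_Ioc, lintegral_mul_const' _ _ ENNReal.ofReal_ne_top, e2,
    ← ENNReal.ofReal_mul (by have : 0 < p - 2 := by linarith
                             positivity)]
  congr 1
  rcases hy.eq_or_lt with rfl | hy0
  · simp [Real.zero_rpow (by linarith : p ≠ 0)]
  · rw [Real.div_rpow hy hc.le, Real.rpow_sub hy0, Real.rpow_sub hc, Real.rpow_sub hc,
      Real.rpow_two, Real.rpow_two]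
    field_simp

theorem lintegral_rpow_mul_tail {n : ℕ} {h : (Fin n → ℝ) → ℂ} (hh : Measurable h) {c p : ℝ}
    (hc : 0 < c) (hp : 2 < p) :
    ∫⁻ t in Set.Ioi (0 : ℝ), ENNReal.ofReal (t ^ (p - 3)) *
      ∫⁻ x, ‖{y | c * t < ‖h y‖}.indicator h x‖ₑ ^ 2 ∂(μT n) =
      ENNReal.ofReal (c ^ (2 - p) / (p - 2)) * ∫⁻ x, ‖h x‖ₑ ^ p ∂(μT n) := by
  have := isProbabilityMeasure_μT n
  have e1 : ∀ t x, ‖{y | c * t < ‖h y‖}.indicator h x‖ₑ ^ 2 =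
      if c * t < ‖h x‖ then ENNReal.ofReal (‖h x‖ ^ 2) else 0 := by
    intro t x
    by_cases hx : c * t < ‖h x‖
    · rw [Set.indicator_of_mem (by exact hx), if_pos hx, ENNReal.ofReal_pow (norm_nonneg _),
        ofReal_norm]
    · rw [Set.indicator_of_notMem (by exact hx), if_neg hx]; simp
  have hm : Measurable (Function.uncurry fun (t : ℝ) (x : Fin n → ℝ) =>
      ENNReal.ofReal (t ^ (p - 3)) *
        (if c * t < ‖h x‖ then ENNReal.ofReal (‖h x‖ ^ 2) else 0)) := by
    refine Measurable.mul (by fun_prop) (Measurable.ite ?_ (by fun_prop) measurable_const)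
    exact measurableSet_lt (by fun_prop) (by fun_prop)
  simp_rw [e1]
  calc _ = ∫⁻ t in Set.Ioi (0 : ℝ), ∫⁻ x, ENNReal.ofReal (t ^ (p - 3)) *
        (if c * t < ‖h x‖ then ENNReal.ofReal (‖h x‖ ^ 2) else 0) ∂(μT n) := by
        refine lintegral_congr fun t => (lintegral_const_mul' _ _ ENNReal.ofReal_ne_top).symm
    _ = ∫⁻ x, ENNReal.ofReal (c ^ (2 - p) / (p - 2) * ‖h x‖ ^ p) ∂(μT n) := by
        rw [lintegral_lintegral_swap hm.aemeasurable]
        exact lintegral_congr fun x => lintegral_rpow_mul_ite hc hp (norm_nonneg _)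
    _ = _ := by
        rw [← lintegral_const_mul' _ _ ENNReal.ofReal_ne_top]
        refine lintegral_congr fun x => ?_
        rw [ENNReal.ofReal_mul (by have : 0 < p - 2 := by linarith
                                   positivity),
          ← ofReal_norm, ENNReal.ofReal_rpow_of_nonneg (norm_nonneg _) (by linarith)]

theorem BddMeas.lintegral_norm_sq {n : ℕ} {g : (Fin n → ℝ) → ℂ} (hg : BddMeas g) :
    ∫⁻ x, ‖g x‖ₑ ^ 2 ∂(μT n) = ENNReal.ofReal (∫ x, ‖g x‖ ^ 2 ∂(μT n)) := by
  rw [ofReal_integral_eq_lintegral_ofReal hg.integrable_norm_sq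
    (ae_of_all _ fun x => by positivity)]
  refine lintegral_congr fun x => ?_
  rw [ENNReal.ofReal_pow (norm_nonneg _), ofReal_norm]

theorem integral_norm_sq_mulOp_le {n : ℕ} {u : (Fin n → ℤ) → ℂ} (hu : u.support.Finite) {A : ℝ}
    (hA : ∀ ξ, ‖u ξ‖ ≤ A) {g : (Fin n → ℝ) → ℂ} (hg : BddMeas g) :
    ∫ x, ‖mulOp u g x‖ ^ 2 ∂(μT n) ≤ A ^ 2 * ∫ x, ‖g x‖ ^ 2 ∂(μT n) := by
  rw [mulOp, integral_norm_sq_trig (S := hu.toFinset)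
    (fun ξ hξ => by rw [eq_zero_of_notMem_toFinset hu ξ hξ, zero_mul])]
  calc _ ≤ ∑ ξ ∈ hu.toFinset, A ^ 2 * ‖fc g ξ‖ ^ 2 := by
        refine Finset.sum_le_sum fun ξ _ => ?_
        rw [norm_mul, mul_pow]
        gcongr
        exact hA ξ
    _ ≤ _ := by
        rw [← Finset.mul_sum]
        gcongr
        exact sum_norm_sq_fc_le hg _

theorem sum_integral_norm_sq_mulOp_le {n : ℕ} (S : Finset ℕ) {u : ℕ → (Fin n → ℤ) → ℂ}
    (hu : ∀ j, (u j).support.Finite) {A : ℝ} (hA : ∀ ξ, ∑ j ∈ S, ‖u j ξ‖ ^ 2 ≤ A)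
    {g : (Fin n → ℝ) → ℂ} (hg : BddMeas g) :
    ∑ j ∈ S, ∫ x, ‖mulOp (u j) g x‖ ^ 2 ∂(μT n) ≤ A * ∫ x, ‖g x‖ ^ 2 ∂(μT n) := by
  classical
  set R := S.biUnion fun j => (hu j).toFinset
  have hR : ∀ j ∈ S, ∀ ξ ∉ R, u j ξ = 0 := fun j hj ξ hξ =>
    eq_zero_of_notMem_toFinset (hu j) ξ fun h => hξ (Finset.mem_biUnion.2 ⟨j, hj, h⟩)
  have hA0 : 0 ≤ A := (Finset.sum_nonneg fun j _ => by positivity).trans (hA 0)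
  calc _ = ∑ j ∈ S, ∑ ξ ∈ R, ‖u j ξ‖ ^ 2 * ‖fc g ξ‖ ^ 2 := by
        refine Finset.sum_congr rfl fun j hj => ?_
        rw [mulOp, integral_norm_sq_trig (S := R) (fun ξ hξ => by rw [hR j hj ξ hξ, zero_mul])]
        simp only [norm_mul, mul_pow]
    _ ≤ ∑ ξ ∈ R, A * ‖fc g ξ‖ ^ 2 := by
        rw [Finset.sum_comm]
        refine Finset.sum_le_sum fun ξ _ => ?_
        rw [← Finset.sum_mul]
        gcongr
        exact hA ξ
    _ ≤ _ := by
        rw [← Finset.mul_sum]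
        gcongr
        exact sum_norm_sq_fc_le hg _

theorem sum_lpCut_le_one {n : ℕ} (S : Finset ℕ) (ξ : Fin n → ℤ) : ∑ j ∈ S, lpCut j ξ ≤ 1 := by
  have h : S ⊆ Finset.range (S.sup id + 1) := fun j hj =>
    Finset.mem_range.2 (Nat.lt_succ_of_le (Finset.le_sup (f := id) hj))
  exact (Finset.sum_le_sum_of_subset_of_nonneg h fun j _ _ => lpCut_nonneg j ξ).trans
    ((sum_lpCut _ ξ).le.trans (lowCut_le_one _ ξ))

/-- Almost orthogonality of the Littlewood-Paley pieces of a multiplier of order `-m`. -/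
theorem integral_norm_sq_sum_mulOp_le {n : ℕ} {a : (Fin n → ℤ) → ℂ} {A m : ℝ} (hA : 0 ≤ A)
    (ha : ∀ ξ, ‖a ξ‖ ≤ A * jb ξ ^ (-m))
    (hfin : ∀ j, (fun ξ => a ξ * (lpCut j ξ : ℂ)).support.Finite)
    (S : Finset ℕ) {h : ℕ → (Fin n → ℝ) → ℂ} (hh : ∀ j, BddMeas (h j)) :
    ∫ x, ‖∑ j ∈ S, mulOp (fun ξ => a ξ * (lpCut j ξ : ℂ)) (h j) x‖ ^ 2 ∂(μT n) ≤
      ∑ j ∈ S, (A * ((2 * (1 + n)) ^ |-m| * ((2 : ℝ) ^ j) ^ (-m))) ^ 2 *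
        ∫ x, ‖h j x‖ ^ 2 ∂(μT n) := by
  classical
  set R := S.biUnion fun j => (hfin j).toFinset
  have hR : ∀ j ∈ S, ∀ ξ ∉ R, a ξ * (lpCut j ξ : ℂ) = 0 := fun j hj ξ hξ =>
    eq_zero_of_notMem_toFinset (hfin j) ξ fun h => hξ (Finset.mem_biUnion.2 ⟨j, hj, h⟩)
  have e1 : ∀ x, ∑ j ∈ S, mulOp (fun ξ => a ξ * (lpCut j ξ : ℂ)) (h j) x =
      trig (fun ξ => ∑ j ∈ S, a ξ * (lpCut j ξ : ℂ) * fc (h j) ξ) x := fun x =>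
    (trig_finset_sum S (fun j _ => finite_support_mul_fc (hfin j) _) x).symm
  simp_rw [e1]
  rw [integral_norm_sq_trig (S := R)
    (fun ξ hξ => Finset.sum_eq_zero fun j hj => by rw [hR j hj ξ hξ, zero_mul])]
  have hn0 : (0 : ℝ) ≤ n := Nat.cast_nonneg n
  calc _ ≤ ∑ ξ ∈ R, ∑ j ∈ S, (A * ((2 * (1 + n)) ^ |-m| * ((2 : ℝ) ^ j) ^ (-m))) ^ 2 *
        ‖fc (h j) ξ‖ ^ 2 := by
        refine Finset.sum_le_sum fun ξ _ => ?_
        have hψ := fun j => lpCut_nonneg j ξ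
        calc _ ≤ (∑ j ∈ S, √(lpCut j ξ) * (√(lpCut j ξ) * (‖a ξ‖ * ‖fc (h j) ξ‖))) ^ 2 := by
              gcongr
              refine (norm_sum_le _ _).trans (Finset.sum_le_sum fun j _ => ?_)
              rw [norm_mul, norm_mul, Complex.norm_real, Real.norm_of_nonneg (hψ j), ← mul_assoc,
                Real.mul_self_sqrt (hψ j)]
              exact le_of_eq (by ring)
          _ ≤ (∑ j ∈ S, √(lpCut j ξ) ^ 2) *
              ∑ j ∈ S, (√(lpCut j ξ) * (‖a ξ‖ * ‖fc (h j) ξ‖)) ^ 2 :=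
              Finset.sum_mul_sq_le_sq_mul_sq _ _ _
          _ ≤ 1 * ∑ j ∈ S, (√(lpCut j ξ) * (‖a ξ‖ * ‖fc (h j) ξ‖)) ^ 2 := by
              gcongr
              simp only [Real.sq_sqrt (hψ _)]
              exact sum_lpCut_le_one S ξ
          _ ≤ _ := by
              rw [one_mul]
              refine Finset.sum_le_sum fun j _ => ?_
              rw [mul_pow, Real.sq_sqrt (hψ j), mul_pow, ← mul_assoc]
              gcongr
              by_cases hz : lpCut j ξ = 0
              · rw [hz, zero_mul]; positivity
              · have hd := dyadic_lpCut j ξ (Complex.ofReal_ne_zero.2 hz)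
                have h1 := rpow_le_of_comparable (by linarith : (1 : ℝ) ≤ 2 * (1 + n))
                  (by positivity) (jb_pos ξ) hd.1 hd.2 (-m)
                calc _ ≤ 1 * ‖a ξ‖ ^ 2 := by gcongr; exact lpCut_le_one j ξ
                  _ ≤ _ := by
                    rw [one_mul]
                    gcongr
                    exact (ha ξ).trans (by gcongr)
    _ ≤ _ := by
        rw [Finset.sum_comm]
        refine Finset.sum_le_sum fun j _ => ?_
        rw [← Finset.mul_sum]
        gcongr
        exact sum_norm_sq_fc_le (hh j) _

theorem lowCut_succ_eq_one {n : ℕ} {j : ℕ} {ξ : Fin n → ℤ} (h : lowCut j ξ ≠ 0) :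
    lowCut (j + 1) ξ = 1 :=
  lowCut_eq_one fun l => by
    by_contra hl
    exact h (lowCut_eq_zero l (not_le.1 hl).le)

/-- A widened Littlewood-Paley cutoff, equal to one on the support of `lpCut j`. -/
def fatCut {n : ℕ} : ℕ → (Fin n → ℤ) → ℝ
  | 0 => fun ξ => lpCut 0 ξ + lpCut 1 ξ
  | j + 1 => fun ξ => lpCut j ξ + lpCut (j + 1) ξ + lpCut (j + 2) ξ

theorem fatCut_nonneg {n : ℕ} (j : ℕ) (ξ : Fin n → ℤ) : 0 ≤ fatCut j ξ := by
  have h := fun j => lpCut_nonneg j ξ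
  cases j with
  | zero => exact add_nonneg (h 0) (h 1)
  | succ j => exact add_nonneg (add_nonneg (h j) (h _)) (h _)

theorem fatCut_le_one {n : ℕ} (j : ℕ) (ξ : Fin n → ℤ) : fatCut j ξ ≤ 1 := by
  cases j with
  | zero => simpa [fatCut] using sum_lpCut_le_one {0, 1} ξ
  | succ j => simpa [fatCut, add_assoc] using sum_lpCut_le_one {j, j + 1, j + 2} ξ

theorem lpCut_mul_fatCut {n : ℕ} (j : ℕ) (ξ : Fin n → ℤ) :
    lpCut j ξ * fatCut j ξ = lpCut j ξ := by
  by_cases h : lpCut j ξ = 0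
  · rw [h, zero_mul]
  suffices fatCut j ξ = 1 by rw [this, mul_one]
  have h0 : lowCut j ξ ≠ 0 := by
    intro h0
    exact h (le_antisymm (((Finset.single_le_sum (f := fun j => lpCut j ξ)
      (fun j _ => lpCut_nonneg j ξ) (Finset.mem_range.2 (Nat.lt_succ_self j))).trans
      (sum_lpCut j ξ).le).trans h0.le) (lpCut_nonneg j ξ))
  have h1 := lowCut_succ_eq_one h0
  match j, h, h0, h1 with
  | 0, h, h0, h1 => simp only [fatCut, lpCut]; linarith
  | 1, h, h0, h1 => simp only [fatCut, lpCut]; linarith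
  | j + 2, h, h0, h1 =>
    have h2 : lowCut j ξ = 0 := by
      by_contra h2
      have h3 := lowCut_succ_eq_one h2
      have h4 := lowCut_succ_eq_one (h3.trans_ne one_ne_zero)
      exact h (by simp only [lpCut]; linarith)
    simp only [fatCut, lpCut]
    linarith

theorem sum_fatCut_le {n : ℕ} (J : ℕ) (ξ : Fin n → ℤ) :
    ∑ j ∈ Finset.range (J + 1), fatCut j ξ ≤ 4 := by
  have h : ∀ i, ∑ j ∈ Finset.range J, lpCut (j + i) ξ ≤ 1 := fun i => by
    rw [← Finset.sum_image (f := fun j => lpCut j ξ) (g := fun j => j + i)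
      fun x _ y _ hxy => by simpa using hxy]
    exact sum_lpCut_le_one _ ξ
  rw [Finset.sum_range_succ']
  simp only [fatCut, Finset.sum_add_distrib]
  have h0 := fatCut_le_one 0 ξ
  simp only [fatCut] at h0
  have h1 := h 0
  have h2 := h 1
  have h3 := h 2
  simp only [add_zero] at h1
  linarith

theorem finite_support_lpCut {n : ℕ} (hn : 1 ≤ n) (j : ℕ) :
    (fun ξ : Fin n → ℤ => (lpCut j ξ : ℂ)).support.Finite := by
  have hn0 : (0 : ℝ) ≤ n := Nat.cast_nonneg n
  obtain ⟨K, _, h⟩ := SymL2.of_dyadic n hn 1 0 (2 * (1 + n)) (by linarith)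
  obtain ⟨B, hB, hs⟩ := exists_symCl_lpCut n (n / 2 + 1)
  exact (h _ B j hB.le (hs j) (dyadic_lpCut j)).finite

theorem finite_support_add {n : ℕ} {u v : (Fin n → ℤ) → ℂ} (hu : u.support.Finite)
    (hv : v.support.Finite) : (fun ξ => u ξ + v ξ).support.Finite :=
  (hu.union hv).subset (Function.support_add u v)

theorem mulOp_add_symbol {n : ℕ} {u v : (Fin n → ℤ) → ℂ} (hu : u.support.Finite)
    (hv : v.support.Finite) (g : (Fin n → ℝ) → ℂ) (x : Fin n → ℝ) :
    mulOp (fun ξ => u ξ + v ξ) g x = mulOp u g x + mulOp v g x := by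
  simp only [mulOp, add_mul]
  exact trig_add (finite_support_mul_fc hu _) (finite_support_mul_fc hv _) x

theorem finite_support_fatCut {n : ℕ} (hn : 1 ≤ n) (j : ℕ) :
    (fun ξ : Fin n → ℤ => (fatCut j ξ : ℂ)).support.Finite := by
  have h := finite_support_lpCut hn
  cases j with
  | zero => simpa [fatCut] using finite_support_add (h 0) (h 1)
  | succ j =>
    simpa [fatCut] using finite_support_add (finite_support_add (h j) (h (j + 1))) (h (j + 2))

theorem exists_norm_mulOp_fatCut_le (n : ℕ) (hn : 1 ≤ n) : ∃ K : ℝ, 0 < K ∧ ∀ (j : ℕ) (N : ℝ)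
    (g : (Fin n → ℝ) → ℂ), 0 ≤ N → BddMeas g → (∀ y, ‖g y‖ ≤ N) → ∀ x,
      ‖mulOp (fun ξ => (fatCut j ξ : ℂ)) g x‖ ≤ K * N := by
  have hn0 : (0 : ℝ) ≤ n := Nat.cast_nonneg n
  obtain ⟨K, hK, h⟩ := exists_mulOp_dyadic_le n hn 1 0 (2 * (1 + n)) (by linarith)
  obtain ⟨B, hB, hs⟩ := exists_symCl_lpCut n (n / 2 + 1)
  refine ⟨3 * (K * B), by positivity, fun j N g hN hg hgN x => ?_⟩
  have h1 : ∀ j, ‖mulOp (fun ξ => (lpCut j ξ : ℂ)) g x‖ ≤ K * B * N := fun j => by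
    have := h _ B j hB (hs j) (dyadic_lpCut j) x 0 N le_rfl hN g hg hgN
      fun y _ => ⟨⟨0, hn⟩, chord_nonneg _ _⟩
    simpa using this
  have hf := finite_support_lpCut hn
  cases j with
  | zero =>
    simp only [fatCut, Complex.ofReal_add]
    rw [mulOp_add_symbol (hf 0) (hf 1)]
    refine (norm_add_le _ _).trans ?_
    have : 0 ≤ K * B * N := by positivity
    linarith [h1 0, h1 1]
  | succ j =>
    simp only [fatCut, Complex.ofReal_add]
    rw [mulOp_add_symbol (finite_support_add (hf j) (hf (j + 1))) (hf (j + 2)),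
      mulOp_add_symbol (hf j) (hf (j + 1))]
    refine (norm_add₃_le).trans ?_
    linarith [h1 j, h1 (j + 1), h1 (j + 2)]

theorem measurable_tail {n : ℕ} (h : (Fin n → ℝ) → ℂ) {c : ℝ} (hc : 0 < c) :
    Measurable fun t : ℝ => ∫⁻ x, ‖{y | c * t < ‖h y‖}.indicator h x‖ₑ ^ 2 ∂(μT n) := by
  refine Antitone.measurable fun s t hst => lintegral_mono fun x => ?_
  refine pow_le_pow_left₀ zero_le ?_ 2
  refine enorm_indicator_le_of_subset (fun y hy => ?_) h x
  exact (mul_le_mul_of_nonneg_left hst hc.le).trans_lt hy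

theorem measurableSet_lt_norm {n : ℕ} {h : (Fin n → ℝ) → ℂ} (hh : BddMeas h) (c : ℝ) :
    MeasurableSet {y | c < ‖h y‖} :=
  measurableSet_lt measurable_const hh.measurable.norm

theorem BddMeas.indicator_lt {n : ℕ} {h : (Fin n → ℝ) → ℂ} (hh : BddMeas h) (c : ℝ) :
    BddMeas ({y | c < ‖h y‖}.indicator h) :=
  hh.indicator (measurableSet_lt_norm hh c)

theorem norm_indicator_compl_le {n : ℕ} (h : (Fin n → ℝ) → ℂ) {c : ℝ} (hc : 0 ≤ c)
    (x : Fin n → ℝ) : ‖{y | c < ‖h y‖}ᶜ.indicator h x‖ ≤ c := by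
  by_cases hx : x ∈ {y | c < ‖h y‖}ᶜ
  · rw [Set.indicator_of_mem hx]; exact not_lt.1 hx
  · rw [Set.indicator_of_notMem hx, norm_zero]; exact hc

theorem exists_sum_lintegral_fatCut_le (n : ℕ) (hn : 1 ≤ n) {p : ℝ} (hp : 2 < p) :
    ∃ C : ℝ, 0 < C ∧ ∀ (J : ℕ) (f : (Fin n → ℝ) → ℂ), BddMeas f →
      ∑ j ∈ Finset.range (J + 1), ∫⁻ x, ‖mulOp (fun ξ => (fatCut j ξ : ℂ)) f x‖ₑ ^ p ∂(μT n) ≤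
        ENNReal.ofReal C * ∫⁻ x, ‖f x‖ₑ ^ p ∂(μT n) := by
  obtain ⟨K, hK, hbd⟩ := exists_norm_mulOp_fatCut_le n hn
  have hp2 : 0 < p - 2 := by linarith
  set D : ℝ := (2 * K) ^ (2 - p) / (p - 2) with hD
  have hD0 : 0 < D := by positivity
  refine ⟨D⁻¹ * (16 * (1 ^ (2 - p) / (p - 2))), by positivity, fun J f hf => ?_⟩
  have hfin := finite_support_fatCut hn
  set P : ℕ → (Fin n → ℝ) → ℂ := fun j => mulOp (fun ξ => (fatCut j ξ : ℂ)) f with hP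
  have hPB : ∀ j, BddMeas (P j) := fun j => BddMeas.mulOp (hfin j) f
  have key : ∀ t, 0 < t → ∑ j ∈ Finset.range (J + 1),
      ∫⁻ x, ‖{y | 2 * K * t < ‖P j y‖}.indicator (P j) x‖ₑ ^ 2 ∂(μT n) ≤
      ENNReal.ofReal 16 * ∫⁻ x, ‖{y | 1 * t < ‖f y‖}.indicator f x‖ₑ ^ 2 ∂(μT n) := by
    intro t ht
    have hb := hf.indicator_lt (1 * t)
    have hg := hf.indicator (measurableSet_lt_norm hf (1 * t)).compl
    set b := {y | 1 * t < ‖f y‖}.indicator f with hbdef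
    have h1 : ∀ j x, ‖{y | 2 * K * t < ‖P j y‖}.indicator (P j) x‖ₑ ^ 2 ≤
        ENNReal.ofReal 4 * ‖mulOp (fun ξ => (fatCut j ξ : ℂ)) b x‖ₑ ^ 2 := by
      intro j x
      by_cases hx : x ∈ {y | 2 * K * t < ‖P j y‖}
      · rw [Set.indicator_of_mem hx, ← ofReal_norm, ← ofReal_norm,
          ← ENNReal.ofReal_pow (norm_nonneg _), ← ENNReal.ofReal_pow (norm_nonneg _),
          ← ENNReal.ofReal_mul (by norm_num)]
        refine ENNReal.ofReal_le_ofReal ?_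
        have e : f = fun y => {y | 1 * t < ‖f y‖}ᶜ.indicator f y + b y := by
          funext y
          exact (Set.indicator_compl_add_self_apply _ f y).symm
        have h2 : ‖P j x‖ ≤ K * t + ‖mulOp (fun ξ => (fatCut j ξ : ℂ)) b x‖ := by
          simp only [hP]
          conv_lhs => rw [e]
          rw [mulOp_add (hfin j) hg hb]
          refine (norm_add_le _ _).trans (add_le_add ?_ le_rfl)
          exact hbd j t _ ht.le hg (fun y => (norm_indicator_compl_le f (by linarith) y).trans
            (one_mul t).le) x
        have h3 : 2 * K * t < ‖P j x‖ := hx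
        have h4 : ‖P j x‖ ≤ 2 * ‖mulOp (fun ξ => (fatCut j ξ : ℂ)) b x‖ := by linarith
        calc ‖P j x‖ ^ 2 ≤ (2 * ‖mulOp (fun ξ => (fatCut j ξ : ℂ)) b x‖) ^ 2 := by gcongr
          _ = _ := by ring
      · rw [Set.indicator_of_notMem hx]; simp
    have h5 := sum_integral_norm_sq_mulOp_le (Finset.range (J + 1)) hfin (A := 4) (fun ξ => by
      refine le_trans (Finset.sum_le_sum fun j _ => ?_) (sum_fatCut_le J ξ)
      rw [Complex.norm_real, Real.norm_of_nonneg (fatCut_nonneg j ξ)]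
      exact pow_le_of_le_one (fatCut_nonneg j ξ) (fatCut_le_one j ξ) two_ne_zero) hb
    calc _ ≤ ∑ j ∈ Finset.range (J + 1), ENNReal.ofReal 4 *
          ENNReal.ofReal (∫ x, ‖mulOp (fun ξ => (fatCut j ξ : ℂ)) b x‖ ^ 2 ∂(μT n)) := by
          refine Finset.sum_le_sum fun j _ => ?_
          rw [← (BddMeas.mulOp (hfin j) b).lintegral_norm_sq,
            ← lintegral_const_mul' _ _ ENNReal.ofReal_ne_top]
          exact lintegral_mono fun x => h1 j x
      _ = ENNReal.ofReal 4 * ENNReal.ofReal (∑ j ∈ Finset.range (J + 1),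
          ∫ x, ‖mulOp (fun ξ => (fatCut j ξ : ℂ)) b x‖ ^ 2 ∂(μT n)) := by
          rw [← Finset.mul_sum, ENNReal.ofReal_sum_of_nonneg fun j _ =>
            integral_nonneg fun x => by positivity]
      _ ≤ ENNReal.ofReal 4 * ENNReal.ofReal (4 * ∫ x, ‖b x‖ ^ 2 ∂(μT n)) := by gcongr
      _ = _ := by
          rw [hb.lintegral_norm_sq, ENNReal.ofReal_mul (by norm_num), ← mul_assoc,
            ← ENNReal.ofReal_mul (by norm_num)]
          norm_num
  have hmain : ENNReal.ofReal D * ∑ j ∈ Finset.range (J + 1), ∫⁻ x, ‖P j x‖ₑ ^ p ∂(μT n) ≤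
      ENNReal.ofReal (16 * (1 ^ (2 - p) / (p - 2))) * ∫⁻ x, ‖f x‖ₑ ^ p ∂(μT n) := by
    rw [ENNReal.ofReal_mul (by norm_num), mul_assoc,
      ← lintegral_rpow_mul_tail hf.measurable one_pos hp, Finset.mul_sum,
      ← lintegral_const_mul' _ _ ENNReal.ofReal_ne_top]
    calc _ = ∑ j ∈ Finset.range (J + 1), ∫⁻ t in Set.Ioi (0 : ℝ), ENNReal.ofReal (t ^ (p - 3)) *
          ∫⁻ x, ‖{y | 2 * K * t < ‖P j y‖}.indicator (P j) x‖ₑ ^ 2 ∂(μT n) :=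
          Finset.sum_congr rfl fun j _ =>
            (lintegral_rpow_mul_tail (hPB j).measurable (by positivity) hp).symm
      _ = ∫⁻ t in Set.Ioi (0 : ℝ), ENNReal.ofReal (t ^ (p - 3)) * ∑ j ∈ Finset.range (J + 1),
          ∫⁻ x, ‖{y | 2 * K * t < ‖P j y‖}.indicator (P j) x‖ₑ ^ 2 ∂(μT n) := by
          rw [← lintegral_finsetSum]
          · simp_rw [Finset.mul_sum]
          · intro j _
            exact Measurable.mul (by fun_prop) (measurable_tail (P j) (by positivity))
      _ ≤ _ := by
          refine setLIntegral_mono' measurableSet_Ioi fun t ht => ?_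
          calc _ ≤ ENNReal.ofReal (t ^ (p - 3)) * (ENNReal.ofReal 16 *
                ∫⁻ x, ‖{y | 1 * t < ‖f y‖}.indicator f x‖ₑ ^ 2 ∂(μT n)) := by
                gcongr; exact key t ht
            _ = _ := by ring
  calc _ = ENNReal.ofReal D⁻¹ * (ENNReal.ofReal D *
        ∑ j ∈ Finset.range (J + 1), ∫⁻ x, ‖P j x‖ₑ ^ p ∂(μT n)) := by
        rw [← mul_assoc, ← ENNReal.ofReal_mul (by positivity), inv_mul_cancel₀ hD0.ne',
          ENNReal.ofReal_one, one_mul]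
    _ ≤ _ := by
        rw [ENNReal.ofReal_mul (by positivity), mul_assoc]
        gcongr

theorem exists_lintegral_sum_mulOp_le (n : ℕ) (hn : 1 ≤ n) {ρ p A L c : ℝ} (hρ0 : 0 < ρ)
    (hρ1 : ρ ≤ 1) (hp : 2 < p) (hA : 0 < A) (hL : 0 < L) (hc : 1 ≤ c) :
    ∃ γ > 0, ∃ C > 0, ∀ u : ℕ → (Fin n → ℤ) → ℂ,
      (∀ j, SymCl (n / 2 + 1) ρ (-(n * (1 - ρ) * (1 / 2 - 1 / p))) A (u j)) →
      (∀ j, IsDyadic c j (u j)) → ∀ (S : Finset ℕ) (f : ℕ → (Fin n → ℝ) → ℂ),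
      (∀ j, BddMeas (f j)) → ∀ β : ℝ → ℝ≥0∞,
      (∀ k E t, 0 < t → MeasurableSet E → ∫ x, ‖∑ j ∈ S with ¬ j ≤ k, mulOp (u j) (E.indicator
        ({y | γ * ((2 : ℝ) ^ j) ^ (-(n * (1 - ρ) / p)) * t < ‖f j y‖}ᶜ.indicator (f j))) x‖ ^ 2
        ∂(μT n) ≤ L * (γ * t) ^ 2 * ((2 : ℝ) ^ k) ^ (-(n * (1 - ρ))) * (μT n).real E) →
      (∀ t, 0 < t → ∫⁻ x, ‖∑ j ∈ S, mulOp (u j)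
        ({y | γ * ((2 : ℝ) ^ j) ^ (-(n * (1 - ρ) / p)) * t < ‖f j y‖}.indicator (f j)) x‖ₑ ^ 2
        ∂(μT n) ≤ β t) →
      ∫⁻ x, ‖∑ j ∈ S, mulOp (u j) (f j) x‖ₑ ^ p ∂(μT n) ≤
        ENNReal.ofReal C * ∫⁻ t in Set.Ioi (0 : ℝ), ENNReal.ofReal (t ^ (p - 3)) * β t := by
  obtain ⟨C₀, hC₀, hosc⟩ := exists_oscillation_le n hn (p := p) hρ0 hρ1 hA hL hc
  obtain ⟨γ, hγ, C, hC, hgood⟩ := exists_lintegral_rpow_le_of_split n (by linarith : 0 < p) hC₀.le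
  obtain ⟨K, hK, h5⟩ := SymL2.of_dyadic n hn ρ (-(n * (1 - ρ) * (1 / 2 - 1 / p))) c hc
  refine ⟨γ, hγ, C, hC, fun u hu hd S f hf β hL2 hβ => ?_⟩
  have hfin : ∀ j, (u j).support.Finite := fun j => (h5 (u j) A j hA.le (hu j) (hd j)).finite
  refine hgood (fun x => ∑ j ∈ S, mulOp (u j) (f j) x)
    (continuous_finsetSum _ fun j _ => continuous_mulOp (hfin j) _)
    (BddMeas.sum S fun j _ => BddMeas.mulOp (hfin j) _) β fun t ht => ?_
  set e : ℕ → ℝ := fun j => γ * ((2 : ℝ) ^ j) ^ (-(n * (1 - ρ) / p)) * t with he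
  have he0 : ∀ j, 0 ≤ e j := fun j => by positivity
  set g : ℕ → (Fin n → ℝ) → ℂ := fun j => {y | e j < ‖f j y‖}ᶜ.indicator (f j) with hg
  set b : ℕ → (Fin n → ℝ) → ℂ := fun j => {y | e j < ‖f j y‖}.indicator (f j) with hb
  have hgB : ∀ j, BddMeas (g j) := fun j => (hf j).indicator (measurableSet_lt_norm (hf j) _).compl
  have hbB : ∀ j, BddMeas (b j) := fun j => (hf j).indicator_lt _
  obtain ⟨ck, h1, h2⟩ := hosc u hu hd S (γ * t) (by positivity) g hgB
    (fun j x => (norm_indicator_compl_le (f j) (he0 j) x).trans (le_of_eq (by rw [he]; ring)))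
    fun k E hE => hL2 k E t ht hE
  refine ⟨fun x => ∑ j ∈ S, mulOp (u j) (g j) x, fun x => ∑ j ∈ S, mulOp (u j) (b j) x, ck,
    (BddMeas.sum S fun j _ => BddMeas.mulOp (hfin j) _).measurable,
    (BddMeas.sum S fun j _ => BddMeas.mulOp (hfin j) _).measurable, fun x => ?_, h1, h2, hβ t ht⟩
  rw [← Finset.sum_add_distrib]
  refine Finset.sum_congr rfl fun j _ => ?_
  rw [← mulOp_add (hfin j) (hgB j) (hbB j)]
  congr 1
  funext y
  exact (Set.indicator_compl_add_self_apply _ (f j) y).symm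

theorem integral_norm_sq_indicator_le {n : ℕ} {g : (Fin n → ℝ) → ℂ} {N : ℝ} (hN : ∀ y, ‖g y‖ ≤ N)
    {E : Set (Fin n → ℝ)} (hE : MeasurableSet E) :
    ∫ x, ‖E.indicator g x‖ ^ 2 ∂(μT n) ≤ N ^ 2 * (μT n).real E := by
  have := isProbabilityMeasure_μT n
  rw [mul_comm, ← smul_eq_mul, ← integral_indicator_const _ hE]
  refine integral_mono_of_nonneg (ae_of_all _ fun x => by positivity)
    ((integrable_const _).indicator hE) (ae_of_all _ fun x => ?_)
  by_cases hx : x ∈ E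
  · simp only [Set.indicator_of_mem hx]; gcongr; exact hN x
  · simp [Set.indicator_of_notMem hx]

theorem sum_two_pow_rpow_le {a : ℝ} (ha : 0 < a) (S : Finset ℕ) (k : ℕ) :
    ∑ j ∈ S with ¬ j ≤ k, ((2 : ℝ) ^ j) ^ (-a) ≤ (1 - 2 ^ (-a))⁻¹ * ((2 : ℝ) ^ k) ^ (-a) := by
  have hθ1 : (2 : ℝ) ^ (-a) < 1 := Real.rpow_lt_one_of_one_lt_of_neg (by norm_num) (by linarith)
  have h1 : ∀ j ∈ S.filter (fun j => ¬ j ≤ k),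
      ((2 : ℝ) ^ j) ^ (-a) = ((2 : ℝ) ^ (-a)) ^ (j - k) * ((2 : ℝ) ^ k) ^ (-a) := by
    intro j hj
    obtain ⟨i, rfl⟩ := Nat.exists_eq_add_of_le (not_le.1 (Finset.mem_filter.1 hj).2).le
    rw [Nat.add_sub_cancel_left, pow_add, Real.mul_rpow (by positivity) (by positivity), mul_comm,
      ← Real.rpow_natCast 2 i, ← Real.rpow_natCast _ i, ← Real.rpow_mul (by norm_num),
      ← Real.rpow_mul (by norm_num), mul_comm (i : ℝ)]
  rw [Finset.sum_congr rfl h1, ← Finset.sum_mul]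
  gcongr
  refine sum_pow_le_of_injOn (by positivity) hθ1 _ (e := fun j => j - k) ?_
  intro i hi j hj hij
  have hi' := (Finset.mem_filter.1 hi).2
  have hj' := (Finset.mem_filter.1 hj).2
  simp only at hij
  omega

theorem finite_support_mul_left {n : ℕ} {v : (Fin n → ℤ) → ℂ} (hv : v.support.Finite)
    (u : (Fin n → ℤ) → ℂ) : (fun ξ => u ξ * v ξ).support.Finite :=
  hv.subset fun ξ hξ h => hξ (by simp [h])

theorem finite_support_lowCut {n : ℕ} (hn : 1 ≤ n) (J : ℕ) :
    (fun ξ : Fin n → ℤ => (lowCut J ξ : ℂ)).support.Finite := by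
  refine ((Finset.range (J + 1)).finite_toSet.biUnion fun j _ => finite_support_lpCut hn j).subset
    fun ξ hξ => ?_
  by_contra h
  simp only [Set.mem_iUnion, not_exists] at h
  refine hξ ?_
  simp only [← sum_lpCut, Complex.ofReal_sum]
  exact Finset.sum_eq_zero fun j hj => by
    by_contra h'
    exact h j (by simpa using hj) h'

theorem mulOp_lowCut {n : ℕ} (hn : 1 ≤ n) (a : (Fin n → ℤ) → ℂ) (J : ℕ) (f : (Fin n → ℝ) → ℂ)
    (x : Fin n → ℝ) : mulOp (fun ξ => a ξ * (lowCut J ξ : ℂ)) f x =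
      ∑ j ∈ Finset.range (J + 1), mulOp (fun ξ => a ξ * (lpCut j ξ : ℂ)) f x := by
  simp only [mulOp]
  rw [← trig_finset_sum _ fun j _ => finite_support_mul_fc
    (finite_support_mul_left (finite_support_lpCut hn j) a) _]
  simp only [← sum_lpCut, Complex.ofReal_sum, Finset.mul_sum, Finset.sum_mul]

theorem SymCl.exists_mul_lpCut (n : ℕ) (ρ μ A : ℝ) (hρ : ρ ≤ 1) (hA : 0 < A) :
    ∃ B : ℝ, 0 < B ∧ ∀ a : (Fin n → ℤ) → ℂ, SymCl (n / 2 + 1) ρ μ A a →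
      ∀ j, SymCl (n / 2 + 1) ρ μ B fun ξ => a ξ * (lpCut j ξ : ℂ) := by
  obtain ⟨B, hB, hs⟩ := exists_symCl_lpCut n (n / 2 + 1)
  obtain ⟨K, hK, hm⟩ := SymCl.exists_mul n (n / 2 + 1) ρ μ 0
  refine ⟨K * A * B, by positivity, fun a ha j => ?_⟩
  simpa using hm a _ A B hA.le hB.le ha ((hs j).mono hρ le_rfl hB.le)

theorem exists_lintegral_mulOp_le_of_rho_eq_one (n : ℕ) (hn : 1 ≤ n) {p A : ℝ} (hp : 2 < p)
    (hA : 0 < A) : ∃ C : ℝ, 0 < C ∧ ∀ a : (Fin n → ℤ) → ℂ, SymCl (n / 2 + 1) 1 0 A a →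
      ∀ (J : ℕ) (f : (Fin n → ℝ) → ℂ), BddMeas f →
      ∫⁻ x, ‖mulOp (fun ξ => a ξ * (lowCut J ξ : ℂ)) f x‖ₑ ^ p ∂(μT n) ≤
        ENNReal.ofReal C * ∫⁻ x, ‖f x‖ₑ ^ p ∂(μT n) := by
  have hn0 : (0 : ℝ) ≤ n := Nat.cast_nonneg n
  have hp2 : 0 < p - 2 := by linarith
  obtain ⟨B, hB, hs⟩ := SymCl.exists_mul_lpCut n 1 0 A le_rfl hA
  obtain ⟨γ, hγ, C, hC, h⟩ := exists_lintegral_sum_mulOp_le n hn (ρ := 1) (p := p) (A := B)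
    (L := A ^ 2) (c := 2 * (1 + n)) one_pos le_rfl hp hB (by positivity) (by linarith)
  simp only [sub_self, mul_zero, zero_mul, neg_zero, zero_div, Real.rpow_zero, mul_one] at h
  refine ⟨C * (A ^ 2 * (γ ^ (2 - p) / (p - 2))), by positivity, fun a ha J f hf => ?_⟩
  set S := Finset.range (J + 1)
  set u : ℕ → (Fin n → ℤ) → ℂ := fun j ξ => a ξ * (lpCut j ξ : ℂ) with hu
  have hfin : ∀ j, (u j).support.Finite := fun j =>
    finite_support_mul_left (finite_support_lpCut hn j) a
  have hL2 : ∀ (S' : Finset ℕ) (g : (Fin n → ℝ) → ℂ), BddMeas g →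
      ∫ x, ‖∑ j ∈ S', mulOp (u j) g x‖ ^ 2 ∂(μT n) ≤ A ^ 2 * ∫ x, ‖g x‖ ^ 2 ∂(μT n) := by
    intro S' g hg
    have e : ∀ x, ∑ j ∈ S', mulOp (u j) g x = mulOp (fun ξ => ∑ j ∈ S', u j ξ) g x := fun x => by
      simp only [mulOp, Finset.sum_mul]
      exact (trig_finset_sum S' (fun j _ => finite_support_mul_fc (hfin j) _) x).symm
    simp_rw [e]
    refine integral_norm_sq_mulOp_le ?_ (fun ξ => ?_) hg
    · refine (S'.finite_toSet.biUnion fun j _ => hfin j).subset fun ξ hξ => ?_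
      by_contra h
      simp only [Set.mem_iUnion, not_exists] at h
      exact hξ (Finset.sum_eq_zero fun j hj => by
        by_contra h'
        exact h j (by simpa using hj) h')
    · have h1 : ‖a ξ‖ ≤ A := by simpa using ha.norm_le hn ξ
      rw [hu, ← Finset.mul_sum, norm_mul, ← Complex.ofReal_sum, Complex.norm_real,
        Real.norm_of_nonneg (Finset.sum_nonneg fun j _ => lpCut_nonneg j ξ)]
      exact (mul_le_of_le_one_right (norm_nonneg _) (sum_lpCut_le_one S' ξ)).trans h1
  have hmain := h u (hs a ha) (fun j => (dyadic_lpCut j).mul_left a) S (fun _ => f) (fun _ => hf)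
    (fun t => ENNReal.ofReal (A ^ 2) *
      ∫⁻ x, ‖{y | γ * t < ‖f y‖}.indicator f x‖ₑ ^ 2 ∂(μT n))
    (fun k E t ht hE => ?_) (fun t ht => ?_)
  · have e0 : ∀ x, _ = ∑ j ∈ S, mulOp (u j) f x := mulOp_lowCut hn a J f
    simp_rw [e0]
    refine hmain.trans (le_of_eq ?_)
    rw [ENNReal.ofReal_mul hC.le, ENNReal.ofReal_mul (by positivity), mul_assoc, mul_assoc,
      ← lintegral_rpow_mul_tail hf.measurable hγ hp]
    refine congrArg _ ?_
    rw [← lintegral_const_mul' _ _ ENNReal.ofReal_ne_top]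
    exact lintegral_congr fun t => by ring
  · refine (hL2 _ _ ((hf.indicator (measurableSet_lt_norm hf _).compl).indicator hE)).trans ?_
    rw [mul_assoc]
    gcongr
    exact integral_norm_sq_indicator_le (fun y => norm_indicator_compl_le f (by positivity) y) hE
  · have hb := hf.indicator_lt (γ * t)
    rw [(BddMeas.sum S fun j _ => BddMeas.mulOp (hfin j) _).lintegral_norm_sq,
      hb.lintegral_norm_sq, ← ENNReal.ofReal_mul (by positivity)]
    exact ENNReal.ofReal_le_ofReal (hL2 S _ hb)

theorem exists_lintegral_mulOp_le_of_rho_lt_one (n : ℕ) (hn : 1 ≤ n) {ρ p A : ℝ} (hρ0 : 0 < ρ)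
    (hρ1 : ρ < 1) (hp : 2 < p) (hA : 0 < A) : ∃ C : ℝ, 0 < C ∧ ∀ a : (Fin n → ℤ) → ℂ,
      SymCl (n / 2 + 1) ρ (-(n * (1 - ρ) * (1 / 2 - 1 / p))) A a →
      ∀ (J : ℕ) (f : (Fin n → ℝ) → ℂ), BddMeas f →
      ∫⁻ x, ‖mulOp (fun ξ => a ξ * (lowCut J ξ : ℂ)) f x‖ₑ ^ p ∂(μT n) ≤
        ENNReal.ofReal C * ∫⁻ x, ‖f x‖ₑ ^ p ∂(μT n) := by
  have hn0 : (0 : ℝ) < n := by exact_mod_cast hn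
  have hp2 : 0 < p - 2 := by linarith
  set m : ℝ := n * (1 - ρ) * (1 / 2 - 1 / p) with hm
  set q : ℝ := n * (1 - ρ) / p with hq
  have hq0 : 0 < n * (1 - ρ) := mul_pos hn0 (by linarith)
  have hmq : 2 * m + 2 * q = n * (1 - ρ) := by rw [hm, hq]; field_simp; ring
  have hmq2 : 2 * m = q * (p - 2) := by rw [hm, hq]; field_simp
  have hθ1 : (2 : ℝ) ^ (-(n * (1 - ρ))) < 1 :=
    Real.rpow_lt_one_of_one_lt_of_neg (by norm_num) (by linarith)
  have hθ : 0 < 1 - (2 : ℝ) ^ (-(n * (1 - ρ))) := by linarith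
  set κ : ℝ := A * (2 * (1 + n)) ^ |-m| with hκ
  have hκ0 : 0 < κ := by positivity
  obtain ⟨B, hB, hs⟩ := SymCl.exists_mul_lpCut n ρ (-m) A hρ1.le hA
  obtain ⟨γ, hγ, C, hC, h⟩ := exists_lintegral_sum_mulOp_le n hn (ρ := ρ) (p := p) (A := B)
    (L := κ ^ 2 * (1 - 2 ^ (-(n * (1 - ρ))))⁻¹) (c := 2 * (1 + n)) hρ0 hρ1.le hp hB
    (by positivity) (by linarith)
  obtain ⟨K, hK, hfat⟩ := exists_sum_lintegral_fatCut_le n hn hp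
  refine ⟨C * (κ ^ 2 * (γ ^ (2 - p) / (p - 2)) * K), by positivity, fun a ha J f hf => ?_⟩
  set S := Finset.range (J + 1)
  set u : ℕ → (Fin n → ℤ) → ℂ := fun j ξ => a ξ * (lpCut j ξ : ℂ) with hu
  have hfin : ∀ j, (u j).support.Finite := fun j =>
    finite_support_mul_left (finite_support_lpCut hn j) a
  have hfat' := finite_support_fatCut hn
  set P : ℕ → (Fin n → ℝ) → ℂ := fun j => mulOp (fun ξ => (fatCut j ξ : ℂ)) f with hP
  have hPB : ∀ j, BddMeas (P j) := fun j => BddMeas.mulOp (hfat' j) f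
  have hPu : ∀ j x, mulOp (u j) (P j) x = mulOp (u j) f x := by
    intro j x
    simp only [mulOp, hP, hu]
    congr 1
    funext ξ
    rw [fc_trig (finite_support_mul_fc (hfat' j) _), mul_assoc, ← mul_assoc (lpCut j ξ : ℂ),
      ← Complex.ofReal_mul, lpCut_mul_fatCut, mul_assoc]
  have h2j : ∀ j : ℕ, (0 : ℝ) < 2 ^ j := fun j => by positivity
  have hL2 : ∀ (S' : Finset ℕ) (g : ℕ → (Fin n → ℝ) → ℂ), (∀ j, BddMeas (g j)) →
      ∫ x, ‖∑ j ∈ S', mulOp (u j) (g j) x‖ ^ 2 ∂(μT n) ≤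
        ∑ j ∈ S', κ ^ 2 * ((2 : ℝ) ^ j) ^ (-(2 * m)) * ∫ x, ‖g j x‖ ^ 2 ∂(μT n) := by
    intro S' g hg
    refine (integral_norm_sq_sum_mulOp_le hA.le (ha.norm_le hn) hfin S' hg).trans
      (Finset.sum_le_sum fun j _ => le_of_eq ?_)
    congr 1
    rw [← mul_assoc, mul_pow, ← hκ, ← Real.rpow_natCast (((2 : ℝ) ^ j) ^ (-m)),
      ← Real.rpow_mul (h2j j).le]
    congr 2
    push_cast; ring
  have hγj : ∀ j : ℕ, 0 < γ * ((2 : ℝ) ^ j) ^ (-q) := fun j => by positivity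
  have hmain := h u (hs a ha) (fun j => (dyadic_lpCut j).mul_left a) S P hPB
    (fun t => ∑ j ∈ S, ENNReal.ofReal (κ ^ 2 * ((2 : ℝ) ^ j) ^ (-(2 * m))) *
      ∫⁻ x, ‖{y | γ * ((2 : ℝ) ^ j) ^ (-q) * t < ‖P j y‖}.indicator (P j) x‖ₑ ^ 2 ∂(μT n))
    (fun k E t ht hE => ?_) (fun t ht => ?_)
  · have e0 : ∀ x, _ = ∑ j ∈ S, mulOp (u j) f x := mulOp_lowCut hn a J f
    simp_rw [hPu] at hmain
    simp_rw [e0]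
    refine hmain.trans ?_
    rw [ENNReal.ofReal_mul hC.le, mul_assoc]
    gcongr
    simp_rw [Finset.mul_sum]
    rw [lintegral_finsetSum]
    swap
    · intro j _
      exact Measurable.mul (by fun_prop) ((measurable_tail (P j) (hγj j)).const_mul _)
    have e : ∀ j ∈ S, ∫⁻ t in Set.Ioi (0 : ℝ), ENNReal.ofReal (t ^ (p - 3)) *
        (ENNReal.ofReal (κ ^ 2 * ((2 : ℝ) ^ j) ^ (-(2 * m))) *
          ∫⁻ x, ‖{y | γ * ((2 : ℝ) ^ j) ^ (-q) * t < ‖P j y‖}.indicator (P j) x‖ₑ ^ 2 ∂(μT n)) =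
        ENNReal.ofReal (κ ^ 2 * (γ ^ (2 - p) / (p - 2))) * ∫⁻ x, ‖P j x‖ₑ ^ p ∂(μT n) := by
      intro j _
      simp_rw [mul_left_comm (ENNReal.ofReal (_ ^ (p - 3)))]
      rw [lintegral_const_mul' _ _ ENNReal.ofReal_ne_top,
        lintegral_rpow_mul_tail (hPB j).measurable (hγj j) hp, ← mul_assoc,
        ← ENNReal.ofReal_mul (by positivity)]
      congr 2
      rw [Real.mul_rpow hγ.le (by positivity), ← Real.rpow_mul (h2j j).le,
        show -q * (2 - p) = 2 * m by rw [hmq2]; ring, Real.rpow_neg (h2j j).le]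
      field_simp
    rw [Finset.sum_congr rfl e, ← Finset.mul_sum,
      ENNReal.ofReal_mul (p := κ ^ 2 * (γ ^ (2 - p) / (p - 2))) (by positivity), mul_assoc]
    exact mul_le_mul_right (hfat J f hf) _
  · set g : ℕ → (Fin n → ℝ) → ℂ := fun j =>
      {y | γ * ((2 : ℝ) ^ j) ^ (-q) * t < ‖P j y‖}ᶜ.indicator (P j) with hg
    refine (hL2 _ _ fun j => ((hPB j).indicator
      (measurableSet_lt_norm (hPB j) _).compl).indicator hE).trans ?_
    calc _ ≤ ∑ j ∈ S with ¬ j ≤ k, κ ^ 2 * ((2 : ℝ) ^ j) ^ (-(2 * m)) *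
          ((γ * ((2 : ℝ) ^ j) ^ (-q) * t) ^ 2 * (μT n).real E) := by
          gcongr with j _
          exact integral_norm_sq_indicator_le
            (fun y => norm_indicator_compl_le (P j) (by positivity) y) hE
      _ = κ ^ 2 * (γ * t) ^ 2 * (μT n).real E *
          ∑ j ∈ S with ¬ j ≤ k, ((2 : ℝ) ^ j) ^ (-(n * (1 - ρ))) := by
          rw [Finset.mul_sum]
          refine Finset.sum_congr rfl fun j _ => ?_
          rw [← hmq, show -(2 * m + 2 * q) = -(2 * m) + -q * (2 : ℕ) by push_cast; ring,
            Real.rpow_add (h2j j), Real.rpow_mul (h2j j).le (-q), Real.rpow_natCast]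
          ring
      _ ≤ κ ^ 2 * (γ * t) ^ 2 * (μT n).real E *
          ((1 - 2 ^ (-(n * (1 - ρ))))⁻¹ * ((2 : ℝ) ^ k) ^ (-(n * (1 - ρ)))) := by
          gcongr
          exact sum_two_pow_rpow_le hq0 S k
      _ = _ := by ring
  · have hb := fun j => (hPB j).indicator_lt (γ * ((2 : ℝ) ^ j) ^ (-q) * t)
    rw [(BddMeas.sum S fun j _ => BddMeas.mulOp (hfin j) _).lintegral_norm_sq]
    refine (ENNReal.ofReal_le_ofReal (hL2 S _ hb)).trans (le_of_eq ?_)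
    rw [ENNReal.ofReal_sum_of_nonneg fun j _ => by positivity]
    refine Finset.sum_congr rfl fun j _ => ?_
    rw [(hb j).lintegral_norm_sq, ← ENNReal.ofReal_mul (by positivity)]

/-! ### `L^p` bounds for Fourier multipliers on trigonometric polynomials -/

theorem exists_lintegral_mulOp_le (n : ℕ) (hn : 1 ≤ n) {ρ p A : ℝ} (hρ0 : 0 < ρ)
    (hρ1 : ρ ≤ 1) (hp : 2 ≤ p) (hA : 0 < A) : ∃ C : ℝ, 0 < C ∧ ∀ a : (Fin n → ℤ) → ℂ,
      SymCl (n / 2 + 1) ρ (-(n * (1 - ρ) * (1 / 2 - 1 / p))) A a →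
      ∀ (J : ℕ) (f : (Fin n → ℝ) → ℂ), BddMeas f →
      ∫⁻ x, ‖mulOp (fun ξ => a ξ * (lowCut J ξ : ℂ)) f x‖ₑ ^ p ∂(μT n) ≤
        ENNReal.ofReal C * ∫⁻ x, ‖f x‖ₑ ^ p ∂(μT n) := by
  rcases hp.eq_or_lt with rfl | hp
  · refine ⟨A ^ 2, by positivity, fun a ha J f hf => ?_⟩
    have hu := finite_support_mul_left (finite_support_lowCut hn J) a
    have hb : ∀ ξ, ‖a ξ * (lowCut J ξ : ℂ)‖ ≤ A := fun ξ => by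
      have h1 : ‖a ξ‖ ≤ A := by simpa using ha.norm_le hn ξ
      rw [norm_mul, Complex.norm_real, Real.norm_of_nonneg (lowCut_nonneg J ξ)]
      nlinarith [lowCut_le_one J ξ, lowCut_nonneg J ξ, norm_nonneg (a ξ)]
    have h := integral_norm_sq_mulOp_le hu hb hf
    simp only [ENNReal.rpow_ofNat]
    rw [(BddMeas.mulOp hu f).lintegral_norm_sq, hf.lintegral_norm_sq,
      ← ENNReal.ofReal_mul (by positivity)]
    exact ENNReal.ofReal_le_ofReal h
  · rcases hρ1.eq_or_lt with rfl | hρ1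
    · obtain ⟨C, hC, h⟩ := exists_lintegral_mulOp_le_of_rho_eq_one n hn hp hA
      exact ⟨C, hC, fun a ha => h a (by simpa using ha)⟩
    · exact exists_lintegral_mulOp_le_of_rho_lt_one n hn hρ0 hρ1 hp hA

theorem exists_lowCut_eq_one {n : ℕ} (S : Finset (Fin n → ℤ)) :
    ∃ J : ℕ, ∀ ξ ∈ S, lowCut J ξ = 1 := by
  obtain ⟨J, hJ⟩ := pow_unbounded_of_one_lt (∑ ξ ∈ S, ∑ l, |(ξ l : ℝ)|) (one_lt_two (α := ℝ))
  refine ⟨J, fun ξ hξ => lowCut_eq_one fun l => ?_⟩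
  have h1 : |(ξ l : ℝ)| ≤ ∑ l, |(ξ l : ℝ)| :=
    Finset.single_le_sum (f := fun l => |(ξ l : ℝ)|) (fun _ _ => abs_nonneg _) (Finset.mem_univ l)
  have h2 : ∑ l, |(ξ l : ℝ)| ≤ ∑ ξ ∈ S, ∑ l, |(ξ l : ℝ)| :=
    Finset.single_le_sum (f := fun ξ : Fin n → ℤ => ∑ l, |(ξ l : ℝ)|)
      (fun _ _ => Finset.sum_nonneg fun _ _ => abs_nonneg _) hξ
  exact_mod_cast (h1.trans h2).trans hJ.le

theorem BddMeas.lintegral_norm_rpow {n : ℕ} {f : (Fin n → ℝ) → ℂ} (hf : BddMeas f) {p : ℝ}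
    (hp : 0 ≤ p) : ∫⁻ x, ‖f x‖ₑ ^ p ∂(μT n) = ENNReal.ofReal (∫ x, ‖f x‖ ^ p ∂(μT n)) := by
  rw [ofReal_integral_eq_lintegral_ofReal (hf.integrable_norm_rpow hp)
    (.of_forall fun x => by positivity)]
  congr 1; ext x
  rw [← ENNReal.ofReal_rpow_of_nonneg (norm_nonneg _) hp, ofReal_norm]

theorem le_rpow_mul_of_le_mul_rpow {p q : ℝ} (hpq : p.HolderConjugate q) {U V K : ℝ≥0∞}
    (hU : U ≠ ∞) (h : U ≤ V ^ (1 / p) * (K * U) ^ (1 / q)) : U ≤ K ^ (p / q) * V := by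
  rcases eq_or_ne U 0 with rfl | hU0
  · exact zero_le
  have hp := hpq.pos
  have hq := hpq.symm.pos
  have h1 : U ^ (1 / p) * U ^ (1 / q) = U := by
    rw [← ENNReal.rpow_add _ _ hU0 hU, one_div, one_div, hpq.inv_add_inv_eq_one, ENNReal.rpow_one]
  have h2 : U ^ (1 / p) ≤ V ^ (1 / p) * K ^ (1 / q) := by
    rw [ENNReal.mul_rpow_of_nonneg _ _ (by positivity), ← mul_assoc] at h
    nth_rewrite 1 [← h1] at h
    exact (ENNReal.mul_le_mul_iff_left (by simp [hU0, hU]) (by simp [hU0, hU])).1 h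
  have h3 := ENNReal.rpow_le_rpow h2 hp.le
  rw [ENNReal.mul_rpow_of_nonneg _ _ hp.le, ← ENNReal.rpow_mul, ← ENNReal.rpow_mul,
    ← ENNReal.rpow_mul, one_div_mul_cancel hp.ne', ENNReal.rpow_one, ENNReal.rpow_one,
    mul_comm] at h3
  rwa [show p / q = 1 / q * p by ring]

theorem trig_mul_eq_mulOp {n : ℕ} {a c : (Fin n → ℤ) → ℂ} (hc : c.support.Finite) {J : ℕ}
    (hJ : ∀ ξ ∈ hc.toFinset, lowCut J ξ = 1) :
    trig (fun ξ => a ξ * c ξ) = mulOp (fun ξ => a ξ * (lowCut J ξ : ℂ)) (trig c) := by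
  unfold mulOp
  congr 1; ext ξ
  rw [fc_trig hc]
  by_cases h : ξ ∈ hc.toFinset
  · simp [hJ ξ h]
  · simp [eq_zero_of_notMem_toFinset hc ξ h]

theorem lintegral_trig_mul_le_of_conj {n : ℕ} (hn : 1 ≤ n) {p q : ℝ} (hpq : p.HolderConjugate q)
    {a c : (Fin n → ℤ) → ℂ} (hc : c.support.Finite) {J : ℕ}
    (hJ : ∀ ξ ∈ hc.toFinset, lowCut J ξ = 1) {K : ℝ≥0∞}
    (h : ∀ f, BddMeas f →
      ∫⁻ x, ‖mulOp (fun ξ => (starRingEnd ℂ) (a ξ) * (lowCut J ξ : ℂ)) f x‖ₑ ^ q ∂(μT n) ≤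
        K * ∫⁻ x, ‖f x‖ₑ ^ q ∂(μT n)) :
    ∫⁻ x, ‖trig (fun ξ => a ξ * c ξ) x‖ₑ ^ p ∂(μT n) ≤
      K ^ (p / q) * ∫⁻ x, ‖trig c x‖ₑ ^ p ∂(μT n) := by
  have hac := finite_support_mul_left hc a
  have hp := hpq.pos
  have hq := hpq.symm.pos
  have hS : ∀ ξ ∉ hc.toFinset, a ξ * c ξ = 0 := fun ξ hξ => by
    rw [eq_zero_of_notMem_toFinset hc ξ hξ, mul_zero]
  set u := trig (fun ξ => a ξ * c ξ) with hu
  have hub : BddMeas u := BddMeas.trig hac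
  set g : (Fin n → ℝ) → ℂ := fun x => ((‖u x‖ ^ (p - 2) : ℝ) : ℂ) * u x with hg
  have hgn : ∀ x, ‖g x‖ = ‖u x‖ ^ (p - 1) := fun x => by
    rcases eq_or_ne (u x) 0 with h0 | h0
    · simp [hg, h0, Real.zero_rpow (hpq.sub_one_pos).ne']
    · rw [hg, norm_mul, Complex.norm_real, Real.norm_of_nonneg (by positivity),
        ← Real.rpow_add_one (by simpa using h0)]
      congr 1; ring
  have hgb : BddMeas g := by
    obtain ⟨M, hM⟩ := hub.bdd
    refine ⟨?_, M ^ (p - 1), fun x => ?_⟩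
    · exact (Complex.measurable_ofReal.comp (hub.measurable.norm.pow_const _)).mul hub.measurable
    · rw [hgn]
      exact Real.rpow_le_rpow (norm_nonneg _) (hM x) hpq.sub_one_pos.le
  set b : (Fin n → ℤ) → ℂ := fun ξ => (starRingEnd ℂ) (a ξ) * (lowCut J ξ : ℂ) with hb
  have hbf : b.support.Finite := finite_support_mul_left (finite_support_lowCut hn J) _
  have hwb : BddMeas (mulOp b g) := BddMeas.mulOp hbf g
  have hfw : ∀ ξ, fc (mulOp b g) ξ = b ξ * fc g ξ := fun ξ =>
    fc_trig (finite_support_mul_fc hbf _) ξ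
  have hpair : ∫ x, u x * (starRingEnd ℂ) (g x) ∂(μT n) =
      ∫ x, trig c x * (starRingEnd ℂ) (mulOp b g x) ∂(μT n) := by
    rw [integral_trig_mul_conj hS hgb, integral_trig_mul_conj (eq_zero_of_notMem_toFinset hc) hwb]
    refine Finset.sum_congr rfl fun ξ hξ => ?_
    rw [hfw]
    simp only [hb, hJ ξ hξ, map_mul, Complex.conj_conj, Complex.ofReal_one, map_one]
    ring
  have hleft : ∫ x, u x * (starRingEnd ℂ) (g x) ∂(μT n) = ((∫ x, ‖u x‖ ^ p ∂(μT n) : ℝ) : ℂ) := by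
    rw [← integral_complex_ofReal]
    congr 1; ext x
    simp only [hg, map_mul, Complex.conj_ofReal]
    rw [mul_left_comm, Complex.mul_conj, Complex.normSq_eq_norm_sq, ← Complex.ofReal_mul]
    congr 1
    rcases eq_or_ne (u x) 0 with h0 | h0
    · simp [h0, Real.zero_rpow hp.ne']
    · rw [← Real.rpow_natCast, ← Real.rpow_add (by simpa using h0)]
      congr 1; push_cast; ring
  have hgq : ∫⁻ x, ‖g x‖ₑ ^ q ∂(μT n) = ∫⁻ x, ‖u x‖ₑ ^ p ∂(μT n) := by
    congr 1; ext x
    rw [← ofReal_norm, ← ofReal_norm, hgn, ← ENNReal.ofReal_rpow_of_nonneg (norm_nonneg _)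
      hpq.sub_one_pos.le, ← ENNReal.rpow_mul]
    congr 1
    rw [hpq.sub_one_mul_conj]
  have hUeq := hub.lintegral_norm_rpow hp.le
  refine le_rpow_mul_of_le_mul_rpow hpq (by rw [hUeq]; exact ENNReal.ofReal_ne_top) ?_
  calc ∫⁻ x, ‖u x‖ₑ ^ p ∂(μT n) = ‖∫ x, u x * (starRingEnd ℂ) (g x) ∂(μT n)‖ₑ := by
        rw [hUeq, hleft, ← ofReal_norm, Complex.norm_real, Real.norm_of_nonneg
          (integral_nonneg fun x => by positivity)]
    _ = ‖∫ x, trig c x * (starRingEnd ℂ) (mulOp b g x) ∂(μT n)‖ₑ := by rw [hpair]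
    _ ≤ ∫⁻ x, ‖trig c x * (starRingEnd ℂ) (mulOp b g x)‖ₑ ∂(μT n) :=
        enorm_integral_le_lintegral_enorm _
    _ = ∫⁻ x, ((fun x => ‖trig c x‖ₑ) * fun x => ‖mulOp b g x‖ₑ) x ∂(μT n) := by
        congr 1; ext x
        rw [enorm_mul, Pi.mul_apply]
        congr 1
        rw [← ofReal_norm, ← ofReal_norm, Complex.norm_conj]
    _ ≤ (∫⁻ x, ‖trig c x‖ₑ ^ p ∂(μT n)) ^ (1 / p) *
          (∫⁻ x, ‖mulOp b g x‖ₑ ^ q ∂(μT n)) ^ (1 / q) :=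
        ENNReal.lintegral_mul_le_Lp_mul_Lq _ hpq
          (BddMeas.trig hc).measurable.enorm.aemeasurable hwb.measurable.enorm.aemeasurable
    _ ≤ _ := by
        have h1 := h g hgb
        rw [hgq] at h1
        exact mul_le_mul_right (ENNReal.rpow_le_rpow h1 (by positivity)) _

/-- Fefferman's theorem for Fourier multipliers, on trigonometric polynomials. -/
theorem exists_lintegral_trig_mul_le (n : ℕ) (hn : 1 ≤ n) {ρ p A : ℝ} (hρ0 : 0 < ρ)
    (hρ1 : ρ ≤ 1) (hp : 1 < p) (hA : 0 < A) : ∃ C : ℝ, 0 < C ∧ ∀ a : (Fin n → ℤ) → ℂ,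
      SymCl (n / 2 + 1) ρ (-(n * (1 - ρ) * |1 / p - 1 / 2|)) A a →
      ∀ c : (Fin n → ℤ) → ℂ, c.support.Finite →
      ∫⁻ x, ‖trig (fun ξ => a ξ * c ξ) x‖ₑ ^ p ∂(μT n) ≤
        ENNReal.ofReal C * ∫⁻ x, ‖trig c x‖ₑ ^ p ∂(μT n) := by
  have hp0 : 0 < p := by linarith
  rcases le_or_gt 2 p with h2 | h2
  · obtain ⟨C, hC, h⟩ := exists_lintegral_mulOp_le n hn hρ0 hρ1 h2 hA
    refine ⟨C, hC, fun a ha c hc => ?_⟩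
    have habs : |1 / p - 1 / 2| = 1 / 2 - 1 / p := by
      rw [abs_sub_comm, abs_of_nonneg]
      rw [sub_nonneg]; exact one_div_le_one_div_of_le two_pos h2
    rw [habs] at ha
    obtain ⟨J, hJ⟩ := exists_lowCut_eq_one hc.toFinset
    rw [trig_mul_eq_mulOp hc hJ]
    exact h a ha J _ (BddMeas.trig hc)
  · have hpq := Real.HolderConjugate.conjExponent hp
    set q := p.conjExponent with hq
    have hq2 : 2 ≤ q := by
      rw [hq, Real.conjExponent, le_div_iff₀ (by linarith)]; linarith
    have habs : |1 / p - 1 / 2| = 1 / 2 - 1 / q := by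
      have h1 := hpq.inv_add_inv_eq_one
      rw [abs_of_nonneg (sub_nonneg.2 (one_div_le_one_div_of_le hp0 h2.le)), one_div p, one_div q]
      linarith
    obtain ⟨C, hC, h⟩ := exists_lintegral_mulOp_le n hn hρ0 hρ1 hq2 hA
    refine ⟨C ^ (p / q), by positivity, fun a ha c hc => ?_⟩
    rw [habs] at ha
    obtain ⟨J, hJ⟩ := exists_lowCut_eq_one hc.toFinset
    rw [← ENNReal.ofReal_rpow_of_pos hC]
    exact lintegral_trig_mul_le_of_conj hn hpq hc hJ fun f hf => h _ ha.conj J f hf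

/-! ### A local Sobolev inequality -/

theorem hasDerivAt_taylor_sum {g : ℕ → ℝ → ℂ} (hg : ∀ i t, HasDerivAt (g i) (g (i + 1) t) t)
    (m : ℕ) (t : ℝ) :
    HasDerivAt (fun t : ℝ => ∑ i ∈ Finset.range (m + 1),
      (((-t) ^ i / (i.factorial : ℝ) : ℝ) : ℂ) * g i t)
      ((((-t) ^ m / (m.factorial : ℝ) : ℝ) : ℂ) * g (m + 1) t) t := by
  induction m with
  | zero => simpa using hg 0 t
  | succ m ih =>
    simp only [Finset.sum_range_succ _ (m + 1)]
    have h1 : HasDerivAt (fun t : ℝ => (-t) ^ (m + 1) / ((m + 1).factorial : ℝ))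
        (-((-t) ^ m / (m.factorial : ℝ))) t := by
      have h := ((hasDerivAt_neg t).pow (m + 1)).div_const ((m + 1).factorial : ℝ)
      convert! h using 1
      have : (m.factorial : ℝ) ≠ 0 := by positivity
      rw [Nat.factorial_succ]
      push_cast
      field_simp
    refine (ih.add (h1.ofReal_comp.mul (hg (m + 1) t))).congr_deriv ?_
    push_cast
    ring

theorem enorm_le_sum_add_lintegral {g : ℕ → ℝ → ℂ} (hg : ∀ i t, HasDerivAt (g i) (g (i + 1) t) t)
    (m : ℕ) : ‖g 0 0‖ₑ ≤ ∑ i ∈ Finset.range (m + 1), ‖g i 1‖ₑ +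
      ∫⁻ t in Set.Ioc (0 : ℝ) 1, ENNReal.ofReal (t ^ m) * ‖g (m + 1) t‖ₑ := by
  have hle : ∀ (i : ℕ) {t : ℝ}, 0 ≤ t → ‖(((-t) ^ i / (i.factorial : ℝ) : ℝ) : ℂ)‖ₑ ≤
      ENNReal.ofReal (t ^ i) := fun i t ht => by
    rw [← ofReal_norm, Complex.norm_real]
    refine ENNReal.ofReal_le_ofReal ?_
    rw [norm_div, norm_pow, norm_neg, Real.norm_of_nonneg ht, Real.norm_natCast]
    exact div_le_self (by positivity) (by exact_mod_cast i.factorial_pos)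
  have hcont : ∀ i, Continuous (g i) := fun i =>
    continuous_iff_continuousAt.2 fun t => (hg i t).continuousAt
  set F : ℝ → ℂ := fun t => (((-t) ^ m / (m.factorial : ℝ) : ℝ) : ℂ) * g (m + 1) t with hF
  have hFc : Continuous F := by
    have := hcont (m + 1)
    fun_prop
  have hint := intervalIntegral.integral_eq_sub_of_hasDerivAt (a := 0) (b := 1)
    (fun t _ => hasDerivAt_taylor_sum hg m t) (hFc.intervalIntegrable _ _)
  have h0 : ∑ i ∈ Finset.range (m + 1),
      (((-(0 : ℝ)) ^ i / (i.factorial : ℝ) : ℝ) : ℂ) * g i 0 = g 0 0 := by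
    rw [Finset.sum_range_succ', Finset.sum_eq_zero fun i _ => by simp]
    simp
  rw [h0] at hint
  have hg0 : g 0 0 = ∑ i ∈ Finset.range (m + 1),
      (((-(1 : ℝ)) ^ i / (i.factorial : ℝ) : ℝ) : ℂ) * g i 1 - ∫ t in (0 : ℝ)..1, F t := by
    rw [hint]; ring
  rw [hg0]
  refine (enorm_sub_le).trans
    (add_le_add ((enorm_sum_le _ _).trans (Finset.sum_le_sum fun i _ => ?_))
    ?_)
  · rw [enorm_mul]
    calc _ ≤ ENNReal.ofReal (1 ^ i) * ‖g i 1‖ₑ := mul_le_mul_left (hle i zero_le_one) _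
      _ = _ := by simp
  · rw [intervalIntegral.integral_of_le zero_le_one]
    refine (enorm_integral_le_lintegral_enorm _).trans (setLIntegral_mono' measurableSet_Ioc ?_)
    intro t ht
    rw [hF, enorm_mul]
    exact mul_le_mul_left (hle m ht.1.le) _

/-- Iterated partial derivative along a word of coordinate directions. -/
def pdW {n : ℕ} (L : List (Fin n)) (f : (Fin n → ℝ) → ℂ) : (Fin n → ℝ) → ℂ := L.foldr pd f

theorem ContDiff.pd {n : ℕ} {f : (Fin n → ℝ) → ℂ} (hf : ContDiff ℝ (⊤ : ℕ∞) f) (j : Fin n) :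
    ContDiff ℝ (⊤ : ℕ∞) (_root_.pd j f) :=
  (hf.fderiv_right (m := (⊤ : ℕ∞)) le_rfl).clm_apply contDiff_const

theorem ContDiff.pdW {n : ℕ} {f : (Fin n → ℝ) → ℂ} (hf : ContDiff ℝ (⊤ : ℕ∞) f)
    (L : List (Fin n)) : ContDiff ℝ (⊤ : ℕ∞) (_root_.pdW L f) := by
  induction L with
  | nil => exact hf
  | cons j L ih => exact ih.pd j

theorem hasDerivAt_comp_ray {n : ℕ} {f : (Fin n → ℝ) → ℂ} (hf : ContDiff ℝ (⊤ : ℕ∞) f)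
    (x y : Fin n → ℝ) (t : ℝ) :
    HasDerivAt (fun t : ℝ => f (x + t • y)) (∑ j, (y j : ℂ) * pd j f (x + t • y)) t := by
  have h1 : HasFDerivAt f (fderiv ℝ f (x + t • y)) (x + t • y) :=
    (hf.differentiable (by simp) _).hasFDerivAt
  have h2 : HasDerivAt (fun t : ℝ => x + t • y) y t := by
    simpa using ((hasDerivAt_id t).smul_const y).const_add x
  refine (h1.comp_hasDerivAt t h2).congr_deriv ?_
  have hy : y = ∑ j, y j • (Pi.single j 1 : Fin n → ℝ) := by
    ext i; simp [Finset.sum_apply, Pi.single_apply]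
  conv_lhs => rw [hy]
  rw [map_sum]
  refine Finset.sum_congr rfl fun j _ => ?_
  rw [map_smul, ← Complex.real_smul]
  conv_lhs => rw [← hy]
  rfl

/-- The iterated derivatives along a ray. -/
def rayDeriv {n : ℕ} (f : (Fin n → ℝ) → ℂ) (x y : Fin n → ℝ) (i : ℕ) (t : ℝ) : ℂ :=
  ∑ J : Fin i → Fin n, ((∏ l, y (J l) : ℝ) : ℂ) * pdW (List.ofFn J) f (x + t • y)

theorem hasDerivAt_rayDeriv {n : ℕ} {f : (Fin n → ℝ) → ℂ} (hf : ContDiff ℝ (⊤ : ℕ∞) f)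
    (x y : Fin n → ℝ) (i : ℕ) (t : ℝ) :
    HasDerivAt (rayDeriv f x y i) (rayDeriv f x y (i + 1) t) t := by
  have h := HasDerivAt.fun_sum (u := Finset.univ) fun (J : Fin i → Fin n) _ =>
    (hasDerivAt_comp_ray (hf.pdW (List.ofFn J)) x y t).const_mul ((∏ l, y (J l) : ℝ) : ℂ)
  refine h.congr_deriv ?_
  rw [rayDeriv, ← (Fin.consEquiv fun _ => Fin n).sum_comp, Fintype.sum_prod_type, Finset.sum_comm]
  refine Finset.sum_congr rfl fun J _ => ?_
  rw [Finset.mul_sum]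
  refine Finset.sum_congr rfl fun j _ => ?_
  simp only [Fin.consEquiv, Equiv.coe_fn_mk, Fin.prod_univ_succ, List.ofFn_succ, Fin.cons_zero,
    Fin.cons_succ, pdW, List.foldr_cons]
  push_cast
  ring

theorem enorm_rayDeriv_le {n : ℕ} (f : (Fin n → ℝ) → ℂ) (x y : Fin n → ℝ) (hy : y ∈ cube n)
    (i : ℕ) (t : ℝ) : ‖rayDeriv f x y i t‖ₑ ≤
      ∑ J : Fin i → Fin n, ‖pdW (List.ofFn J) f (x + t • y)‖ₑ := by
  refine (enorm_sum_le _ _).trans (Finset.sum_le_sum fun J _ => ?_)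
  rw [enorm_mul]
  refine (mul_le_mul_left (b := ‖((∏ l, y (J l) : ℝ) : ℂ)‖ₑ) (c := 1) ?_ _).trans (one_mul _).le
  rw [← ofReal_norm, Complex.norm_real, ENNReal.ofReal_le_one, Real.norm_eq_abs, Finset.abs_prod]
  refine Finset.prod_le_one (fun _ _ => abs_nonneg _) fun l _ => ?_
  have := hy (J l) (Set.mem_univ _)
  rw [abs_of_nonneg this.1]
  exact this.2.le

/-- The box `[0,2)ⁿ`. -/
def box (n : ℕ) : Set (Fin n → ℝ) := Set.univ.pi fun _ => Set.Ico (0 : ℝ) 2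

theorem measurableSet_box (n : ℕ) : MeasurableSet (box n) :=
  MeasurableSet.univ_pi fun _ => measurableSet_Ico

theorem add_smul_mem_box {n : ℕ} {x y : Fin n → ℝ} (hx : x ∈ cube n) (hy : y ∈ cube n) {t : ℝ}
    (ht0 : 0 ≤ t) (ht1 : t ≤ 1) : x + t • y ∈ box n := by
  intro l hl
  have h1 := hx l hl
  have h2 := hy l hl
  simp only [Pi.add_apply, Pi.smul_apply, smul_eq_mul, Set.mem_Ico] at *
  constructor <;> nlinarith

theorem lintegral_comp_ray_le {n : ℕ} {F : (Fin n → ℝ) → ℝ≥0∞} (hF : Measurable F)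
    {x : Fin n → ℝ} (hx : x ∈ cube n) {t : ℝ} (ht0 : 0 < t) (ht1 : t ≤ 1) :
    ∫⁻ y, F (x + t • y) ∂(μT n) ≤ ENNReal.ofReal (t ^ (-(n : ℝ))) * ∫⁻ z in box n, F z := by
  set G := (box n).indicator F with hG
  have hGm : Measurable G := hF.indicator (measurableSet_box n)
  calc ∫⁻ y, F (x + t • y) ∂(μT n) ≤ ∫⁻ y, G (x + t • y) := by
        rw [μT]
        refine (setLIntegral_mono' (measurableSet_cube n) fun y hy => ?_).trans
          (setLIntegral_le_lintegral _ _)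
        rw [hG, Set.indicator_of_mem (add_smul_mem_box hx hy ht0.le ht1)]
    _ = ∫⁻ w, G (x + w) ∂(Measure.map (fun y : Fin n → ℝ => t • y) volume) := by
        rw [lintegral_map (by fun_prop) (by fun_prop)]
    _ = ENNReal.ofReal (t ^ (-(n : ℝ))) * ∫⁻ w, G (x + w) := by
        rw [Measure.map_addHaar_smul _ ht0.ne', lintegral_smul_measure, smul_eq_mul]
        congr 2
        rw [Module.finrank_fin_fun, abs_of_pos (by positivity), Real.rpow_neg ht0.le,
          Real.rpow_natCast]
    _ = _ := by
        rw [lintegral_add_left_eq_self, hG, lintegral_indicator (measurableSet_box n)]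

theorem lintegral_le_lintegral_rpow {n : ℕ} {F : (Fin n → ℝ) → ℝ≥0∞} (hF : Measurable F) {p : ℝ}
    (hp : 1 < p) : ∫⁻ y, F y ∂(μT n) ≤ (∫⁻ y, F y ^ p ∂(μT n)) ^ (1 / p) := by
  have := isProbabilityMeasure_μT n
  have h := ENNReal.lintegral_mul_le_Lp_mul_Lq (μT n) (Real.HolderConjugate.conjExponent hp)
    hF.aemeasurable (aemeasurable_const (b := (1 : ℝ≥0∞)))
  simpa using h

theorem lintegral_comp_ray_le_rpow {n : ℕ} {F : (Fin n → ℝ) → ℝ≥0∞} (hF : Measurable F) {p : ℝ}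
    (hp : 1 < p) {x : Fin n → ℝ} (hx : x ∈ cube n) {t : ℝ} (ht0 : 0 < t) (ht1 : t ≤ 1) :
    ∫⁻ y, F (x + t • y) ∂(μT n) ≤
      ENNReal.ofReal (t ^ (-(n / p))) * (∫⁻ z in box n, F z ^ p) ^ (1 / p) := by
  refine (lintegral_le_lintegral_rpow (hF.comp (by fun_prop)) hp).trans ?_
  refine (ENNReal.rpow_le_rpow (lintegral_comp_ray_le (hF.pow_const p) hx ht0 ht1)
    (by positivity)).trans (le_of_eq ?_)
  rw [ENNReal.mul_rpow_of_nonneg _ _ (by positivity), ENNReal.ofReal_rpow_of_pos (by positivity),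
    ← Real.rpow_mul ht0.le]
  congr 3
  ring

theorem exists_enorm_le_sum_box (n m : ℕ) {p : ℝ} (hp : 1 < p) (hm : (n : ℝ) / p < m + 1) :
    ∃ C : ℝ, 0 < C ∧ ∀ f : (Fin n → ℝ) → ℂ, ContDiff ℝ (⊤ : ℕ∞) f → ∀ x ∈ cube n,
      ‖f x‖ₑ ^ p ≤ ENNReal.ofReal C * ∑ i ∈ Finset.range (m + 2), ∑ J : Fin i → Fin n,
        ∫⁻ z in box n, ‖pdW (List.ofFn J) f z‖ₑ ^ p := by
  have := isProbabilityMeasure_μT n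
  have hp0 : 0 < p := by linarith
  set K : ℝ≥0∞ := 1 + ∫⁻ t in Set.Ioc (0 : ℝ) 1, ENNReal.ofReal (t ^ (m - n / p)) with hK
  have hKfin : K ≠ ∞ := by
    have h1 : IntervalIntegrable (fun t : ℝ => t ^ (m - n / p)) volume 0 1 :=
      intervalIntegral.intervalIntegrable_rpow' (by linarith)
    rw [intervalIntegrable_iff_integrableOn_Ioc_of_le zero_le_one] at h1
    refine ENNReal.add_ne_top.2 ⟨ENNReal.one_ne_top, ?_⟩
    exact (h1.lintegral_lt_top).ne
  set D : ℝ≥0∞ := K ^ p * (((m + 2 : ℕ) : ℝ≥0∞) ^ (p - 1)) *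
    ∑ i ∈ Finset.range (m + 2), ((n ^ i : ℕ) : ℝ≥0∞) ^ (p - 1) with hD
  have hDfin : D ≠ ∞ := by
    refine ENNReal.mul_ne_top (ENNReal.mul_ne_top ?_ ?_) ?_
    · exact ENNReal.rpow_ne_top_of_nonneg hp0.le hKfin
    · exact ENNReal.rpow_ne_top_of_nonneg (by linarith) (ENNReal.natCast_ne_top _)
    · exact (ENNReal.sum_lt_top.2 fun i _ => (ENNReal.rpow_ne_top_of_nonneg (by linarith)
        (ENNReal.natCast_ne_top _)).lt_top).ne
  refine ⟨D.toReal + 1, by positivity, fun f hf x hx => ?_⟩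
  set v : ℕ → (Fin n → ℝ) → ℝ≥0∞ := fun i z => ∑ J : Fin i → Fin n, ‖pdW (List.ofFn J) f z‖ₑ
    with hv
  have hvm : ∀ i, Measurable (v i) := fun i =>
    Finset.measurable_sum _ fun J _ => (hf.pdW _).continuous.measurable.enorm
  set M : ℕ → ℝ≥0∞ := fun i => (∫⁻ z in box n, v i z ^ p) ^ (1 / p) with hM
  have hpt : ∀ y ∈ cube n, ‖f x‖ₑ ≤ ∑ i ∈ Finset.range (m + 1), v i (x + (1 : ℝ) • y) +
      ∫⁻ t in Set.Ioc (0 : ℝ) 1, ENNReal.ofReal (t ^ m) * v (m + 1) (x + t • y) := by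
    intro y hy
    have h0 : rayDeriv f x y 0 0 = f x := by simp [rayDeriv, pdW]
    rw [← h0]
    refine (enorm_le_sum_add_lintegral (fun i t => hasDerivAt_rayDeriv hf x y i t) m).trans ?_
    refine add_le_add (Finset.sum_le_sum fun i _ => enorm_rayDeriv_le f x y hy i 1)
      (lintegral_mono fun t => mul_le_mul_right (enorm_rayDeriv_le f x y hy (m + 1) t) _)
  have hcomp : Measurable fun z : (Fin n → ℝ) × ℝ => v (m + 1) (x + z.2 • z.1) :=
    (hvm _).comp (by fun_prop)
  have hvc : ∀ i (t : ℝ), Measurable fun y : Fin n → ℝ => v i (x + t • y) := fun i t =>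
    (hvm i).comp (by fun_prop)
  have hav : ‖f x‖ₑ ≤ ∑ i ∈ Finset.range (m + 1), M i +
      (∫⁻ t in Set.Ioc (0 : ℝ) 1, ENNReal.ofReal (t ^ (m - n / p))) * M (m + 1) := by
    calc ‖f x‖ₑ = ∫⁻ _, ‖f x‖ₑ ∂(μT n) := by simp
      _ ≤ ∫⁻ y, (∑ i ∈ Finset.range (m + 1), v i (x + (1 : ℝ) • y) +
          ∫⁻ t in Set.Ioc (0 : ℝ) 1, ENNReal.ofReal (t ^ m) * v (m + 1) (x + t • y)) ∂(μT n) := by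
          rw [μT]
          exact setLIntegral_mono' (measurableSet_cube n) hpt
      _ = ∑ i ∈ Finset.range (m + 1), ∫⁻ y, v i (x + (1 : ℝ) • y) ∂(μT n) +
          ∫⁻ t in Set.Ioc (0 : ℝ) 1,
            ENNReal.ofReal (t ^ m) * ∫⁻ y, v (m + 1) (x + t • y) ∂(μT n) := by
          rw [lintegral_add_left (Finset.measurable_sum _ fun i _ => hvc i 1),
            lintegral_finsetSum _ fun i _ => hvc i 1, lintegral_lintegral_swap]
          · congr 1
            refine lintegral_congr fun t => ?_
            rw [lintegral_const_mul _ (hvc _ t)]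
          · exact ((by fun_prop : Measurable fun z : (Fin n → ℝ) × ℝ =>
              ENNReal.ofReal (z.2 ^ m)).mul hcomp).aemeasurable
      _ ≤ _ := by
          refine add_le_add (Finset.sum_le_sum fun i _ => ?_) ?_
          · simpa [hM] using lintegral_comp_ray_le_rpow (hvm i) hp hx one_pos le_rfl
          · rw [← lintegral_mul_const _ (by fun_prop)]
            refine setLIntegral_mono' measurableSet_Ioc fun t ht => ?_
            refine (mul_le_mul_right (lintegral_comp_ray_le_rpow (hvm (m + 1)) hp hx ht.1 ht.2)
              _).trans (le_of_eq ?_)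
            rw [← mul_assoc, ← ENNReal.ofReal_mul (by have := ht.1; positivity), sub_eq_add_neg,
              Real.rpow_add ht.1, Real.rpow_natCast]
  have hav2 : ‖f x‖ₑ ≤ K * ∑ i ∈ Finset.range (m + 2), M i := by
    refine hav.trans ?_
    rw [Finset.sum_range_succ _ (m + 1), mul_add]
    refine add_le_add ?_ (mul_le_mul_left (le_add_left le_rfl) _)
    exact le_mul_of_one_le_left' (le_add_right le_rfl)
  have hMp : ∀ i ∈ Finset.range (m + 2), M i ^ p ≤
      (∑ i ∈ Finset.range (m + 2), ((n ^ i : ℕ) : ℝ≥0∞) ^ (p - 1)) *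
        ∑ J : Fin i → Fin n, ∫⁻ z in box n, ‖pdW (List.ofFn J) f z‖ₑ ^ p := by
    intro i hi
    simp only [hM]
    rw [← ENNReal.rpow_mul, one_div_mul_cancel hp0.ne', ENNReal.rpow_one]
    calc ∫⁻ z in box n, v i z ^ p ≤ ∫⁻ z in box n, ((n ^ i : ℕ) : ℝ≥0∞) ^ (p - 1) *
          ∑ J : Fin i → Fin n, ‖pdW (List.ofFn J) f z‖ₑ ^ p := by
          refine lintegral_mono fun z => ?_
          have h := ENNReal.rpow_sum_le_const_mul_sum_rpow Finset.univ
            (fun J : Fin i → Fin n => ‖pdW (List.ofFn J) f z‖ₑ) hp.le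
          simpa using h
      _ = ((n ^ i : ℕ) : ℝ≥0∞) ^ (p - 1) *
          ∑ J : Fin i → Fin n, ∫⁻ z in box n, ‖pdW (List.ofFn J) f z‖ₑ ^ p := by
          have hmJ : ∀ J : Fin i → Fin n, Measurable fun z => ‖pdW (List.ofFn J) f z‖ₑ ^ p :=
            fun J => (hf.pdW _).continuous.measurable.enorm.pow_const p
          rw [lintegral_const_mul _ (Finset.measurable_sum _ fun J _ => hmJ J),
            lintegral_finsetSum _ fun J _ => hmJ J]
      _ ≤ _ := mul_le_mul_left
          (Finset.single_le_sum (f := fun i => ((n ^ i : ℕ) : ℝ≥0∞) ^ (p - 1))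
            (fun _ _ => zero_le) hi) _
  calc ‖f x‖ₑ ^ p ≤ (K * ∑ i ∈ Finset.range (m + 2), M i) ^ p := ENNReal.rpow_le_rpow hav2 hp0.le
    _ ≤ K ^ p * (((m + 2 : ℕ) : ℝ≥0∞) ^ (p - 1) * ∑ i ∈ Finset.range (m + 2), M i ^ p) := by
        rw [ENNReal.mul_rpow_of_nonneg _ _ hp0.le]
        refine mul_le_mul_right ?_ _
        simpa using ENNReal.rpow_sum_le_const_mul_sum_rpow (Finset.range (m + 2)) M hp.le
    _ ≤ D * ∑ i ∈ Finset.range (m + 2), ∑ J : Fin i → Fin n,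
        ∫⁻ z in box n, ‖pdW (List.ofFn J) f z‖ₑ ^ p := by
        rw [hD, mul_assoc, mul_assoc,
          Finset.mul_sum (Finset.range (m + 2)) _ (∑ i ∈ Finset.range (m + 2), _)]
        exact mul_le_mul_right (mul_le_mul_right (Finset.sum_le_sum hMp) _) _
    _ ≤ _ := by
        refine mul_le_mul_left ?_ _
        rw [ENNReal.ofReal_add (by positivity) zero_le_one, ENNReal.ofReal_toReal hDfin]
        exact le_add_right le_rfl

/-! ### Derivatives and differences of symbols -/

theorem differentiable_of_smooth {n : ℕ} {f : (Fin n → ℝ) → ℂ} (hf : ContDiff ℝ (⊤ : ℕ∞) f) :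
    Differentiable ℝ f := hf.differentiable (by simp)

theorem pdW_cons {n : ℕ} (j : Fin n) (L : List (Fin n)) (f : (Fin n → ℝ) → ℂ) :
    pdW (j :: L) f = pd j (pdW L f) := rfl

theorem pdW_sub {n : ℕ} (L : List (Fin n)) {f g : (Fin n → ℝ) → ℂ}
    (hf : ContDiff ℝ (⊤ : ℕ∞) f) (hg : ContDiff ℝ (⊤ : ℕ∞) g) :
    pdW L (fun z => f z - g z) = fun z => pdW L f z - pdW L g z := by
  induction L with
  | nil => rfl
  | cons j L ih =>
    ext z
    rw [pdW_cons, ih, pd, fderiv_fun_sub (differentiable_of_smooth (hf.pdW L) z)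
      (differentiable_of_smooth (hg.pdW L) z)]
    rfl

theorem pdW_mul_const {n : ℕ} (L : List (Fin n)) {f : (Fin n → ℝ) → ℂ}
    (hf : ContDiff ℝ (⊤ : ℕ∞) f) (c : ℂ) :
    pdW L (fun z => f z * c) = fun z => pdW L f z * c := by
  induction L with
  | nil => rfl
  | cons j L ih =>
    ext z
    rw [pdW_cons, ih, pd, fderiv_mul_const (differentiable_of_smooth (hf.pdW L) z)]
    simp [pdW_cons, pd, mul_comm]

theorem pdW_sum {n : ℕ} {ι : Type*} (L : List (Fin n)) (S : Finset ι) {f : ι → (Fin n → ℝ) → ℂ}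
    (hf : ∀ i ∈ S, ContDiff ℝ (⊤ : ℕ∞) (f i)) :
    pdW L (fun z => ∑ i ∈ S, f i z) = fun z => ∑ i ∈ S, pdW L (f i) z := by
  induction L with
  | nil => rfl
  | cons j L ih =>
    ext z
    rw [pdW_cons, ih, pd, fderiv_fun_sum fun i hi => differentiable_of_smooth ((hf i hi).pdW L) z]
    simp [pdW_cons, pd]

theorem pd_comm {n : ℕ} (i j : Fin n) {f : (Fin n → ℝ) → ℂ} (hf : ContDiff ℝ (⊤ : ℕ∞) f) :
    pd i (pd j f) = pd j (pd i f) := by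
  have key : ∀ (i j : Fin n) x, pd i (pd j f) x =
      fderiv ℝ (fderiv ℝ f) x (Pi.single i 1) (Pi.single j 1) := fun i j x => by
    have hd : DifferentiableAt ℝ (fderiv ℝ f) x :=
      ((hf.fderiv_right (m := (⊤ : ℕ∞)) le_rfl).differentiable (by simp)) x
    change fderiv ℝ (fun y => fderiv ℝ f y (Pi.single j 1)) x (Pi.single i 1) = _
    rw [fderiv_clm_apply hd (differentiableAt_const _)]
    simp
  ext x
  rw [key, key]
  exact hf.contDiffAt.isSymmSndFDerivAt (by
    rw [minSmoothness_of_isRCLikeNormedField]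
    exact WithTop.coe_le_coe.2 (le_top (a := (2 : ℕ∞)))) _ _

theorem pdW_perm {n : ℕ} {L L' : List (Fin n)} (h : L.Perm L') {f : (Fin n → ℝ) → ℂ}
    (hf : ContDiff ℝ (⊤ : ℕ∞) f) : pdW L f = pdW L' f := by
  induction h with
  | nil => rfl
  | cons j _ ih => rw [pdW_cons, pdW_cons, ih]
  | swap i j L => simp only [pdW_cons]; exact pd_comm _ _ (hf.pdW L)
  | trans _ _ h1 h2 => exact h1.trans h2

theorem mIdxList_perm_iff {n : ℕ} (β : Fin n → ℕ) (L : List (Fin n)) :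
    (mIdxList β).Perm L ↔ ∀ j, L.count j = β j := by
  have hc : ∀ j, (mIdxList β).count j = β j := fun j => by
    rw [mIdxList, List.count_flatMap, ← Fin.sum_univ_def]
    simp [List.count_replicate]
  rw [List.perm_iff_count]
  exact forall_congr' fun j => by rw [hc, eq_comm]

theorem pdM_count {n : ℕ} (L : List (Fin n)) {f : (Fin n → ℝ) → ℂ}
    (hf : ContDiff ℝ (⊤ : ℕ∞) f) : pdM (fun j => L.count j) f = pdW L f :=
  pdW_perm ((mIdxList_perm_iff _ L).2 fun _ => rfl) hf

theorem sum_count {n : ℕ} (L : List (Fin n)) : ∑ j, L.count j = L.length := by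
  have := Multiset.sum_count_eq_card (s := Finset.univ) (m := (L : Multiset (Fin n))) (by simp)
  simpa using this

theorem ddM_single {n : ℕ} (l : Fin n) (i : ℕ) (u : (Fin n → ℤ) → ℂ) :
    ddM (Pi.single l i) u = (dd l)^[i] u := by
  have h : mIdxList (Pi.single l i) = List.replicate i l := by
    rw [← List.perm_replicate, mIdxList_perm_iff]
    intro j
    rcases eq_or_ne l j with rfl | h
    · simp
    · simp [List.count_replicate, h, h.symm]
  rw [ddM, h]
  clear h
  induction i with
  | zero => rfl
  | succ i ih => rw [List.replicate_succ, List.foldr_cons, ih, Function.iterate_succ_apply']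

theorem contDiff_dd_iterate {n : ℕ} {σ : (Fin n → ℝ) → (Fin n → ℤ) → ℂ}
    (hσ : ∀ ξ, ContDiff ℝ (⊤ : ℕ∞) fun x => σ x ξ) (l : Fin n) (i : ℕ) (ξ : Fin n → ℤ) :
    ContDiff ℝ (⊤ : ℕ∞) fun x => (dd l)^[i] (σ x) ξ := by
  induction i generalizing ξ with
  | zero => exact hσ ξ
  | succ i ih =>
    simp only [Function.iterate_succ_apply', dd]
    exact (ih _).sub (ih _)

theorem dd_iterate_pdW {n : ℕ} {σ : (Fin n → ℝ) → (Fin n → ℤ) → ℂ}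
    (hσ : ∀ ξ, ContDiff ℝ (⊤ : ℕ∞) fun x => σ x ξ) (L : List (Fin n)) (z : Fin n → ℝ) (l : Fin n)
    (i : ℕ) (ξ : Fin n → ℤ) : (dd l)^[i] (fun ξ => pdW L (fun x => σ x ξ) z) ξ =
      pdW L (fun x => (dd l)^[i] (σ x) ξ) z := by
  induction i generalizing ξ with
  | zero => rfl
  | succ i ih =>
    simp only [Function.iterate_succ_apply', dd]
    rw [pdW_sub L (contDiff_dd_iterate hσ l i _) (contDiff_dd_iterate hσ l i _), ih, ih]

theorem symCl_pdW {n N s : ℕ} {ρ μ C : ℝ} {σ : (Fin n → ℝ) → (Fin n → ℤ) → ℂ}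
    (hσs : ∀ ξ, ContDiff ℝ (⊤ : ℕ∞) fun x => σ x ξ)
    (hσ : ∀ (α β : Fin n → ℕ), (∑ j, α j) ≤ s → (∑ j, β j) ≤ N →
      ∀ (x : Fin n → ℝ) (ξ : Fin n → ℤ),
        ‖symbDxD β α σ x ξ‖ ≤ C * jb ξ ^ (μ - ρ * ∑ j, (α j : ℝ)))
    {L : List (Fin n)} (hL : L.length ≤ N) (z : Fin n → ℝ) :
    SymCl s ρ μ C fun ξ => pdW L (fun x => σ x ξ) z := by
  intro l i hi ξ
  rw [dd_iterate_pdW hσs, ← pdM_count L (contDiff_dd_iterate hσs l i ξ)]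
  have h := hσ (Pi.single l i) (fun j => L.count j) (by simpa using hi)
    (by rwa [sum_count]) z ξ
  simp only [symbDxD, ddM_single] at h
  have h2 : ∑ j, ((Pi.single l i : Fin n → ℕ) j : ℝ) = i := by
    rw [← Nat.cast_sum, Finset.sum_pi_single']
    simp
  rwa [h2] at h

/-! ### Pseudo-differential operators on trigonometric polynomials -/

theorem exists_lintegral_op_trig_le (n : ℕ) (hn : 1 ≤ n) {ρ p C : ℝ} (hρ0 : 0 < ρ)
    (hρ1 : ρ ≤ 1) (hp : 1 < p) (hC : 0 < C) (σ : (Fin n → ℝ) → (Fin n → ℤ) → ℂ)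
    (hσs : ∀ ξ, ContDiff ℝ (⊤ : ℕ∞) fun x => σ x ξ)
    (hσ : ∀ L : List (Fin n), L.length ≤ ⌊(n : ℝ) / p⌋₊ + 1 → ∀ z,
      SymCl (n / 2 + 1) ρ (-(n * (1 - ρ) * |1 / p - 1 / 2|)) C fun ξ => pdW L (fun x => σ x ξ) z) :
    ∃ C' : ℝ, 0 < C' ∧ ∀ c : (Fin n → ℤ) → ℂ, c.support.Finite →
      ∫⁻ x, ‖trig (fun ξ => σ x ξ * c ξ) x‖ₑ ^ p ∂(μT n) ≤
        ENNReal.ofReal C' * ∫⁻ x, ‖trig c x‖ₑ ^ p ∂(μT n) := by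
  have := isProbabilityMeasure_μT n
  obtain ⟨C₁, hC₁, h₁⟩ := exists_lintegral_trig_mul_le n hn hρ0 hρ1 hp hC
  obtain ⟨C₂, hC₂, h₂⟩ := exists_enorm_le_sum_box n ⌊(n : ℝ) / p⌋₊ hp (Nat.lt_floor_add_one _)
  set m := ⌊(n : ℝ) / p⌋₊ with hm
  set D : ℝ≥0∞ := ENNReal.ofReal C₂ * ((∑ i ∈ Finset.range (m + 2), (n ^ i : ℕ) : ℕ) *
    (ENNReal.ofReal C₁ * volume (box n))) with hD
  have hvol : volume (box n) ≠ ∞ := by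
    rw [box, volume_pi_pi]
    exact (ENNReal.prod_lt_top fun i _ => by simp).ne
  have hDfin : D ≠ ∞ :=
    ENNReal.mul_ne_top ENNReal.ofReal_ne_top (ENNReal.mul_ne_top (ENNReal.natCast_ne_top _)
      (ENNReal.mul_ne_top ENNReal.ofReal_ne_top hvol))
  refine ⟨D.toReal + 1, by positivity, fun c hc => ?_⟩
  set S := hc.toFinset with hS
  have hS0 : ∀ (u : (Fin n → ℤ) → ℂ), ∀ ξ ∉ S, u ξ * c ξ = 0 := fun u ξ hξ => by
    rw [eq_zero_of_notMem_toFinset hc ξ hξ, mul_zero]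
  set V := ∫⁻ x, ‖trig c x‖ₑ ^ p ∂(μT n) with hV
  have hW : ∀ L : List (Fin n), ∀ x z, pdW L (fun z => trig (fun ξ => σ z ξ * c ξ) x) z =
      trig (fun ξ => pdW L (fun x => σ x ξ) z * c ξ) x := fun L x z => by
    simp only [trig_eq_sum (hS0 _)]
    rw [pdW_sum]
    · refine Finset.sum_congr rfl fun ξ _ => ?_
      simp only [mul_assoc]
      rw [pdW_mul_const L (hσs ξ)]
    · intro ξ _
      exact ((hσs ξ).mul contDiff_const).mul contDiff_const
  have hHs : ∀ x, ContDiff ℝ (⊤ : ℕ∞) fun z => trig (fun ξ => σ z ξ * c ξ) x := fun x => by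
    simp only [trig_eq_sum (hS0 _)]
    exact ContDiff.sum fun ξ _ => ((hσs ξ).mul contDiff_const).mul contDiff_const
  have hmeas : ∀ L : List (Fin n), Measurable fun w : (Fin n → ℝ) × (Fin n → ℝ) =>
      ‖trig (fun ξ => pdW L (fun x => σ x ξ) w.2 * c ξ) w.1‖ₑ ^ p := fun L => by
    simp only [trig_eq_sum (hS0 _)]
    refine (Continuous.measurable ?_).enorm.pow_const p
    refine continuous_finsetSum _ fun ξ _ => ?_
    exact ((((hσs ξ).pdW L).continuous.comp continuous_snd).mul continuous_const).mul
      ((continuous_eChar ξ).comp continuous_fst)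
  calc ∫⁻ x, ‖trig (fun ξ => σ x ξ * c ξ) x‖ₑ ^ p ∂(μT n)
      ≤ ∫⁻ x, (ENNReal.ofReal C₂ * ∑ i ∈ Finset.range (m + 2), ∑ J : Fin i → Fin n,
        ∫⁻ z in box n, ‖trig (fun ξ => pdW (List.ofFn J) (fun x => σ x ξ) z * c ξ) x‖ₑ ^ p)
          ∂(μT n) := by
        rw [μT]
        refine setLIntegral_mono' (measurableSet_cube n) fun x hx => ?_
        have h := h₂ _ (hHs x) x hx
        simpa only [hW] using h
    _ = ENNReal.ofReal C₂ * ∑ i ∈ Finset.range (m + 2), ∑ J : Fin i → Fin n,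
        ∫⁻ z in box n, ∫⁻ x,
          ‖trig (fun ξ => pdW (List.ofFn J) (fun x => σ x ξ) z * c ξ) x‖ₑ ^ p ∂(μT n) := by
        have hm1 : ∀ i, ∀ J : Fin i → Fin n, Measurable fun x => ∫⁻ z in box n,
            ‖trig (fun ξ => pdW (List.ofFn J) (fun x => σ x ξ) z * c ξ) x‖ₑ ^ p :=
          fun i J => (hmeas (List.ofFn J)).lintegral_prod_right'
        rw [lintegral_const_mul _ (Finset.measurable_sum _ fun i _ =>
            Finset.measurable_sum _ fun J _ => hm1 i J),
          lintegral_finsetSum _ fun i _ => Finset.measurable_sum _ fun J _ => hm1 i J]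
        congr 1
        refine Finset.sum_congr rfl fun i _ => ?_
        rw [lintegral_finsetSum _ fun J _ => hm1 i J]
        refine Finset.sum_congr rfl fun J _ => ?_
        exact lintegral_lintegral_swap (hmeas (List.ofFn J)).aemeasurable
    _ ≤ ENNReal.ofReal C₂ * ∑ i ∈ Finset.range (m + 2), ∑ J : Fin i → Fin n,
        ∫⁻ z in box n, ENNReal.ofReal C₁ * V := by
        refine mul_le_mul_right (Finset.sum_le_sum fun i hi => Finset.sum_le_sum fun J _ =>
          lintegral_mono fun z => h₁ _ (hσ _ ?_ z) c hc) _
        rw [List.length_ofFn]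
        have := Finset.mem_range.1 hi
        omega
    _ = D * V := by
        simp only [setLIntegral_const, Finset.sum_const, Finset.card_univ, Fintype.card_pi,
          Fintype.card_fin, Finset.prod_const, nsmul_eq_mul, ← Finset.sum_mul, hD]
        push_cast
        ring
    _ ≤ _ := by
        refine mul_le_mul_left ?_ _
        rw [ENNReal.ofReal_add (by positivity) zero_le_one, ENNReal.ofReal_toReal hDfin]
        exact le_add_right le_rfl

/-! ### Fourier series of smooth periodic functions -/

theorem Per.bddMeas {n : ℕ} {f : (Fin n → ℝ) → ℂ} (hf : Per f) (hc : Continuous f) :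
    BddMeas f := by
  refine ⟨hc.measurable, ?_⟩
  obtain ⟨M, hM⟩ := (isCompact_Icc (a := (0 : Fin n → ℝ)) (b := 1)).exists_bound_of_continuousOn
    hc.continuousOn
  refine ⟨M, fun x => ?_⟩
  have h := hf (fun j => Int.fract (x j)) fun j => ⌊x j⌋
  have hx : ((fun j => Int.fract (x j)) + fun j => (⌊x j⌋ : ℝ)) = x := by
    ext j
    simp
  rw [hx] at h
  rw [h]
  exact hM _ ⟨fun j => Int.fract_nonneg _, fun j => (Int.fract_lt_one _).le⟩

theorem Per.pd {n : ℕ} {f : (Fin n → ℝ) → ℂ} (hf : Per f) (j : Fin n) : Per (_root_.pd j f) := by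
  intro x v
  unfold _root_.pd
  rw [← fderiv_comp_add_right]
  congr 2
  ext y
  exact hf y v

theorem Per.mul {n : ℕ} {f g : (Fin n → ℝ) → ℂ} (hf : Per f) (hg : Per g) :
    Per fun x => f x * g x := fun x v => by
  simp only [hf x v, hg x v]

theorem per_eChar {n : ℕ} (ξ : Fin n → ℤ) : Per fun x => eChar x ξ := by
  intro x v
  simp only [eChar]
  refine Complex.exp_eq_exp_iff_exists_int.2 ⟨∑ j, v j * ξ j, ?_⟩
  push_cast
  simp only [Pi.add_apply, Complex.ofReal_add, Complex.ofReal_intCast, add_mul,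
    Finset.sum_add_distrib]
  ring

theorem hasDerivAt_line {n : ℕ} {f : (Fin n → ℝ) → ℂ} (hf : ContDiff ℝ (⊤ : ℕ∞) f) (j : Fin n)
    (x : Fin n → ℝ) (s : ℝ) :
    HasDerivAt (fun s : ℝ => f (x + s • Pi.single j 1)) (pd j f (x + s • Pi.single j 1)) s := by
  have h := (differentiable_of_smooth hf (x + s • Pi.single j 1)).hasFDerivAt
  have h2 : HasDerivAt (fun s : ℝ => x + s • (Pi.single j 1 : Fin n → ℝ)) (Pi.single j 1) s := by
    simpa using ((hasDerivAt_id s).smul_const (Pi.single j 1 : Fin n → ℝ)).const_add x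
  exact h.comp_hasDerivAt s h2

theorem integral_pd_eq_zero {n : ℕ} {f : (Fin n → ℝ) → ℂ} (hf : ContDiff ℝ (⊤ : ℕ∞) f)
    (hper : Per f) (j : Fin n) : ∫ x, pd j f x ∂(μT n) = 0 := by
  obtain _ | m := n
  · exact j.elim0
  have hmp := measurePreserving_piFinSuccAbove
    (fun _ : Fin (m + 1) => (volume : Measure ℝ).restrict (Set.Ico 0 1)) j
  set e := MeasurableEquiv.piFinSuccAbove (fun _ : Fin (m + 1) => ℝ) j
  have hint := ((hper.pd j).bddMeas (hf.pd j).continuous).integrable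
  rw [μT_eq_pi] at hint ⊢
  have h1 := hmp.integral_comp' fun z => pd j f (e.symm z)
  have h2 := (hmp.integrable_comp_emb e.measurableEmbedding (g := fun z => pd j f (e.symm z))).1
    (by simpa [Function.comp_def] using hint)
  simp only [MeasurableEquiv.symm_apply_apply] at h1
  rw [h1, integral_prod_symm _ h2]
  refine integral_eq_zero_of_ae (.of_forall fun y => ?_)
  have hline : ∀ s : ℝ, e.symm (s, y) = e.symm (0, y) + s • Pi.single j 1 := fun s => by
    change j.insertNth s y = j.insertNth 0 y + s • Pi.single j 1
    ext i
    refine j.succAboveCases ?_ (fun i => ?_) i <;> simp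
  have hfun : (fun s => pd j f (e.symm (s, y))) =
      fun s : ℝ => pd j f (e.symm (0, y) + s • Pi.single j 1) := funext fun s => by rw [hline]
  simp only [Pi.zero_apply]
  rw [hfun, integral_Ico_eq_integral_Ioc, ← intervalIntegral.integral_of_le zero_le_one,
    intervalIntegral.integral_eq_sub_of_hasDerivAt
      (fun s _ => hasDerivAt_line hf j (e.symm (0, y)) s)]
  · have h := hper (e.symm (0, y)) (Pi.single j 1)
    rw [sub_eq_zero, zero_smul, add_zero, one_smul, ← h]
    congr 2
    ext i
    rcases eq_or_ne i j with rfl | hij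
    · simp
    · simp [hij]
  · have := (hf.pd j).continuous
    exact Continuous.intervalIntegrable (by fun_prop) _ _

theorem pd_eChar {n : ℕ} (ξ : Fin n → ℤ) (j : Fin n) (x : Fin n → ℝ) :
    pd j (fun x => eChar x ξ) x = 2 * π * Complex.I * ξ j * eChar x ξ := by
  have h1 := hasDerivAt_line (contDiff_eChar ξ) j x 0
  have h2 := hasFDerivAt_eChar ξ x (Pi.single j 1) 0
  have h := h1.unique h2
  rw [zero_smul, add_zero] at h
  rw [h, Finset.sum_eq_single j (fun l _ hl => by simp [hl]) (by simp)]
  simp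

theorem fc_pd {n : ℕ} {f : (Fin n → ℝ) → ℂ} (hf : ContDiff ℝ (⊤ : ℕ∞) f) (hper : Per f)
    (j : Fin n) (ξ : Fin n → ℤ) : fc (pd j f) ξ = 2 * π * Complex.I * ξ j * fc f ξ := by
  have hprod : ∀ x, pd j (fun x => eChar x (-ξ) * f x) x =
      eChar x (-ξ) * pd j f x - 2 * π * Complex.I * ξ j * (eChar x (-ξ) * f x) := fun x => by
    have h := pd_eChar (-ξ) j x
    unfold pd at h ⊢
    rw [fderiv_fun_mul (differentiable_of_smooth (contDiff_eChar _) x)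
      (differentiable_of_smooth hf x)]
    simp only [add_apply, smul_apply, smul_eq_mul, h,
      Pi.neg_apply, Int.cast_neg]
    ring
  have h0 := integral_pd_eq_zero ((contDiff_eChar (-ξ)).mul hf) ((per_eChar (-ξ)).mul hper) j
  simp only [hprod] at h0
  have hb := BddMeas.eChar (n := n) (-ξ)
  rw [integral_sub (hb.mul ((hper.pd j).bddMeas (hf.pd j).continuous)).integrable
    ((hb.mul (hper.bddMeas hf.continuous)).integrable.const_mul _), integral_const_mul,
    sub_eq_zero] at h0
  simpa only [fc_eq, conj_eChar] using h0

theorem exists_abs_pow_mul_norm_fc_le {n : ℕ} (j : Fin n) (k : ℕ) {f : (Fin n → ℝ) → ℂ}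
    (hf : ContDiff ℝ (⊤ : ℕ∞) f) (hper : Per f) :
    ∃ M : ℝ, ∀ ξ, |(ξ j : ℝ)| ^ k * ‖fc f ξ‖ ≤ M := by
  induction k generalizing f with
  | zero =>
    obtain ⟨M, hM⟩ := (hper.bddMeas hf.continuous).bdd
    have := isProbabilityMeasure_μT n
    refine ⟨M, fun ξ => ?_⟩
    rw [pow_zero, one_mul, fc_eq]
    refine (norm_integral_le_of_norm_le_const (C := M) (.of_forall fun x => ?_)).trans (by simp)
    simpa [norm_eChar] using hM x
  | succ k ih =>
    obtain ⟨M, hM⟩ := ih (hf.pd j) (hper.pd j)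
    refine ⟨M, fun ξ => le_trans ?_ (hM ξ)⟩
    rw [fc_pd hf hper, pow_succ, mul_assoc, norm_mul _ (fc f ξ)]
    have h : |(ξ j : ℝ)| ≤ ‖2 * (π : ℂ) * Complex.I * (ξ j : ℂ)‖ := by
      simp only [norm_mul, Complex.norm_I, Complex.norm_ofNat, Complex.norm_real, mul_one,
        Complex.norm_intCast, Real.norm_eq_abs, abs_of_pos pi_pos]
      nlinarith [abs_nonneg (ξ j : ℝ), pi_gt_three]
    gcongr

theorem exists_lattice_castZ_mem (n : ℕ) : ∃ L : Submodule ℤ (Fin n → ℝ), DiscreteTopology L ∧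
    Module.finrank ℤ L = n ∧ ∀ ξ : Fin n → ℤ, castZ ξ ∈ L := by
  have hd := ZSpan.discreteTopology_pi_basisFun (ι := Fin n)
  refine ⟨Submodule.span ℤ (Set.range (Pi.basisFun ℝ (Fin n))), hd, ?_, fun ξ =>
    ((Pi.basisFun ℝ (Fin n)).mem_span_iff_repr_mem ℤ _).2 fun i => ⟨ξ i, by simp [castZ]⟩⟩
  exact (Module.finrank_eq_card_basis ((Pi.basisFun ℝ (Fin n)).restrictScalars ℤ)).trans
    (Fintype.card_fin n)

theorem summable_norm_castZ (n k : ℕ) (hk : n < k) :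
    Summable fun ξ : Fin n → ℤ => ‖castZ ξ‖⁻¹ ^ k := by
  obtain ⟨L, hd, hrank, hmem⟩ := exists_lattice_castZ_mem n
  have h : Summable fun z : L => ‖(z : Fin n → ℝ)‖⁻¹ ^ k := by
    simpa only [Submodule.coe_norm] using
      ZLattice.summable_norm_pow_inv L k (by rw [hrank]; exact hk)
  have hinj : Function.Injective fun ξ : Fin n → ℤ => (⟨castZ ξ, hmem ξ⟩ : L) := fun ξ η h => by
    ext j
    have := congrFun (Subtype.ext_iff.1 h) j
    simpa [castZ] using this
  have hs := h.comp_injective hinj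
  simpa only [Function.comp_def] using hs

theorem summable_norm_fc {n : ℕ} {f : (Fin n → ℝ) → ℂ} (hf : ContDiff ℝ (⊤ : ℕ∞) f)
    (hper : Per f) : Summable fun ξ => ‖fc f ξ‖ := by
  choose M hM using fun j : Fin n => exists_abs_pow_mul_norm_fc_le j (n + 1) hf hper
  have hM0 : ∀ j, 0 ≤ M j := fun j => le_trans (by positivity) (hM j 0)
  refine Summable.of_norm_bounded_eventually
    ((summable_norm_castZ n (n + 1) n.lt_succ_self).mul_left (∑ j, M j)) ?_
  rw [Filter.eventually_cofinite]
  refine (Set.finite_singleton 0).subset fun ξ hξ => ?_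
  by_contra hne
  refine hξ ?_
  have hne' : ∃ j, ξ j ≠ 0 := by
    by_contra! h
    exact hne (funext h)
  obtain ⟨j0, hj0⟩ := hne'
  have : Nonempty (Fin n) := ⟨j0⟩
  obtain ⟨j, hj⟩ := Finite.exists_max fun j => ‖castZ ξ j‖
  have hnorm : ‖castZ ξ‖ = |(ξ j : ℝ)| :=
    le_antisymm ((pi_norm_le_iff_of_nonneg (abs_nonneg _)).2 hj) (norm_le_pi_norm (castZ ξ) j)
  have hpos : 0 < |(ξ j : ℝ)| := lt_of_lt_of_le (by simpa [castZ] using hj0) (hj j0)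
  rw [hnorm, norm_norm, inv_pow, ← div_eq_mul_inv, le_div_iff₀ (by positivity), mul_comm]
  exact (hM j ξ).trans (Finset.single_le_sum (fun i _ => hM0 i) (Finset.mem_univ j))

theorem mFourier_coe {n : ℕ} (ξ : Fin n → ℤ) (x : Fin n → ℝ) :
    UnitAddTorus.mFourier ξ (fun j => (x j : UnitAddCircle)) = eChar x ξ := by
  rw [eChar_eq_prod]
  simp only [UnitAddTorus.mFourier, ContinuousMap.coe_mk]
  refine Finset.prod_congr rfl fun j _ => ?_
  rw [fourier_coe_apply]
  congr 1
  push_cast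
  ring

theorem cube_ae_eq (n : ℕ) :
    {x : Fin n → ℝ | ∀ i, x i ∈ Set.Ioc ((0 : Fin n → ℝ) i) ((0 : Fin n → ℝ) i + 1)} =ᵐ[volume]
      cube n := by
  have h1 : {x : Fin n → ℝ | ∀ i, x i ∈ Set.Ioc ((0 : Fin n → ℝ) i) ((0 : Fin n → ℝ) i + 1)} =
      Set.univ.pi fun _ => Set.Ioc (0 : ℝ) 1 := by
    ext x
    simp
  rw [h1, cube]
  exact (Measure.univ_pi_Ioc_ae_eq_Icc (μ := fun _ : Fin n => (volume : Measure ℝ))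
    (f := fun _ => 0) (g := fun _ => 1)).trans
    (Measure.univ_pi_Ico_ae_eq_Icc (μ := fun _ : Fin n => (volume : Measure ℝ))
    (f := fun _ => 0) (g := fun _ => 1)).symm

theorem hasSum_fc_mul_eChar {n : ℕ} {f : (Fin n → ℝ) → ℂ} (hf : ContDiff ℝ (⊤ : ℕ∞) f)
    (hper : Per f) (x : Fin n → ℝ) : HasSum (fun ξ => fc f ξ * eChar x ξ) (f x) := by
  set q : (Fin n → ℝ) → UnitAddTorus (Fin n) := fun x j => (x j : UnitAddCircle)
  have hq : IsOpenQuotientMap q :=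
    IsOpenQuotientMap.piMap fun _ : Fin n => QuotientAddGroup.isOpenQuotientMap_mk
  set F : UnitAddTorus (Fin n) → ℂ := fun u => f (Function.surjInv hq.surjective u)
  have hF : ∀ x, F (q x) = f x := fun x => by
    have h1 := Function.surjInv_eq hq.surjective (q x)
    have h2 : ∀ j, ∃ k : ℤ, Function.surjInv hq.surjective (q x) j = x j + k := fun j => by
      have h3 := (QuotientAddGroup.eq_iff_sub_mem.1 (congrFun h1 j))
      obtain ⟨k, hk⟩ := AddSubgroup.mem_zmultiples_iff.1 h3
      refine ⟨k, ?_⟩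
      simp only [zsmul_eq_mul, mul_one] at hk
      linarith
    choose k hk using h2
    have h4 : Function.surjInv hq.surjective (q x) = x + fun j => (k j : ℝ) := funext hk
    simp only [F, h4]
    exact hper x k
  have hFc : Continuous F := by
    rw [hq.isQuotientMap.continuous_iff]
    exact hf.continuous.congr fun x => (hF x).symm
  have hcoeff : ∀ ξ, UnitAddTorus.mFourierCoeff F ξ = fc f ξ := fun ξ => by
    rw [UnitAddTorus.mFourierCoeff_eq_integral F ξ 0, setIntegral_congr_set (cube_ae_eq n), fc_eq]
    refine integral_congr_ae (.of_forall fun y => ?_)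
    have h1 : F (fun j => (y j : UnitAddCircle)) = f y := hF y
    simp only [mFourier_coe, h1, smul_eq_mul, conj_eChar]
  have hs : Summable (UnitAddTorus.mFourierCoeff F) := by
    rw [funext hcoeff]
    exact (summable_norm_fc hf hper).of_norm
  have h := UnitAddTorus.hasSum_mFourier_series_apply_of_summable (f := ⟨F, hFc⟩) hs (q x)
  have h5 : ∀ ξ, UnitAddTorus.mFourier ξ (q x) = eChar x ξ := fun ξ => mFourier_coe ξ x
  simpa only [ContinuousMap.coe_mk, hcoeff, h5, hF, smul_eq_mul] using h

/-! ### Passage from trigonometric polynomials to smooth functions -/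

theorem tendsto_lintegral_trig_indicator {n : ℕ} {b : (Fin n → ℝ) → (Fin n → ℤ) → ℂ}
    {u : (Fin n → ℤ) → ℝ} (hb : ∀ ξ, Continuous fun x => b x ξ) (hu : Summable u)
    (hbu : ∀ x ξ, ‖b x ξ‖ ≤ u ξ) {p : ℝ} (hp : 0 ≤ p) :
    Filter.Tendsto
      (fun S : Finset (Fin n → ℤ) => ∫⁻ x, ‖∑ ξ ∈ S, b x ξ * eChar x ξ‖ₑ ^ p ∂(μT n))
      Filter.atTop (nhds (∫⁻ x, ‖∑' ξ, b x ξ * eChar x ξ‖ₑ ^ p ∂(μT n))) := by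
  have := isProbabilityMeasure_μT n
  have hu0 : ∀ ξ, 0 ≤ u ξ := fun ξ => (norm_nonneg _).trans (hbu 0 ξ)
  have hbe : ∀ x ξ, ‖b x ξ * eChar x ξ‖ ≤ u ξ := fun x ξ => by
    rw [norm_mul, norm_eChar, mul_one]
    exact hbu x ξ
  refine tendsto_lintegral_filter_of_dominated_convergence
    (fun _ => ENNReal.ofReal (∑' ξ, u ξ) ^ p) (.of_forall fun S => ?_)
    (.of_forall fun S => .of_forall fun x => ?_) ?_ (.of_forall fun x => ?_)
  · have : Continuous fun x => ∑ ξ ∈ S, b x ξ * eChar x ξ :=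
      continuous_finsetSum _ fun ξ _ => (hb ξ).mul (continuous_eChar ξ)
    exact this.measurable.enorm.pow_const p
  · refine ENNReal.rpow_le_rpow ?_ hp
    rw [← ofReal_norm]
    exact ENNReal.ofReal_le_ofReal ((norm_sum_le _ _).trans
      ((Finset.sum_le_sum fun ξ _ => hbe x ξ).trans (hu.sum_le_tsum S fun ξ _ => hu0 ξ)))
  · rw [lintegral_const, measure_univ, mul_one]
    exact ENNReal.rpow_ne_top_of_nonneg hp ofReal_ne_top
  · exact ((ENNReal.continuous_rpow_const.comp continuous_enorm).tendsto _).comp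
      (hu.of_norm_bounded (hbe x)).hasSum

theorem bddMeas_tsum {n : ℕ} {b : (Fin n → ℝ) → (Fin n → ℤ) → ℂ} {u : (Fin n → ℤ) → ℝ}
    (hb : ∀ ξ, Continuous fun x => b x ξ) (hu : Summable u) (hbu : ∀ x ξ, ‖b x ξ‖ ≤ u ξ) :
    BddMeas fun x => ∑' ξ, b x ξ * eChar x ξ := by
  have hbe : ∀ ξ x, ‖b x ξ * eChar x ξ‖ ≤ u ξ := fun ξ x => by
    rw [norm_mul, norm_eChar, mul_one]
    exact hbu x ξ
  exact ⟨(continuous_tsum (fun ξ => (hb ξ).mul (continuous_eChar ξ)) hu hbe).measurable,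
    ∑' ξ, u ξ, fun x => tsum_of_norm_bounded hu.hasSum fun ξ => hbe ξ x⟩

theorem Op_eq_tsum {n : ℕ} (σ : (Fin n → ℝ) → (Fin n → ℤ) → ℂ) (f : (Fin n → ℝ) → ℂ) :
    Op σ f = fun x => ∑' ξ, (σ x ξ * fc f ξ) * eChar x ξ := by
  ext x
  exact tsum_congr fun ξ => by ring

theorem lintegral_Op_le {n : ℕ} {σ : (Fin n → ℝ) → (Fin n → ℤ) → ℂ} {A p : ℝ} {K : ℝ≥0∞}
    (hσc : ∀ ξ, Continuous fun x => σ x ξ) (hσb : ∀ x ξ, ‖σ x ξ‖ ≤ A) (hp : 0 ≤ p) (hK : K ≠ ∞)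
    (h : ∀ c : (Fin n → ℤ) → ℂ, c.support.Finite →
      ∫⁻ x, ‖trig (fun ξ => σ x ξ * c ξ) x‖ₑ ^ p ∂(μT n) ≤
        K * ∫⁻ x, ‖trig c x‖ₑ ^ p ∂(μT n))
    {f : (Fin n → ℝ) → ℂ} (hf : ContDiff ℝ (⊤ : ℕ∞) f) (hper : Per f) :
    ∫⁻ x, ‖Op σ f x‖ₑ ^ p ∂(μT n) ≤ K * ∫⁻ x, ‖f x‖ₑ ^ p ∂(μT n) := by
  have hs := summable_norm_fc hf hper
  have hσf : ∀ x ξ, ‖σ x ξ * fc f ξ‖ ≤ A * ‖fc f ξ‖ := fun x ξ => by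
    rw [norm_mul]
    gcongr
    exact hσb x ξ
  have h1 := tendsto_lintegral_trig_indicator (b := fun x ξ => σ x ξ * fc f ξ)
    (fun ξ => (hσc ξ).mul continuous_const) (hs.mul_left A) hσf hp
  have h2 := tendsto_lintegral_trig_indicator (b := fun _ ξ => fc f ξ)
    (fun ξ => continuous_const) hs (fun _ ξ => le_rfl) hp
  simp only [(hasSum_fc_mul_eChar hf hper _).tsum_eq] at h2
  rw [Op_eq_tsum]
  refine le_of_tendsto_of_tendsto' h1 (ENNReal.Tendsto.const_mul h2 (.inr hK)) fun S => ?_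
  classical
  set c : (Fin n → ℤ) → ℂ := fun ξ => if ξ ∈ S then fc f ξ else 0
  have hc0 : ∀ ξ ∉ S, c ξ = 0 := fun ξ hξ => if_neg hξ
  have hc : ∀ ξ ∈ S, c ξ = fc f ξ := fun ξ hξ => if_pos hξ
  have hσtrig : ∀ x, trig (fun ξ => σ x ξ * c ξ) x = ∑ ξ ∈ S, σ x ξ * fc f ξ * eChar x ξ :=
      fun x => by
    rw [trig_eq_sum (S := S) fun ξ hξ => by simp only [hc0 ξ hξ, mul_zero]]
    exact Finset.sum_congr rfl fun ξ hξ => by rw [hc ξ hξ]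
  have hfc : ∀ x, trig c x = ∑ ξ ∈ S, fc f ξ * eChar x ξ := fun x => by
    rw [trig_eq_sum hc0]
    exact Finset.sum_congr rfl fun ξ hξ => by rw [hc ξ hξ]
  simpa only [hσtrig, hfc] using h c (S.finite_toSet.subset fun ξ hξ => by
    by_contra hne
    exact hξ (hc0 ξ hne))

theorem lpT_le_of_lintegral_le {n : ℕ} {p K : ℝ} (hp : 0 < p) (hK : 0 ≤ K)
    {g f : (Fin n → ℝ) → ℂ} (hg : BddMeas g) (hf : BddMeas f)
    (h : ∫⁻ x, ‖g x‖ₑ ^ p ∂(μT n) ≤ ENNReal.ofReal K * ∫⁻ x, ‖f x‖ₑ ^ p ∂(μT n)) :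
    lpT n p g ≤ K ^ (1 / p) * lpT n p f := by
  have hf0 : 0 ≤ ∫ x, ‖f x‖ ^ p ∂(μT n) := integral_nonneg fun x => by positivity
  have hg0 : 0 ≤ ∫ x, ‖g x‖ ^ p ∂(μT n) := integral_nonneg fun x => by positivity
  rw [hg.lintegral_norm_rpow hp.le, hf.lintegral_norm_rpow hp.le, ← ENNReal.ofReal_mul hK,
    ENNReal.ofReal_le_ofReal_iff (mul_nonneg hK hf0)] at h
  rw [lpT, lpT, ← Real.mul_rpow hK hf0]
  exact Real.rpow_le_rpow hg0 h (by positivity)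

/-- **Theorem IB.** Let `0 < ρ ≤ 1`, `1 < p < ∞` and `m_p = n(1-ρ)|1/p - 1/2|`.  If
`σ : 𝕋ⁿ × ℤⁿ → ℂ` satisfies `|∂_x^β Δ_ξ^α σ(x,ξ)| ≤ C ⟨ξ⟩^{-m_p - ρ|α|}` for
`|α| ≤ [n/2]+1`, `|β| ≤ [n/p]+1`, then `σ(x,D)` extends to a bounded operator
on `L^p(𝕋ⁿ)`. -/
theorem periodic_pseudodiff_fefferman_Lp_bounded
    (n : ℕ) (hn : 1 ≤ n) (ρ p : ℝ)
    (hρ0 : 0 < ρ) (hρ1 : ρ ≤ 1) (hp1 : 1 < p)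
    (σ : (Fin n → ℝ) → (Fin n → ℤ) → ℂ)
    (hσ_smooth : ∀ ξ, ContDiff ℝ (⊤ : ℕ∞) fun x => σ x ξ)
    (hσ_per : ∀ ξ, Per fun x => σ x ξ)
    (C : ℝ) (hC : 0 < C)
    (hσ : ∀ (α β : Fin n → ℕ), (∑ j, α j) ≤ n / 2 + 1 → (∑ j, β j) ≤ ⌊(n : ℝ) / p⌋₊ + 1 →
      ∀ (x : Fin n → ℝ) (ξ : Fin n → ℤ),
        ‖symbDxD β α σ x ξ‖ ≤
          C * jb ξ ^ (-((n : ℝ) * (1 - ρ) * |1 / p - 1 / 2|) - ρ * ∑ j, (α j : ℝ))) :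
    ∃ C' : ℝ, 0 < C' ∧ ∀ f : (Fin n → ℝ) → ℂ, ContDiff ℝ (⊤ : ℕ∞) f → Per f →
      lpT n p (Op σ f) ≤ C' * lpT n p f := by
  have hσL : ∀ L : List (Fin n), L.length ≤ ⌊(n : ℝ) / p⌋₊ + 1 → ∀ z,
      SymCl (n / 2 + 1) ρ (-(n * (1 - ρ) * |1 / p - 1 / 2|)) C fun ξ => pdW L (fun x => σ x ξ) z :=
    fun L hL z => symCl_pdW hσ_smooth hσ hL z
  have hσb : ∀ x ξ, ‖σ x ξ‖ ≤ C := fun x ξ => by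
    refine ((hσL [] (Nat.zero_le _) x).norm_le hn ξ).trans (mul_le_of_le_one_right hC.le ?_)
    refine Real.rpow_le_one_of_one_le_of_nonpos (one_le_jb ξ) (neg_nonpos.2 ?_)
    have : 0 ≤ 1 - ρ := sub_nonneg.2 hρ1
    positivity
  obtain ⟨K, hK, h⟩ := exists_lintegral_op_trig_le n hn hρ0 hρ1 hp1 hC σ hσ_smooth hσL
  have hp0 : 0 < p := one_pos.trans hp1
  refine ⟨K ^ (1 / p), by positivity, fun f hf hper => ?_⟩
  refine lpT_le_of_lintegral_le hp0 hK.le ?_ (hper.bddMeas hf.continuous)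
    (lintegral_Op_le (fun ξ => (hσ_smooth ξ).continuous) hσb hp0.le ofReal_ne_top h hf hper)
  rw [Op_eq_tsum]
  refine bddMeas_tsum (fun ξ => (hσ_smooth ξ).continuous.mul continuous_const)
    ((summable_norm_fc hf hper).mul_left C) fun x ξ => ?_
  rw [norm_mul]
  gcongr
  exact hσb x ξ
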